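/- There is an absolute constant C such that for every integer n ≥ 3, the number R(n) of ordered triples (p₁, p₂, p₃) of primes with p₁ + p₂ + p₃ = n satisfies |R(n) − 𝔖(n)·n²/(2(log n)³)| ≤ C·n²/(log n)⁴, where 𝔖(n) = ∏_{p | n} (1 − 1/(p−1)²) · ∏_{p ∤ n} (1 + 1/(p−1)³), the products running over the primes dividing n and not dividing n respectively. In particular, since 𝔖(n) ≥ 1 for odd n, every sufficiently large odd integer is the sum of three primes. -/

import Mathlib

open Real

/-- The number of ordered triples of primes summing to `n`. -/
noncomputable def ternaryGoldbachReps (n : ℕ) : ℕ :=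
  {t : ℕ × ℕ × ℕ | t.1.Prime ∧ t.2.1.Prime ∧ t.2.2.Prime ∧ t.1 + t.2.1 + t.2.2 = n}.ncard

/-- The singular series of the ternary Goldbach problem. -/
noncomputable def ternarySingularSeries (n : ℕ) : ℝ :=
  ∏' p : Nat.Primes,
    (if (p : ℕ) ∣ n then 1 - 1 / ((p : ℝ) - 1) ^ 2 else 1 + 1 / ((p : ℝ) - 1) ^ 3)

section LFunctionApprox

open Complex Filter Topology Set MeasureTheory

/-- The mean value of a Dirichlet character over a full period. -/
noncomputable def charMean {q : ℕ} [NeZero q] (χ : DirichletCharacter ℂ q) : ℂ :=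
  (∑ j : ZMod q, χ j) / q

lemma norm_charMean_le {q : ℕ} [NeZero q] (χ : DirichletCharacter ℂ q) : ‖charMean χ‖ ≤ 1 := by
  have hq : (0 : ℝ) < q := by exact_mod_cast Nat.pos_of_ne_zero (NeZero.ne q)
  rw [charMean, norm_div, Complex.norm_natCast, div_le_one hq]
  refine (norm_sum_le _ _).trans ((Finset.sum_le_sum fun j _ => χ.norm_le_one j).trans ?_)
  simp [ZMod.card]

lemma charMean_eq_zero {q : ℕ} [NeZero q] {χ : DirichletCharacter ℂ q} (hχ : χ ≠ 1) :
    charMean χ = 0 := by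
  rw [charMean, MulChar.sum_eq_zero_of_ne_one hχ, zero_div]

lemma sum_range_char_period {q : ℕ} [NeZero q] (χ : DirichletCharacter ℂ q) (m : ℕ) :
    ∑ k ∈ Finset.range q, χ ((m + k : ℕ) : ZMod q) = ∑ j : ZMod q, χ j := by
  have h1 : ∑ k ∈ Finset.range q, χ ((m + k : ℕ) : ZMod q)
      = ∑ j : ZMod q, χ ((m : ZMod q) + j) := by
    refine Finset.sum_bij' (fun k _ => (k : ZMod q)) (fun j _ => j.val) ?_ ?_ ?_ ?_ ?_
    · simp
    · intro j _; simpa using ZMod.val_lt j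
    · intro k hk
      exact ZMod.val_cast_of_lt (by simpa using hk)
    · intro j _; simp
    · intro k _; simp
  rw [h1]
  exact Fintype.sum_equiv (Equiv.addLeft (m : ZMod q)) _ _ fun j => rfl

lemma norm_sum_range_char_sub_le {q : ℕ} [NeZero q] (χ : DirichletCharacter ℂ q) (m : ℕ) :
    ‖∑ k ∈ Finset.range m, χ (k : ZMod q) - charMean χ * m‖ ≤ 2 * q := by
  have hq : 0 < q := Nat.pos_of_ne_zero (NeZero.ne q)
  have hqC : (q : ℂ) ≠ 0 := by exact_mod_cast hq.ne'
  set E : ℕ → ℂ := fun m => ∑ k ∈ Finset.range m, χ (k : ZMod q) - charMean χ * m with hE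
  have hper : Function.Periodic E q := by
    intro m
    simp only [hE]
    rw [Finset.sum_range_add, sum_range_char_period]
    have : charMean χ * q = ∑ j : ZMod q, χ j := by
      rw [charMean]; field_simp
    rw [← this]; push_cast; ring
  have h2 : E m = E (m % q) := (hper.map_mod_nat m).symm
  have h3 : ∀ r : ℕ, ‖E r‖ ≤ 2 * r := by
    intro r
    simp only [hE]
    refine (norm_sub_le _ _).trans ?_
    have ha : ‖∑ k ∈ Finset.range r, χ (k : ZMod q)‖ ≤ r := by
      refine (norm_sum_le _ _).trans ((Finset.sum_le_sum fun j _ => χ.norm_le_one _).trans ?_)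
      simp
    have hb : ‖charMean χ * r‖ ≤ r := by
      rw [norm_mul, Complex.norm_natCast]
      exact mul_le_of_le_one_left (Nat.cast_nonneg r) (norm_charMean_le χ)
    linarith
  change ‖E m‖ ≤ _
  rw [h2]
  refine (h3 _).trans ?_
  have : ((m % q : ℕ) : ℝ) ≤ q := by exact_mod_cast (Nat.mod_lt m hq).le
  linarith

lemma norm_sum_Ioc_char_sub_le {q : ℕ} [NeZero q] (χ : DirichletCharacter ℂ q) {M N : ℕ}
    (h : N ≤ M) :
    ‖∑ k ∈ Finset.Ioc N M, χ (k : ZMod q) - charMean χ * (M - N)‖ ≤ 4 * q := by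
  have h1 : ∑ k ∈ Finset.Ioc N M, χ (k : ZMod q)
      = ∑ k ∈ Finset.range (M + 1), χ (k : ZMod q) - ∑ k ∈ Finset.range (N + 1), χ (k : ZMod q) := by
    rw [eq_sub_iff_add_eq, add_comm, ← Finset.sum_union]
    · congr 1
      ext k; simp only [Finset.mem_union, Finset.mem_range, Finset.mem_Ioc]; omega
    · rw [Finset.disjoint_left]; intro k; simp only [Finset.mem_range, Finset.mem_Ioc]; omega
  have h2 := norm_sum_range_char_sub_le χ (M + 1)
  have h3 := norm_sum_range_char_sub_le χ (N + 1)
  have : ∑ k ∈ Finset.Ioc N M, χ (k : ZMod q) - charMean χ * (M - N)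
      = (∑ k ∈ Finset.range (M + 1), χ (k : ZMod q) - charMean χ * (M + 1 : ℕ))
        - (∑ k ∈ Finset.range (N + 1), χ (k : ZMod q) - charMean χ * (N + 1 : ℕ)) := by
    rw [h1]; push_cast; ring
  rw [this]
  refine (norm_sub_le _ _).trans ?_
  linarith

/-- The error in approximating the partial sums of `χ` beyond `N` by their mean. -/
noncomputable def charRem {q : ℕ} [NeZero q] (χ : DirichletCharacter ℂ q) (N : ℕ) (u : ℝ) : ℂ :=
  if (N : ℝ) < u then ∑ k ∈ Finset.Ioc N ⌊u⌋₊, χ (k : ZMod q) - charMean χ * (u - N) else 0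

lemma norm_charRem_le {q : ℕ} [NeZero q] (χ : DirichletCharacter ℂ q) (N : ℕ) (u : ℝ) :
    ‖charRem χ N u‖ ≤ 5 * q := by
  have hq : (1 : ℝ) ≤ q := by exact_mod_cast Nat.pos_of_ne_zero (NeZero.ne q)
  rw [charRem]
  split_ifs with h
  · have hNu : N ≤ ⌊u⌋₊ := Nat.le_floor h.le
    have h1 := norm_sum_Ioc_char_sub_le χ hNu
    have h0 : 0 ≤ u := (Nat.cast_nonneg N).trans h.le
    have h2 : ‖charMean χ * (u - ⌊u⌋₊ : ℂ)‖ ≤ 1 := by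
      rw [norm_mul]
      have : ‖(u - ⌊u⌋₊ : ℂ)‖ ≤ 1 := by
        rw [show (u - ⌊u⌋₊ : ℂ) = ((u - ⌊u⌋₊ : ℝ) : ℂ) by push_cast; ring, Complex.norm_real,
          Real.norm_eq_abs, abs_le]
        constructor
        · linarith [Nat.floor_le h0]
        · linarith [Nat.lt_floor_add_one u]
      exact mul_le_one₀ (norm_charMean_le χ) (norm_nonneg _) this
    have : ∑ k ∈ Finset.Ioc N ⌊u⌋₊, χ (k : ZMod q) - charMean χ * (u - N)
        = (∑ k ∈ Finset.Ioc N ⌊u⌋₊, χ (k : ZMod q) - charMean χ * (⌊u⌋₊ - N))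
          - charMean χ * (u - ⌊u⌋₊ : ℂ) := by ring
    rw [this]
    refine (norm_sub_le _ _).trans ?_
    linarith
  · simp

lemma measurable_charRem {q : ℕ} [NeZero q] (χ : DirichletCharacter ℂ q) (N : ℕ) :
    Measurable (charRem χ N) := by
  unfold charRem
  refine Measurable.ite measurableSet_Ioi ?_ measurable_const
  refine Measurable.sub ?_ ?_
  · exact (measurable_from_top (f := fun n : ℕ => ∑ k ∈ Finset.Ioc N n, χ (k : ZMod q))).comp
      Nat.measurable_floor
  · fun_prop

lemma differentiableAt_mellin_charRem {q : ℕ} [NeZero q] (χ : DirichletCharacter ℂ q) {N : ℕ}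
    (hN : 1 ≤ N) {s : ℂ} (hs : s.re < 0) : DifferentiableAt ℂ (mellin (charRem χ N)) s := by
  have hb : ∀ u, ‖charRem χ N u‖ ≤ 5 * q := norm_charRem_le χ N
  refine mellin_differentiableAt_of_isBigO_rpow (a := 0) (b := s.re - 1) ?_ ?_ hs ?_ (by linarith)
  · refine LocallyIntegrable.locallyIntegrableOn ?_ _
    refine (locallyIntegrable_const (5 * q : ℝ)).mono
      (measurable_charRem χ N).aestronglyMeasurable (ae_of_all _ fun u => ?_)
    exact (hb u).trans (le_abs_self _)
  · refine Asymptotics.IsBigO.of_bound (5 * q) (Eventually.of_forall fun u => ?_)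
    simpa using hb u
  · have : charRem χ N =ᶠ[𝓝[>] 0] fun _ => 0 := by
      have h1 : ∀ᶠ u : ℝ in 𝓝[>] 0, u < 1 :=
        nhdsWithin_le_nhds (Iio_mem_nhds one_pos)
      filter_upwards [h1] with u hu
      rw [charRem, if_neg]
      have : (1 : ℝ) ≤ N := by exact_mod_cast hN
      linarith
    exact this.trans_isBigO (Asymptotics.isBigO_zero _ _)

/-- `(s - 1) L(s, χ)`, continued to `s = 1`. -/
noncomputable def LFun₁ {q : ℕ} [NeZero q] (χ : DirichletCharacter ℂ q) : ℂ → ℂ :=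
  Function.update (fun s => (s - 1) * DirichletCharacter.LFunction χ s) 1 (charMean χ)

lemma differentiable_LFun₁ {q : ℕ} [NeZero q] (χ : DirichletCharacter ℂ q) :
    Differentiable ℂ (LFun₁ χ) := by
  have hne : ∀ s : ℂ, s ≠ 1 → DifferentiableAt ℂ (LFun₁ χ) s := by
    intro s hs
    refine DifferentiableAt.congr_of_eventuallyEq
      (f := fun s => (s - 1) * DirichletCharacter.LFunction χ s) ?_ ?_
    · exact ((differentiableAt_id.sub_const 1).mul
        (DirichletCharacter.differentiableAt_LFunction χ s (Or.inl hs)))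
    · filter_upwards [isOpen_ne.mem_nhds hs] with z hz
      simp [LFun₁, Function.update_of_ne hz]
  intro s
  by_cases hs : s = 1
  · subst hs
    refine (Complex.analyticAt_of_differentiable_on_punctured_nhds_of_continuousAt ?_ ?_).differentiableAt
    · filter_upwards [self_mem_nhdsWithin] with z hz using hne z hz
    · rw [LFun₁, continuousAt_update_same]
      have := ZMod.LFunction_residue_one (fun j : ZMod q => χ j)
      rw [charMean, Finset.sum_div]
      exact this
  · exact hne s hs

lemma integral_Ioi_sub_mul_cpow {N : ℕ} (hN : 1 ≤ N) {s : ℂ} (hs : 1 < s.re) :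
    IntegrableOn (fun t : ℝ => ((t : ℂ) - N) * (t : ℂ) ^ (-s - 1)) (Ioi (N : ℝ)) ∧
    s * ∫ t in Ioi (N : ℝ), ((t : ℂ) - N) * (t : ℂ) ^ (-s - 1) = (N : ℂ) ^ (1 - s) / (s - 1) := by
  have hN0 : (0 : ℝ) < N := by exact_mod_cast hN
  have hNC : (N : ℂ) ≠ 0 := by exact_mod_cast hN0.ne'
  have hs0 : s ≠ 0 := by rintro rfl; simp at hs; linarith
  have hs1 : s - 1 ≠ 0 := by
    intro h; rw [sub_eq_zero] at h; rw [h] at hs; simp at hs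
  have i1 : IntegrableOn (fun t : ℝ => (t : ℂ) ^ (-s)) (Ioi (N : ℝ)) :=
    integrableOn_Ioi_cpow_of_lt (by simpa using hs) hN0
  have i2 : IntegrableOn (fun t : ℝ => (t : ℂ) ^ (-s - 1)) (Ioi (N : ℝ)) :=
    integrableOn_Ioi_cpow_of_lt (by simp; linarith) hN0
  have heq : ∀ t ∈ Ioi (N : ℝ), ((t : ℂ) - N) * (t : ℂ) ^ (-s - 1)
      = (t : ℂ) ^ (-s) - N * (t : ℂ) ^ (-s - 1) := by
    intro t ht
    have ht0 : (t : ℂ) ≠ 0 := by exact_mod_cast (hN0.trans ht).ne'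
    rw [sub_mul, Complex.cpow_sub _ _ ht0, Complex.cpow_one]
    field_simp
  refine ⟨(i1.sub (i2.const_mul _)).congr_fun (fun t ht => (heq t ht).symm) measurableSet_Ioi, ?_⟩
  rw [setIntegral_congr_fun measurableSet_Ioi heq, integral_sub i1 (i2.const_mul _),
    integral_const_mul, integral_Ioi_cpow_of_lt (by simpa using hs) hN0,
    integral_Ioi_cpow_of_lt (by simp; linarith) hN0]
  have e1 : ((N : ℝ) : ℂ) ^ (-s + 1) = (N : ℂ) ^ (1 - s) := by
    rw [add_comm, ← sub_eq_add_neg]; norm_cast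
  have e2 : (N : ℂ) * ((N : ℝ) : ℂ) ^ (-s - 1 + 1) = (N : ℂ) ^ (1 - s) := by
    rw [Complex.cpow_sub _ _ hNC, Complex.cpow_one, sub_add_cancel, Complex.cpow_neg]
    push_cast; field_simp
  have h3 : -s - 1 + 1 ≠ 0 := by simpa using hs0
  have h4 : -s + 1 ≠ 0 := by
    rw [show -s + 1 = -(s - 1) by ring]; exact neg_ne_zero.mpr hs1
  rw [mul_div_assoc', mul_neg, e2, e1]
  rw [show -s + 1 = -(s - 1) by ring, show -s - 1 + 1 = -s by ring]
  field_simp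
  ring

lemma LSeries_tail_eq {q : ℕ} [NeZero q] (χ : DirichletCharacter ℂ q) {N : ℕ} (hN : 1 ≤ N)
    {s : ℂ} (hs : 1 < s.re) :
    DirichletCharacter.LFunction χ s - ∑ n ∈ Finset.Icc 1 N, χ (n : ZMod q) * (n : ℂ) ^ (-s)
      = charMean χ * ((N : ℂ) ^ (1 - s) / (s - 1)) + s * mellin (charRem χ N) (-s) := by
  have hN0 : (0 : ℝ) < N := by exact_mod_cast hN
  set a : ℕ → ℂ := fun n => if n ≤ N then 0 else χ (n : ZMod q) with ha
  set b : ℕ → ℂ := fun n => if n ≤ N then χ (n : ZMod q) else 0 with hb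
  have hbsupp : ∀ n ∉ Finset.range (N + 1), LSeries.term b s n = 0 := by
    intro n hn
    have : ¬ n ≤ N := by simpa [Nat.lt_succ_iff] using hn
    simp [LSeries.term, hb, this]
  have hχs : LSeriesSummable (fun n : ℕ => χ (n : ZMod q)) s :=
    DirichletCharacter.LSeriesSummable_of_one_lt_re χ hs
  have hbs : LSeriesSummable b s := summable_of_ne_finset_zero hbsupp
  have hab : a = (fun n : ℕ => χ (n : ZMod q)) - b := by
    ext n; simp only [ha, hb, Pi.sub_apply]; split_ifs <;> simp
  have has : LSeriesSummable a s := by rw [hab]; exact hχs.sub hbs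
  have hL : LSeries a s = DirichletCharacter.LFunction χ s
      - ∑ n ∈ Finset.Icc 1 N, χ (n : ZMod q) * (n : ℂ) ^ (-s) := by
    rw [hab, LSeries_sub hχs hbs, DirichletCharacter.LFunction_eq_LSeries χ hs]
    congr 1
    rw [LSeries, tsum_eq_sum hbsupp, Finset.sum_range_succ', LSeries.term_zero, add_zero]
    rw [Finset.range_eq_Ico, Finset.sum_Ico_add' (fun n => LSeries.term b s n) 0 N 1]
    refine Finset.sum_congr (by ext; simp) fun n hn => ?_
    have hn' := Finset.mem_Icc.mp hn
    rw [LSeries.term_of_ne_zero (by omega)]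
    simp only [hb, hn'.2, if_true]
    rw [Complex.cpow_neg, div_eq_mul_inv]
  have hsum : ∀ m : ℕ, ∑ k ∈ Finset.Icc 1 m, a k = ∑ k ∈ Finset.Ioc N m, χ (k : ZMod q) := by
    intro m
    rw [← Finset.sum_filter_add_sum_filter_not (Finset.Icc 1 m) (fun k => k ≤ N)]
    have h1 : ∑ k ∈ (Finset.Icc 1 m).filter (fun k => k ≤ N), a k = 0 := by
      refine Finset.sum_eq_zero fun k hk => ?_
      simp [ha, (Finset.mem_filter.mp hk).2]
    rw [h1, zero_add]
    refine Finset.sum_congr (by ext; simp; omega) fun k hk => ?_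
    have := (Finset.mem_Ioc.mp hk).1
    simp [ha, not_le.mpr this]
  have hint := LSeries_eq_mul_integral a zero_le_one (by simpa using hs) has ?_
  swap
  · refine Asymptotics.IsBigO.of_bound 1 (Eventually.of_forall fun n => ?_)
    rw [hsum]
    refine (norm_sum_le _ _).trans ((Finset.sum_le_sum fun j _ => χ.norm_le_one _).trans ?_)
    simp
  rw [← hL, hint]
  obtain ⟨hi, hI⟩ := integral_Ioi_sub_mul_cpow hN hs
  have hmc : MellinConvergent (charRem χ N) (-s) := by
    refine mellinConvergent_of_isBigO_rpow (a := 0) (b := -s.re - 1) ?_ ?_ (by simp; linarith) ?_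
      (by simp)
    · refine LocallyIntegrable.locallyIntegrableOn ?_ _
      refine (locallyIntegrable_const (5 * q : ℝ)).mono
        (measurable_charRem χ N).aestronglyMeasurable (ae_of_all _ fun u => ?_)
      exact (norm_charRem_le χ N u).trans (le_abs_self _)
    · refine Asymptotics.IsBigO.of_bound (5 * q) (Eventually.of_forall fun u => ?_)
      simpa using norm_charRem_le χ N u
    · have : charRem χ N =ᶠ[𝓝[>] 0] fun _ => 0 := by
        have h1 : ∀ᶠ u : ℝ in 𝓝[>] 0, u < 1 :=
          nhdsWithin_le_nhds (Iio_mem_nhds one_pos)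
        filter_upwards [h1] with u hu
        rw [charRem, if_neg]
        have : (1 : ℝ) ≤ N := by exact_mod_cast hN
        linarith
      exact this.trans_isBigO (Asymptotics.isBigO_zero _ _)
  have key : ∫ t in Ioi (1 : ℝ), (∑ k ∈ Finset.Icc 1 ⌊t⌋₊, a k) * (t : ℂ) ^ (-(s + 1))
      = charMean χ * (∫ t in Ioi (N : ℝ), ((t : ℂ) - N) * (t : ℂ) ^ (-s - 1))
        + mellin (charRem χ N) (-s) := by
    have hsub : Ioi (N : ℝ) ⊆ Ioi 0 := Ioi_subset_Ioi hN0.le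
    have hi' : IntegrableOn ((Ioi (N : ℝ)).indicator
        fun t : ℝ => charMean χ * (((t : ℂ) - N) * (t : ℂ) ^ (-s - 1))) (Ioi 0) := by
      have h1 : IntegrableOn (fun t : ℝ => charMean χ * (((t : ℂ) - N) * (t : ℂ) ^ (-s - 1)))
        (Ioi (N : ℝ)) := hi.const_mul _
      exact (h1.integrable_indicator measurableSet_Ioi).integrableOn
    have e1 : charMean χ * (∫ t in Ioi (N : ℝ), ((t : ℂ) - N) * (t : ℂ) ^ (-s - 1))
        = ∫ t in Ioi (0 : ℝ), (Ioi (N : ℝ)).indicator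
          (fun t : ℝ => charMean χ * (((t : ℂ) - N) * (t : ℂ) ^ (-s - 1))) t := by
      rw [setIntegral_indicator measurableSet_Ioi, inter_eq_right.mpr hsub, integral_const_mul]
    rw [e1, mellin, ← integral_add hi' hmc, ← setIntegral_eq_of_subset_of_forall_sdiff_eq_zero
      (s := Ioi (1 : ℝ)) (t := Ioi 0) measurableSet_Ioi (Ioi_subset_Ioi zero_le_one)]
    · refine setIntegral_congr_fun measurableSet_Ioi fun t ht => ?_
      have ht0 : (0 : ℝ) < t := ht
      simp only [hsum, charRem, indicator, mem_Ioi]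
      rw [show -(s + 1) = -s - 1 by ring]
      split_ifs with h
      · rw [smul_eq_mul]; ring
      · have : ⌊t⌋₊ ≤ N := Nat.floor_le_of_le (not_lt.mp h)
        simp [Finset.Ioc_eq_empty_of_le this]
    · intro t ht
      have h1 : ⌊t⌋₊ ≤ N := Nat.floor_le_of_le
        ((not_lt.mp ht.2).trans (by exact_mod_cast hN))
      simp only [hsum, Finset.Ioc_eq_empty_of_le h1, Finset.sum_empty, zero_mul]
  rw [key, mul_add, ← hI]
  ring

/-- Approximation of `L(s, χ)` by a partial sum in the half plane `Re s > 0`. -/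
theorem LFunction_sub_sum_eq {q : ℕ} [NeZero q] (χ : DirichletCharacter ℂ q) {N : ℕ} (hN : 1 ≤ N)
    {s : ℂ} (hs : 0 < s.re) (hs1 : s ≠ 1) :
    DirichletCharacter.LFunction χ s - ∑ n ∈ Finset.Icc 1 N, χ (n : ZMod q) * (n : ℂ) ^ (-s)
      = charMean χ * ((N : ℂ) ^ (1 - s) / (s - 1)) + s * mellin (charRem χ N) (-s) := by
  have hN0 : (N : ℂ) ≠ 0 := by exact_mod_cast (by omega : N ≠ 0)
  set f : ℂ → ℂ := fun s => LFun₁ χ s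
    - (s - 1) * ∑ n ∈ Finset.Icc 1 N, χ (n : ZMod q) * (n : ℂ) ^ (-s) - charMean χ * (N : ℂ) ^ (1 - s)
  set g : ℂ → ℂ := fun s => (s - 1) * (s * mellin (charRem χ N) (-s))
  have hU : IsOpen {s : ℂ | 0 < s.re} := isOpen_lt continuous_const Complex.continuous_re
  have hf : AnalyticOnNhd ℂ f {s : ℂ | 0 < s.re} := by
    refine DifferentiableOn.analyticOnNhd (fun z _ => ?_) hU
    refine DifferentiableAt.differentiableWithinAt ?_
    refine ((differentiable_LFun₁ χ z).sub (DifferentiableAt.mul (by fun_prop) ?_)).sub ?_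
    · refine DifferentiableAt.fun_sum fun n hn => ?_
      have : (n : ℂ) ≠ 0 := by
        have := (Finset.mem_Icc.mp hn).1
        exact_mod_cast (by omega : n ≠ 0)
      exact (differentiableAt_id.neg.const_cpow (Or.inl this)).const_mul _
    · exact (((differentiableAt_const _).sub differentiableAt_id).const_cpow (Or.inl hN0)).const_mul _
  have hg : AnalyticOnNhd ℂ g {s : ℂ | 0 < s.re} := by
    refine DifferentiableOn.analyticOnNhd (fun z hz => ?_) hU
    refine DifferentiableAt.differentiableWithinAt ?_
    have hm : DifferentiableAt ℂ (fun z => mellin (charRem χ N) (-z)) z := by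
      refine DifferentiableAt.comp z (f := fun z => -z)
        (differentiableAt_mellin_charRem χ hN ?_) (by fun_prop)
      simpa using hz
    exact DifferentiableAt.mul (by fun_prop) (differentiableAt_id.mul hm)
  have hpc : IsPreconnected {s : ℂ | 0 < s.re} := (convex_halfSpace_re_gt 0).isPreconnected
  have hev : f =ᶠ[𝓝 2] g := by
    have h1 : ∀ᶠ z : ℂ in 𝓝 2, 1 < z.re :=
      (isOpen_lt continuous_const Complex.continuous_re).mem_nhds (by simp)
    filter_upwards [h1] with z hz
    have hz1 : z ≠ 1 := by rintro rfl; simp at hz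
    have hz2 : z - 1 ≠ 0 := sub_ne_zero.mpr hz1
    have := LSeries_tail_eq χ hN hz
    simp only [f, g, LFun₁, Function.update_of_ne hz1]
    have h3 := congrArg (fun w => (z - 1) * w) this
    field_simp at h3
    linear_combination h3
  have := hf.eqOn_of_preconnected_of_eventuallyEq hg hpc (by simp) hev hs
  have hs2 : s - 1 ≠ 0 := sub_ne_zero.mpr hs1
  simp only [f, g, LFun₁, Function.update_of_ne hs1] at this
  apply mul_left_cancel₀ hs2
  field_simp
  linear_combination this

end LFunctionApprox

section LFunctionBounds

open Complex Filter Topology Set MeasureTheory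

lemma norm_mellin_charRem_le {q : ℕ} [NeZero q] (χ : DirichletCharacter ℂ q) {N : ℕ}
    (hN : 1 ≤ N) {s : ℂ} (hs : 0 < s.re) :
    ‖mellin (charRem χ N) (-s)‖ ≤ 5 * q * ((N : ℝ) ^ (-s.re) / s.re) := by
  have hN0 : (0 : ℝ) < N := by exact_mod_cast hN
  have hlt : -s.re - 1 < -1 := by linarith
  have hsub : Ioi (N : ℝ) ⊆ Ioi 0 := Ioi_subset_Ioi hN0.le
  rw [mellin, setIntegral_eq_of_subset_of_forall_sdiff_eq_zero measurableSet_Ioi hsub]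
  · have h1 : ‖∫ t in Ioi (N : ℝ), (t : ℂ) ^ (-s - 1) • charRem χ N t‖
        ≤ ∫ t in Ioi (N : ℝ), 5 * q * t ^ (-s.re - 1) := by
      refine norm_integral_le_of_norm_le
        ((integrableOn_Ioi_rpow_of_lt hlt hN0).const_mul _) ?_
      filter_upwards [ae_restrict_mem measurableSet_Ioi] with t ht
      have ht0 : 0 < t := hN0.trans ht
      rw [norm_smul, Complex.norm_cpow_eq_rpow_re_of_pos ht0, mul_comm]
      simp only [Complex.sub_re, Complex.neg_re, Complex.one_re]
      gcongr
      exact norm_charRem_le χ N t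
    refine h1.trans_eq ?_
    rw [integral_const_mul, integral_Ioi_rpow_of_lt hlt hN0, sub_add_cancel, neg_div_neg_eq]
  · intro t ht
    rw [charRem, if_neg (by simpa using ht.2), smul_zero]

/-- The analytic conductor of `χ` mod `q` at height `t`. -/
noncomputable def anCond (q : ℕ) (t : ℝ) : ℝ := q * (2 + |t|)

lemma two_le_anCond (q : ℕ) [NeZero q] (t : ℝ) : 2 ≤ anCond q t := by
  have hq : (1 : ℝ) ≤ q := by exact_mod_cast Nat.pos_of_ne_zero (NeZero.ne q)
  rw [anCond]
  nlinarith [abs_nonneg t]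

lemma norm_LFunction_le {δ : ℝ} (hδ : 0 < δ) (hδ2 : δ ≤ 1 / 2) :
    ∃ C : ℝ, 0 < C ∧ ∀ (q : ℕ) [NeZero q] (χ : DirichletCharacter ℂ q) (s : ℂ),
      1 - δ ≤ s.re → s.re ≤ 4 → s ≠ 1 →
      ‖DirichletCharacter.LFunction χ s‖
        ≤ C * anCond q s.im ^ (2 * δ) * (1 + ‖charMean χ‖ / ‖s - 1‖) := by
  refine ⟨2 * (22 + 1 / δ), by positivity, fun q _ χ s h1 h3 hs1 => ?_⟩
  have hq : (1 : ℝ) ≤ q := by exact_mod_cast Nat.pos_of_ne_zero (NeZero.ne q)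
  set T : ℝ := 2 + |s.im| with hT
  have hT2 : 2 ≤ T := by rw [hT]; linarith [abs_nonneg s.im]
  set N : ℕ := q * ⌈T⌉₊ with hNdef
  have hN1 : (q : ℝ) * T ≤ N := by
    rw [hNdef]; push_cast
    gcongr; exact Nat.le_ceil T
  have hN2 : (N : ℝ) ≤ 2 * (q * T) := by
    rw [hNdef]; push_cast
    have := Nat.ceil_lt_add_one (by linarith : 0 ≤ T)
    nlinarith
  have hNr : (1 : ℝ) ≤ N := by nlinarith
  have hN : 1 ≤ N := by exact_mod_cast hNr
  have hσ : 1 / 2 ≤ s.re := by linarith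
  have hκ : 0 ≤ ‖charMean χ‖ / ‖s - 1‖ := by positivity
  have hNd : (1 : ℝ) ≤ (N : ℝ) ^ δ := Real.one_le_rpow hNr hδ.le
  have hN1σ : (N : ℝ) ^ (1 - s.re) ≤ (N : ℝ) ^ δ :=
    Real.rpow_le_rpow_of_exponent_le hNr (by linarith)
  have hsum : ‖∑ n ∈ Finset.Icc 1 N, χ (n : ZMod q) * (n : ℂ) ^ (-s)‖
      ≤ (N : ℝ) ^ δ * (1 + Real.log N) := by
    have hh : ((harmonic N : ℚ) : ℝ) ≤ 1 + Real.log N := harmonic_le_one_add_log N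
    refine (norm_sum_le _ _).trans (le_trans ?_ (mul_le_mul_of_nonneg_left hh (by positivity)))
    rw [harmonic_eq_sum_Icc]
    push_cast
    rw [Finset.mul_sum]
    refine Finset.sum_le_sum fun n hn => ?_
    obtain ⟨hn1, hn2⟩ := Finset.mem_Icc.mp hn
    have hn0 : (0 : ℝ) < n := by exact_mod_cast hn1
    rw [norm_mul, Complex.norm_natCast_cpow_of_pos (by omega)]
    have e : (n : ℝ) ^ (-s).re ≤ (N : ℝ) ^ δ * (n : ℝ)⁻¹ := by
      calc (n : ℝ) ^ (-s).re ≤ (n : ℝ) ^ (δ - 1) :=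
            Real.rpow_le_rpow_of_exponent_le (by exact_mod_cast hn1) (by simp; linarith)
        _ = (n : ℝ) ^ δ * (n : ℝ)⁻¹ := by
            rw [Real.rpow_sub hn0, Real.rpow_one, div_eq_mul_inv]
        _ ≤ _ := by gcongr
    calc _ ≤ 1 * (n : ℝ) ^ (-s).re := by gcongr; exact χ.norm_le_one _
      _ ≤ _ := by rw [one_mul]; exact e
  have hlog : Real.log N ≤ (N : ℝ) ^ δ / δ := Real.log_le_rpow_div (by positivity) hδ
  have hrem : ‖s * mellin (charRem χ N) (-s)‖ ≤ 20 * (N : ℝ) ^ δ := by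
    rw [norm_mul]
    have hs : ‖s‖ ≤ 2 * T := by
      refine (Complex.norm_le_abs_re_add_abs_im s).trans ?_
      rw [abs_of_nonneg (by linarith), hT]; linarith [abs_nonneg s.im]
    calc ‖s‖ * ‖mellin (charRem χ N) (-s)‖
        ≤ (2 * T) * (5 * q * ((N : ℝ) ^ (-s.re) / (1 / 2))) := by
          gcongr
          refine (norm_mellin_charRem_le χ hN (by linarith)).trans ?_
          gcongr
      _ = 20 * ((q * T) * (N : ℝ) ^ (-s.re)) := by ring
      _ ≤ 20 * (N * (N : ℝ) ^ (-s.re)) := by gcongr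
      _ = 20 * (N : ℝ) ^ (1 - s.re) := by
          rw [sub_eq_add_neg, Real.rpow_add (by linarith), Real.rpow_one]
      _ ≤ _ := by gcongr
  have hpole : ‖charMean χ * ((N : ℂ) ^ (1 - s) / (s - 1))‖
      ≤ (N : ℝ) ^ δ * (‖charMean χ‖ / ‖s - 1‖) := by
    rw [norm_mul, norm_div, Complex.norm_natCast_cpow_of_pos (by omega)]
    simp only [Complex.sub_re, Complex.one_re]
    rw [mul_div_left_comm]
    gcongr
  have hfin : ((N : ℝ) ^ δ) * (N : ℝ) ^ δ ≤ 2 * anCond q s.im ^ (2 * δ) := by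
    rw [← Real.rpow_add (by linarith), ← two_mul]
    calc (N : ℝ) ^ (2 * δ) ≤ (2 * (q * T)) ^ (2 * δ) := by gcongr
      _ = 2 ^ (2 * δ) * anCond q s.im ^ (2 * δ) := by
          rw [Real.mul_rpow (by norm_num) (by positivity), anCond]
      _ ≤ 2 ^ (1 : ℝ) * anCond q s.im ^ (2 * δ) := by
          have : 0 ≤ anCond q s.im := by linarith [two_le_anCond q s.im]
          gcongr
          · norm_num
          · linarith
      _ = _ := by rw [Real.rpow_one]
  have heq := LFunction_sub_sum_eq χ hN (by linarith : 0 < s.re) hs1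
  have htot : DirichletCharacter.LFunction χ s
      = ∑ n ∈ Finset.Icc 1 N, χ (n : ZMod q) * (n : ℂ) ^ (-s)
        + charMean χ * ((N : ℂ) ^ (1 - s) / (s - 1)) + s * mellin (charRem χ N) (-s) := by
    linear_combination heq
  rw [htot]
  have hA : ((N : ℝ) ^ δ * (1 + Real.log N)) ≤ (N : ℝ) ^ δ * ((N : ℝ) ^ δ * (1 + 1 / δ)) := by
    gcongr
    calc 1 + Real.log N ≤ (N : ℝ) ^ δ + (N : ℝ) ^ δ / δ := by gcongr
      _ = _ := by ring
  set X := (N : ℝ) ^ δ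
  set P := ‖charMean χ‖ / ‖s - 1‖
  calc _ ≤ X * (X * (1 + 1 / δ)) + X * P + 20 * X := by
        refine (norm_add₃_le).trans ?_
        gcongr
        exact hsum.trans hA
    _ ≤ X * X * (22 + 1 / δ) * (1 + P) := by
        have e1 : X ≤ X * X := by nlinarith
        have e2 : 0 ≤ 1 / δ := by positivity
        have e3 : X * P ≤ X * X * P := by gcongr
        have e4 : 0 ≤ X * X * (1 / δ) * P := by positivity
        have e5 : 0 ≤ X * X * P := by positivity
        nlinarith
    _ ≤ (2 * anCond q s.im ^ (2 * δ)) * (22 + 1 / δ) * (1 + P) := by gcongr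
    _ = _ := by ring

/-- The points at which the pole of a principal `L`-function plays no role. -/
def Harmless {q : ℕ} (χ : DirichletCharacter ℂ q) (t : ℝ) : Prop := χ ≠ 1 ∨ 1 / 2 ≤ |t|

lemma norm_LFunction_le_of_harmless {δ : ℝ} (hδ : 0 < δ) (hδ2 : δ ≤ 1 / 2) :
    ∃ C : ℝ, 0 < C ∧ ∀ (q : ℕ) [NeZero q] (χ : DirichletCharacter ℂ q) (s : ℂ),
      1 - δ ≤ s.re → s.re ≤ 4 → Harmless χ s.im →
      ‖DirichletCharacter.LFunction χ s‖ ≤ C * anCond q s.im ^ (2 * δ) := by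
  obtain ⟨C, hC, h⟩ := norm_LFunction_le hδ hδ2
  refine ⟨3 * C, by positivity, fun q _ χ s h1 h3 hH => ?_⟩
  have hc : 0 < anCond q s.im := by linarith [two_le_anCond q s.im]
  have hX : 0 < anCond q s.im ^ (2 * δ) := by positivity
  by_cases hχ : χ = 1
  · have ht : 1 / 2 ≤ |s.im| := hH.resolve_left (by simpa using hχ)
    have hs1 : s ≠ 1 := by rintro rfl; norm_num at ht
    refine (h q χ s h1 h3 hs1).trans ?_
    have h4 : 1 / 2 ≤ ‖s - 1‖ := by
      refine ht.trans ?_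
      simpa using Complex.abs_im_le_norm (s - 1)
    have h5 : ‖charMean χ‖ / ‖s - 1‖ ≤ 1 / (1 / 2) := by
      gcongr; exact norm_charMean_le χ
    calc _ ≤ C * anCond q s.im ^ (2 * δ) * (1 + 1 / (1 / 2)) := by gcongr
      _ = _ := by ring
  · suffices hle : ‖DirichletCharacter.LFunction χ s‖ ≤ C * anCond q s.im ^ (2 * δ) by
      nlinarith [mul_pos hC hX]
    by_cases hs1 : s = 1
    · subst hs1
      have hcont : ContinuousAt (fun x : ℝ => ‖DirichletCharacter.LFunction χ (1 + x)‖) 0 := by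
        have := (DirichletCharacter.differentiable_LFunction hχ).continuous
        fun_prop
      have hcont' : Tendsto (fun x : ℝ => ‖DirichletCharacter.LFunction χ (1 + x)‖) (𝓝[>] 0)
          (𝓝 ‖DirichletCharacter.LFunction χ 1‖) := by
        have := hcont.tendsto.mono_left (nhdsWithin_le_nhds (s := Ioi 0))
        simpa using this
      refine le_of_tendsto hcont' ?_
      have h1 : ∀ᶠ u : ℝ in 𝓝[>] 0, u < 1 := nhdsWithin_le_nhds (Iio_mem_nhds one_pos)
      filter_upwards [h1, self_mem_nhdsWithin] with x hx hx0
      have hx0' : (0 : ℝ) < x := hx0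
      have := h q χ (1 + x) (by simp; linarith) (by simp; linarith) (by simpa using hx0'.ne')
      simpa [charMean_eq_zero hχ] using this
    · have := h q χ s h1 h3 hs1
      simpa [charMean_eq_zero hχ] using this

end LFunctionBounds

section Estermann

open Complex Filter Topology Set
open scoped ComplexOrder

lemma iteratedDeriv_sub_one_inv_two (n : ℕ) :
    iteratedDeriv n (fun s : ℂ => (s - 1)⁻¹) 2 = (-1) ^ n * n.factorial := by
  have h := congrFun (iteratedDeriv_comp_sub_const n (fun s : ℂ => s⁻¹) 1) 2
  rw [h, iteratedDeriv_eq_iterate]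
  have := iter_deriv_inv n (2 - 1 : ℂ)
  rw [show (2 - 1 : ℂ) = 1 by norm_num, one_zpow, mul_one] at this
  rw [show (2 - 1 : ℂ) = 1 by norm_num]
  exact this

/-- Estermann's lemma: if a Dirichlet series with nonnegative coefficients and a simple pole at
`1` is nonpositive at some `β < 1`, then its residue is not too small. -/
lemma residue_lower_bound {b : ℕ → ℂ} (hb : 0 ≤ b) (habs : LSeries.abscissaOfAbsConv b < 2)
    (hb2 : 1 ≤ (LSeries b 2).re) {G : ℂ → ℂ} (hG : Differentiable ℂ G) {l K β : ℝ}
    (hGe : ∀ᶠ s in 𝓝 (2 : ℂ), G s = LSeries b s - l * (s - 1)⁻¹) (hK : 1 ≤ K)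
    (hbd : ∀ s ∈ Metric.sphere (2 : ℂ) (3 / 2), ‖G s‖ ≤ K) (hβ : 7 / 8 ≤ β) (hβ1 : β < 1)
    (hGβ : (G β).re ≤ l / (1 - β)) :
    (1 - β) / (16 * K ^ (4 * (1 - β))) ≤ l := by
  have hδ : 0 < 1 - β := by linarith
  set D : ℕ → ℝ := fun n => ((-1) ^ n * iteratedDeriv n (LSeries b) (2 : ℂ)).re with hD
  have hDnn : ∀ n, 0 ≤ D n := by
    intro n
    have := LSeries.iteratedDeriv_alternating hb (x := 2) (by exact_mod_cast habs) n
    simpa [hD] using (Complex.le_def.mp this).1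
  have hD0 : 1 ≤ D 0 := by simpa [hD] using hb2
  have hder : ∀ n, iteratedDeriv n G 2
      = iteratedDeriv n (LSeries b) 2 - l * ((-1) ^ n * n.factorial) := by
    intro n
    rw [Filter.EventuallyEq.iteratedDeriv_eq n hGe, iteratedDeriv_fun_sub,
      iteratedDeriv_const_mul_field, iteratedDeriv_sub_one_inv_two]
    · refine (LSeries_analyticOnNhd b 2 ?_).contDiffAt
      rw [Set.mem_ofPred_eq, Complex.re_ofNat]; exact_mod_cast habs
    · have : ContDiffAt ℂ n (fun s : ℂ => (s - 1)⁻¹) 2 :=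
        (contDiffAt_id.sub contDiffAt_const).inv (by norm_num)
      exact contDiffAt_const.mul this
  set g : ℕ → ℝ := fun n => ((n.factorial : ℝ)⁻¹ * D n - l) * (2 - β) ^ n with hg
  have hterm : ∀ n, ((n.factorial : ℂ)⁻¹ • ((β : ℂ) - 2) ^ n • iteratedDeriv n G 2).re = g n := by
    intro n
    have hf : (n.factorial : ℂ) ≠ 0 := by exact_mod_cast n.factorial_ne_zero
    have e : (n.factorial : ℂ)⁻¹ • ((β : ℂ) - 2) ^ n • iteratedDeriv n G 2
        = (((n.factorial : ℝ)⁻¹ * (2 - β) ^ n : ℝ) : ℂ)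
            * ((-1) ^ n * iteratedDeriv n (LSeries b) 2) - ((l * (2 - β) ^ n : ℝ) : ℂ) := by
      rw [hder, smul_eq_mul, smul_eq_mul, show (β : ℂ) - 2 = (-1) * (2 - β) by ring, mul_pow]
      have h1 : ((-1 : ℂ) ^ n) * (-1) ^ n = 1 := by rw [← mul_pow]; simp
      push_cast
      field_simp
      linear_combination (-(2 - (β : ℂ)) ^ n * n.factorial * l) * h1
    rw [e, Complex.sub_re, Complex.re_ofReal_mul, Complex.ofReal_re]
    simp only [hg, hD]; ring
  have hsum : HasSum g (G β).re := by
    have := Complex.hasSum_re (Complex.hasSum_taylorSeries_of_entire hG 2 β)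
    simpa only [hterm] using this
  have hgb : ∀ n, |g n| ≤ K * (3 / 4) ^ n := by
    intro n
    have hf : (0 : ℝ) < n.factorial := by exact_mod_cast n.factorial_pos
    rw [← hterm n]
    refine (Complex.abs_re_le_norm _).trans ?_
    rw [norm_smul, norm_smul, norm_inv, Complex.norm_natCast, norm_pow]
    have h1 : ‖(β : ℂ) - 2‖ ≤ 9 / 8 := by
      rw [show (β : ℂ) - 2 = ((β - 2 : ℝ) : ℂ) by push_cast; ring, Complex.norm_real,
        Real.norm_eq_abs, abs_le]
      constructor <;> linarith
    have h2 := Complex.norm_iteratedDeriv_le_of_forall_mem_sphere_norm_le n (by norm_num)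
      hG.diffContOnCl hbd
    calc (n.factorial : ℝ)⁻¹ * (‖(β : ℂ) - 2‖ ^ n * ‖iteratedDeriv n G 2‖)
        ≤ (n.factorial : ℝ)⁻¹ * ((9 / 8) ^ n * (n.factorial * K / (3 / 2) ^ n)) := by gcongr
      _ = K * ((9 / 8) ^ n / (3 / 2) ^ n) := by
          generalize (9 / 8 : ℝ) ^ n = x
          field_simp
      _ = K * (3 / 4) ^ n := by rw [← div_pow]; norm_num
  set M : ℕ := ⌈4 * Real.log (8 * K)⌉₊ with hM
  have hlogK : 0 < Real.log (8 * K) := Real.log_pos (by linarith)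
  have hM1 : 4 * Real.log (8 * K) ≤ M := Nat.le_ceil _
  have hM2 : (M : ℝ) < 4 * Real.log (8 * K) + 1 := Nat.ceil_lt_add_one (by positivity)
  have hMpos : 0 < M := by
    have : (0 : ℝ) < M := by linarith
    exact_mod_cast this
  have hsmall : 4 * K * (3 / 4 : ℝ) ^ M ≤ 1 / 2 := by
    have h1 : (3 / 4 : ℝ) ^ M ≤ Real.exp (-(1 / 4)) ^ M := by
      gcongr
      have := Real.add_one_le_exp (-(1 / 4 : ℝ))
      linarith
    have h2 : Real.exp (-(1 / 4)) ^ M ≤ (8 * K)⁻¹ := by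
      rw [← Real.exp_nat_mul, ← Real.exp_log (by positivity : 0 < (8 * K)⁻¹), Real.log_inv]
      gcongr
      linarith
    calc 4 * K * (3 / 4 : ℝ) ^ M ≤ 4 * K * (8 * K)⁻¹ := by gcongr; exact h1.trans h2
      _ = 1 / 2 := by field_simp; norm_num
  have htail : -(4 * K * (3 / 4 : ℝ) ^ M) ≤ ∑' i, g (i + M) := by
    have h1 : HasSum (fun i : ℕ => K * (3 / 4) ^ M * (3 / 4 : ℝ) ^ i) (K * (3 / 4) ^ M * 4) := by
      have := hasSum_geometric_of_lt_one (r := 3 / 4) (by norm_num) (by norm_num)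
      norm_num at this
      exact this.mul_left _
    have h2 : ‖∑' i, g (i + M)‖ ≤ K * (3 / 4) ^ M * 4 := by
      refine tsum_of_norm_bounded h1 fun i => ?_
      rw [Real.norm_eq_abs]
      refine (hgb _).trans_eq ?_
      rw [pow_add]; ring
    rw [Real.norm_eq_abs] at h2
    linarith [neg_le_of_abs_le h2]
  have hhead : 1 - l * (((2 - β) ^ M - 1) / (1 - β)) ≤ ∑ i ∈ Finset.range M, g i := by
    have h1 : ∑ i ∈ Finset.range M, (2 - β) ^ i = ((2 - β) ^ M - 1) / (1 - β) := by
      rw [geom_sum_eq (by linarith), show 2 - β - 1 = 1 - β by ring]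
    have h2 : 1 ≤ ∑ i ∈ Finset.range M, (i.factorial : ℝ)⁻¹ * D i * (2 - β) ^ i := by
      refine le_trans ?_ (Finset.single_le_sum (fun i _ => ?_) (Finset.mem_range.mpr hMpos))
      · simpa using hD0
      · have := hDnn i
        have : 0 < 2 - β := by linarith
        positivity
    simp only [hg, sub_mul, Finset.sum_sub_distrib]
    rw [← Finset.mul_sum, h1]
    linarith
  have htot := hsum.summable.sum_add_tsum_nat_add M
  rw [hsum.tsum_eq] at htot
  have hmain : 1 / 2 ≤ l * ((2 - β) ^ M / (1 - β)) := by
    have : l * (((2 - β) ^ M - 1) / (1 - β)) + l / (1 - β) = l * ((2 - β) ^ M / (1 - β)) := by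
      field_simp; ring
    linarith
  have hpow : (2 - β) ^ M ≤ 8 * K ^ (4 * (1 - β)) := by
    calc (2 - β) ^ M ≤ Real.exp (1 - β) ^ M := by
          have := Real.add_one_le_exp (1 - β)
          have h0 : 0 ≤ 2 - β := by linarith
          gcongr; linarith
      _ = Real.exp (M * (1 - β)) := by rw [← Real.exp_nat_mul]
      _ ≤ Real.exp ((4 * Real.log (8 * K) + 1) * (1 - β)) := by gcongr
      _ = Real.exp ((4 * Real.log 8 + 1) * (1 - β)) * K ^ (4 * (1 - β)) := by
          rw [Real.rpow_def_of_pos (by linarith), ← Real.exp_add,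
            Real.log_mul (by norm_num) (by linarith)]
          congr 1; ring
      _ ≤ 8 * K ^ (4 * (1 - β)) := by
          gcongr
          rw [← Real.le_log_iff_exp_le (by norm_num)]
          have : 2 * 0.69 < Real.log 8 := by
            rw [show (8 : ℝ) = 2 ^ 3 by norm_num, Real.log_pow]
            push_cast
            linarith [Real.log_two_gt_d9]
          nlinarith
  have hlpos : 0 < l := by
    by_contra h
    have : l * ((2 - β) ^ M / (1 - β)) ≤ 0 := by
      refine mul_nonpos_of_nonpos_of_nonneg (not_lt.mp h) ?_
      have : 0 < 2 - β := by linarith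
      positivity
    linarith
  have hKp : 0 < K ^ (4 * (1 - β)) := by positivity
  rw [div_le_iff₀ (by positivity)]
  have h3 : l * ((2 - β) ^ M / (1 - β)) ≤ l * (8 * K ^ (4 * (1 - β)) / (1 - β)) := by gcongr
  have h4 := hmain.trans h3
  rw [mul_div_assoc', le_div_iff₀ hδ] at h4
  linarith

end Estermann

section Quadratic

open Complex Filter Topology Set DirichletCharacter
open scoped ComplexOrder

lemma arithmeticFunction_mul_prime_pow (f g : ArithmeticFunction ℂ) {p : ℕ} (hp : p.Prime)
    (k : ℕ) :
    (f * g) (p ^ k) = ∑ i ∈ Finset.range (k + 1), f (p ^ i) * g (p ^ (k - i)) := by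
  rw [ArithmeticFunction.mul_apply,
    Nat.sum_divisorsAntidiagonal (f := fun a b => f a * g b), Nat.sum_divisors_prime_pow hp]
  refine Finset.sum_congr rfl fun i hi => ?_
  rw [Nat.pow_div (by simpa [Nat.lt_succ_iff] using hi) hp.pos]

lemma toArithmeticFunction_prime_pow {q : ℕ} (χ : DirichletCharacter ℂ q) {p : ℕ} (hp : p.Prime)
    (k : ℕ) : toArithmeticFunction (χ ·) (p ^ k) = χ p ^ k := by
  simp [toArithmeticFunction, hp.ne_zero]

lemma zetaMul_prime_pow {q : ℕ} (χ : DirichletCharacter ℂ q) {p : ℕ} (hp : p.Prime) (k : ℕ) :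
    zetaMul χ (p ^ k) = ∑ i ∈ Finset.range (k + 1), χ p ^ i := by
  rw [zetaMul, ArithmeticFunction.coe_zeta_mul_apply, Nat.sum_divisors_prime_pow hp]
  exact Finset.sum_congr rfl fun i _ => toArithmeticFunction_prime_pow χ hp i

/-- The Dirichlet coefficients of `ζ(s) L(s, χ₁) L(s, χ₂) L(s, χ₁χ₂)`. -/
noncomputable def biquadraticCoeff {q₁ q₂ q₃ : ℕ} (χ₁ : DirichletCharacter ℂ q₁)
    (χ₂ : DirichletCharacter ℂ q₂) (χ₃ : DirichletCharacter ℂ q₃) : ArithmeticFunction ℂ :=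
  zetaMul χ₁ * (toArithmeticFunction (χ₂ ·) * toArithmeticFunction (χ₃ ·))

lemma mul_prime_pow_of_mul {q₁ q₂ q₃ : ℕ} {χ₁ : DirichletCharacter ℂ q₁}
    {χ₂ : DirichletCharacter ℂ q₂} {χ₃ : DirichletCharacter ℂ q₃}
    (h : ∀ n : ℕ, χ₃ n = χ₁ n * χ₂ n) {p : ℕ} (hp : p.Prime) (k : ℕ) :
    (toArithmeticFunction (χ₂ ·) * toArithmeticFunction (χ₃ ·) : ArithmeticFunction ℂ) (p ^ k)
      = χ₂ p ^ k * zetaMul χ₁ (p ^ k) := by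
  rw [arithmeticFunction_mul_prime_pow _ _ hp, zetaMul_prime_pow χ₁ hp, Finset.mul_sum,
    ← Finset.sum_range_reflect]
  refine Finset.sum_congr rfl fun i hi => ?_
  have hi' : i ≤ k := by simpa [Nat.lt_succ_iff] using hi
  rw [toArithmeticFunction_prime_pow _ hp, toArithmeticFunction_prime_pow _ hp, h, mul_pow]
  rw [show k + 1 - 1 - i = k - i by omega, show k - (k - i) = i by omega]
  obtain ⟨j, rfl⟩ := Nat.exists_eq_add_of_le hi'
  rw [show i + j - i = j by omega, pow_add]; ring

lemma biquadraticCoeff_comm {q₁ q₂ q₃ : ℕ} (χ₁ : DirichletCharacter ℂ q₁)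
    (χ₂ : DirichletCharacter ℂ q₂) (χ₃ : DirichletCharacter ℂ q₃) :
    biquadraticCoeff χ₁ χ₂ χ₃ = biquadraticCoeff χ₂ χ₁ χ₃ := by
  simp only [biquadraticCoeff, zetaMul]; ring

lemma biquadraticCoeff_nonneg {q₁ q₂ q₃ : ℕ} {χ₁ : DirichletCharacter ℂ q₁}
    {χ₂ : DirichletCharacter ℂ q₂} {χ₃ : DirichletCharacter ℂ q₃} (h₁ : χ₁ ^ 2 = 1)
    (h₂ : χ₂ ^ 2 = 1) (h : ∀ n : ℕ, χ₃ n = χ₁ n * χ₂ n) (n : ℕ) :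
    0 ≤ biquadraticCoeff χ₁ χ₂ χ₃ n := by
  have hmul : (biquadraticCoeff χ₁ χ₂ χ₃).IsMultiplicative :=
    (isMultiplicative_zetaMul χ₁).mul
      ((isMultiplicative_toArithmeticFunction χ₂).mul (isMultiplicative_toArithmeticFunction χ₃))
  rcases eq_or_ne n 0 with rfl | hn
  · simp
  rw [hmul.multiplicative_factorization _ hn]
  refine Finset.prod_nonneg fun p hpn => ?_
  have hp := Nat.prime_of_mem_primeFactors hpn
  generalize n.factorization p = k
  have key : ∀ {a b : ℕ} (ψ₁ : DirichletCharacter ℂ a) (ψ₂ : DirichletCharacter ℂ b),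
      ψ₁ ^ 2 = 1 → (∀ n : ℕ, χ₃ n = ψ₁ n * ψ₂ n) →
      (∀ j, 0 ≤ ψ₂ p ^ j * zetaMul ψ₁ (p ^ j)) → 0 ≤ biquadraticCoeff ψ₁ ψ₂ χ₃ (p ^ k) := by
    intro a b ψ₁ ψ₂ h1 h3 hj
    rw [biquadraticCoeff, arithmeticFunction_mul_prime_pow _ _ hp]
    refine Finset.sum_nonneg fun i _ => mul_nonneg (zetaMul_prime_pow_nonneg h1 hp i) ?_
    rw [mul_prime_pow_of_mul h3 hp]
    exact hj _
  have nonneg_case : ∀ {a b : ℕ} (ψ₁ : DirichletCharacter ℂ a) (ψ₂ : DirichletCharacter ℂ b),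
      ψ₁ ^ 2 = 1 → (∀ n : ℕ, χ₃ n = ψ₁ n * ψ₂ n) → 0 ≤ ψ₂ p →
      0 ≤ biquadraticCoeff ψ₁ ψ₂ χ₃ (p ^ k) := by
    intro a b ψ₁ ψ₂ h1 h3 h0
    exact key ψ₁ ψ₂ h1 h3 fun j =>
      mul_nonneg (pow_nonneg h0 _) (zetaMul_prime_pow_nonneg h1 hp j)
  have hcomm : ∀ n : ℕ, χ₃ n = χ₂ n * χ₁ n := fun n => by rw [h, mul_comm]
  rcases MulChar.isQuadratic_iff_sq_eq_one.mpr h₂ p with hb | hb | hb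
  · exact nonneg_case χ₁ χ₂ h₁ h (by rw [hb])
  · exact nonneg_case χ₁ χ₂ h₁ h (by rw [hb]; exact zero_le_one)
  rcases MulChar.isQuadratic_iff_sq_eq_one.mpr h₁ p with ha | ha | ha
  · rw [biquadraticCoeff_comm]; exact nonneg_case χ₂ χ₁ h₂ hcomm (by rw [ha])
  · rw [biquadraticCoeff_comm]
    exact nonneg_case χ₂ χ₁ h₂ hcomm (by rw [ha]; exact zero_le_one)
  refine key χ₁ χ₂ h₁ h fun j => ?_
  rw [zetaMul_prime_pow χ₁ hp, ha, hb, neg_one_geom_sum]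
  split_ifs with hj
  · simp
  · have : Even j := by simpa [Nat.even_add_one] using hj
    rw [this.neg_one_pow]; simp

lemma LFunction_im_eq_zero {q : ℕ} [NeZero q] {χ : DirichletCharacter ℂ q} (h2 : χ ^ 2 = 1)
    (hχ : χ ≠ 1) (x : ℝ) : (LFunction χ x).im = 0 := by
  have hd := differentiable_LFunction hχ
  set g : ℂ → ℂ := fun s => LFunction χ s - (starRingEnd ℂ) (LFunction χ ((starRingEnd ℂ) s))
  have hg : Differentiable ℂ g := by
    refine hd.sub fun z => ?_
    have := DifferentiableAt.conj_conj (hd ((starRingEnd ℂ) z))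
    rw [Complex.conj_conj] at this
    exact this
  have hreal : ∀ y : ℝ, 1 < y → (LFunction χ y).im = 0 := by
    intro y hy
    have hy' : 1 < (y : ℂ).re := by simpa using hy
    rw [LFunction_eq_LSeries χ hy', LSeries, Complex.im_tsum (LSeriesSummable_of_one_lt_re χ hy')]
    have hz : ∀ n, (LSeries.term (fun n : ℕ => χ n) y n).im = 0 := by
      intro n
      rw [LSeries.term_def]
      split_ifs
      · simp
      · rw [← Complex.ofReal_natCast, ← Complex.ofReal_cpow (Nat.cast_nonneg n), Complex.div_ofReal_im]
        rcases MulChar.isQuadratic_iff_sq_eq_one.mpr h2 n with h | h | h <;> simp [h]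
    simp [hz]
  have hfreq : ∃ᶠ z in 𝓝[≠] (2 : ℂ), g z = 0 := by
    have ht : Tendsto (fun y : ℝ => (y : ℂ)) (𝓝[>] 2) (𝓝[≠] 2) := by
      refine tendsto_nhdsWithin_iff.mpr ⟨?_, ?_⟩
      · exact ((Complex.continuous_ofReal.tendsto' 2 2 (by simp))).mono_left nhdsWithin_le_nhds
      · filter_upwards [self_mem_nhdsWithin] with y hy
        have hy' : (2 : ℝ) < y := hy
        have : y ≠ 2 := hy'.ne'
        simpa using (by exact_mod_cast this : (y : ℂ) ≠ 2)
    refine ht.frequently (Eventually.frequently ?_)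
    filter_upwards [self_mem_nhdsWithin] with y hy
    have hy' : (2 : ℝ) < y := hy
    simp only [g, Complex.conj_ofReal]
    rw [sub_eq_zero, eq_comm, Complex.conj_eq_iff_im]
    exact hreal y (by linarith)
  have h0 : g x = 0 :=
    AnalyticOnNhd.eqOn_zero_of_preconnected_of_frequently_eq_zero
      (f := g) (U := univ) (fun z _ => hg.analyticAt z) isPreconnected_univ (mem_univ _) hfreq
      (mem_univ (x : ℂ))
  simp only [g, Complex.conj_ofReal] at h0
  rwa [sub_eq_zero, eq_comm, Complex.conj_eq_iff_im] at h0

lemma charMean_modOne : charMean (1 : DirichletCharacter ℂ 1) = 1 := by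
  simp only [charMean, Finset.univ_unique, Finset.sum_singleton, Nat.cast_one, div_one]
  exact (congrArg _ (Subsingleton.elim _ _)).trans (map_one (1 : DirichletCharacter ℂ 1))

/-- Lower bound for `A(1)` when `ζ A` has nonnegative coefficients and is nonpositive at some
`β < 1`. -/
lemma exists_value_one_lower_bound : ∃ C : ℝ, 1 ≤ C ∧ ∀ (b : ℕ → ℂ) (A : ℂ → ℂ) (B β l : ℝ),
    0 ≤ b → (∀ s : ℂ, 1 < s.re → LSeriesSummable b s) → b 1 = 1 →
    (∀ s : ℂ, 1 < s.re → LSeries b s = riemannZeta s * A s) → Differentiable ℂ A → A 1 = l →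
    1 ≤ B → (∀ s ∈ Metric.closedBall (2 : ℂ) (3 / 2), ‖A s‖ ≤ B) → 7 / 8 ≤ β → β < 1 →
    (riemannZeta β * A β).re ≤ 0 → (1 - β) / (16 * (C * B) ^ (4 * (1 - β))) ≤ l := by
  set Z : ℂ → ℂ := LFun₁ (1 : DirichletCharacter ℂ 1) with hZ
  have hZd : Differentiable ℂ Z := differentiable_LFun₁ _
  have hZs : ∀ s : ℂ, s ≠ 1 → Z s = (s - 1) * riemannZeta s := by
    intro s hs
    simp [hZ, LFun₁, Function.update_of_ne hs]
  have hZ1 : Z 1 = 1 := by simp [hZ, LFun₁, charMean_modOne]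
  obtain ⟨C, hC⟩ := (isCompact_closedBall (2 : ℂ) (3 / 2)).exists_bound_of_continuousOn
    hZd.continuous.continuousOn
  have hC0 : 0 ≤ C := (norm_nonneg _).trans (hC 2 (by norm_num))
  refine ⟨2 * (C + 1), by linarith, fun b A B β l hb hbs hb1 hLb hA hA1 hB hAB hβ hβ1 hneg => ?_⟩
  set H : ℂ → ℂ := fun s => Z s * A s
  have hH : Differentiable ℂ H := hZd.mul hA
  have hH1 : H 1 = l := by simp [H, hZ1, hA1]
  have hGd : Differentiable ℂ (dslope H 1) := by
    have := (Complex.differentiableOn_dslope (f := H) (c := 1) (s := univ) univ_mem).mpr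
      hH.differentiableOn
    exact differentiableOn_univ.mp this
  have hGs : ∀ s : ℂ, s ≠ 1 → dslope H 1 s = riemannZeta s * A s - l * (s - 1)⁻¹ := by
    intro s hs
    have hs' : s - 1 ≠ 0 := sub_ne_zero.mpr hs
    rw [dslope_of_ne _ hs, slope_def_field, hH1]
    simp only [H, hZs s hs]
    field_simp
  have habs : LSeries.abscissaOfAbsConv b < 2 := by
    have : LSeries.abscissaOfAbsConv b ≤ ((3 / 2 : ℝ) : EReal) := by
      have := (hbs ((3 / 2 : ℝ) : ℂ) (by rw [Complex.ofReal_re]; norm_num)).abscissaOfAbsConv_le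
      rwa [Complex.ofReal_re] at this
    refine this.trans_lt ?_
    rw [show (2 : EReal) = ((2 : ℝ) : EReal) from rfl]
    exact EReal.coe_lt_coe_iff.mpr (by norm_num)
  have hb2 : 1 ≤ (LSeries b 2).re := by
    have hs := hbs 2 (by simp)
    have hnn : ∀ n, 0 ≤ (LSeries.term b 2 n).re := by
      intro n
      rw [LSeries.term_def]
      split_ifs with hn
      · simp
      · have h1 := hb n
        have h2 : (0 : ℂ) ≤ b n / (n : ℂ) ^ (2 : ℂ) := by
          rw [show ((2 : ℂ)) = ((2 : ℕ) : ℂ) by norm_num, Complex.cpow_natCast]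
          have : (0 : ℂ) ≤ ((n : ℂ) ^ 2)⁻¹ := by
            have : (((n : ℂ) ^ 2)⁻¹) = (((n : ℝ) ^ 2)⁻¹ : ℝ) := by push_cast; rfl
            rw [this]
            exact_mod_cast (by positivity : (0 : ℝ) ≤ ((n : ℝ) ^ 2)⁻¹)
          rw [div_eq_mul_inv]
          exact mul_nonneg h1 this
        exact (Complex.le_def.mp h2).1
    have h1 := (Complex.hasSum_re hs.hasSum)
    have h2 := le_hasSum h1 1 fun n _ => hnn n
    refine le_trans ?_ h2
    simp [hb1]
  have h1l : ‖(l : ℂ)‖ ≤ B := by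
    rw [← hA1]; refine hAB 1 ?_
    rw [Metric.mem_closedBall, dist_eq_norm]; norm_num
  refine residue_lower_bound hb habs hb2 hGd (l := l) ?_ ?_ ?_ hβ hβ1 ?_
  · filter_upwards [(isOpen_lt continuous_const Complex.continuous_re).mem_nhds
      (show (1 : ℝ) < (2 : ℂ).re by simp)] with s hs
    have hs' : 1 < s.re := hs
    rw [hGs s (by rintro rfl; simp at hs'), hLb s hs']
  · nlinarith
  · intro s hs
    have hsb : s ∈ Metric.closedBall (2 : ℂ) (3 / 2) := Metric.sphere_subset_closedBall hs
    have hs1 : 1 / 2 ≤ ‖s - 1‖ := by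
      rw [mem_sphere_iff_norm] at hs
      have := norm_sub_norm_le (s - 2) (-1)
      rw [hs] at this
      rw [show s - 1 = (s - 2) - (-1) by ring]
      norm_num at this ⊢
      linarith
    have hne : s ≠ 1 := by rintro rfl; norm_num at hs1
    have hHs : ‖H s‖ ≤ C * B := by
      rw [norm_mul]
      exact mul_le_mul (hC s hsb) (hAB s hsb) (norm_nonneg _) hC0
    rw [dslope_of_ne _ hne, slope_def_field, hH1, norm_div, div_le_iff₀ (by linarith)]
    calc ‖H s - l‖ ≤ C * B + B := (norm_sub_le _ _).trans (add_le_add hHs h1l)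
      _ = 2 * (C + 1) * B * (1 / 2) := by ring
      _ ≤ _ := by gcongr
  · have hβne : (β : ℂ) ≠ 1 := by exact_mod_cast hβ1.ne
    rw [hGs _ hβne, Complex.sub_re]
    have : ((l : ℂ) * ((β : ℂ) - 1)⁻¹).re = l * (β - 1)⁻¹ := by
      rw [show (l : ℂ) * ((β : ℂ) - 1)⁻¹ = ((l * (β - 1)⁻¹ : ℝ) : ℂ) by push_cast; rfl,
        Complex.ofReal_re]
    rw [this, show l / (1 - β) = -(l * (β - 1)⁻¹) by
      rw [← div_eq_mul_inv, ← div_neg, neg_sub]]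
    linarith

lemma riemannZeta_re_nonpos {β : ℝ} (h : 7 / 8 ≤ β) (h1 : β < 1) : (riemannZeta β).re ≤ 0 := by
  have hne : (β : ℂ) ≠ 1 := by exact_mod_cast h1.ne
  have hβ0 : 0 < (β : ℂ).re := by rw [Complex.ofReal_re]; linarith
  have heq := LFunction_sub_sum_eq (1 : DirichletCharacter ℂ 1) le_rfl hβ0 hne
  have hb := norm_mellin_charRem_le (1 : DirichletCharacter ℂ 1) le_rfl hβ0
  have hκ : charMean (1 : DirichletCharacter ℂ 1) = 1 := charMean_modOne
  simp only [LFunction_modOne_eq, hκ, Finset.Icc_self, Finset.sum_singleton, Nat.cast_one,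
    Complex.one_cpow, map_one, one_mul, mul_one, Real.one_rpow, Complex.ofReal_re] at heq hb
  have hz : riemannZeta β = 1 + 1 / ((β : ℂ) - 1)
      + β * mellin (charRem (1 : DirichletCharacter ℂ 1) 1) (-β) := by
    linear_combination heq
  have hn : ‖(β : ℂ) * mellin (charRem (1 : DirichletCharacter ℂ 1) 1) (-β)‖ ≤ 5 := by
    rw [norm_mul, Complex.norm_real, Real.norm_eq_abs, abs_of_nonneg (by linarith)]
    have : 0 < β := by linarith
    calc _ ≤ β * (5 * (1 / β)) := by gcongr
      _ = 5 := by field_simp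
  have hr : (1 / ((β : ℂ) - 1)).re = -(1 / (1 - β)) := by
    rw [show 1 / ((β : ℂ) - 1) = ((1 / (β - 1) : ℝ) : ℂ) by push_cast; rfl, Complex.ofReal_re,
      ← one_div_neg_eq_neg_one_div, neg_sub]
  have h8 : 8 ≤ 1 / (1 - β) := by
    rw [le_div_iff₀ (by linarith)]; linarith
  rw [hz, Complex.add_re, Complex.add_re, hr, Complex.one_re]
  have := (Complex.re_le_norm _).trans hn
  linarith

lemma LFunction_re_two_pos {q : ℕ} [NeZero q] {χ : DirichletCharacter ℂ q} :
    0 < (LFunction χ 2).re := by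
  have h2 : 1 < (2 : ℂ).re := by simp
  have h1 := Complex.hasSum_re (LSeriesSummable_of_one_lt_re χ h2).hasSum
  have h3 := le_hasSum (h1.add hasSum_zeta_two) 1 ?_
  · rw [show (∑' n, LSeries.term (fun n : ℕ => χ n) 2 n) = LFunction χ 2 from
      (LFunction_eq_LSeries χ h2).symm] at h3
    simp at h3
    have hπ := Real.pi_lt_d2
    nlinarith [Real.pi_pos]
  · intro n _
    have hle : ‖LSeries.term (fun n : ℕ => χ n) 2 n‖ ≤ 1 / (n : ℝ) ^ 2 := by
      rcases eq_or_ne n 0 with rfl | hn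
      · simp
      rw [LSeries.norm_term_eq, if_neg hn, Complex.re_ofNat]
      rw [show ((n : ℝ) ^ (2 : ℝ)) = (n : ℝ) ^ (2 : ℕ) from Real.rpow_natCast _ 2]
      gcongr
      exact χ.norm_le_one n
    have := (Complex.abs_re_le_norm _).trans hle
    linarith [(abs_le.mp this).1]

lemma LFunction_re_pos_of_ne_zero {q : ℕ} [NeZero q] {χ : DirichletCharacter ℂ q}
    (h2 : χ ^ 2 = 1) (hχ : χ ≠ 1) {β : ℝ} (hβ1 : β < 1)
    (h : ∀ x : ℝ, β ≤ x → x < 1 → LFunction χ x ≠ 0) : 0 < (LFunction χ β).re := by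
  by_contra! hneg
  have hc : ContinuousOn (fun x : ℝ => (LFunction χ x).re) (Icc β 2) :=
    (Complex.continuous_re.comp
      ((differentiable_LFunction hχ).continuous.comp Complex.continuous_ofReal)).continuousOn
  obtain ⟨x, hx, hx0⟩ := intermediate_value_Icc (by linarith : β ≤ 2) hc
    (show (0 : ℝ) ∈ Icc _ _ from ⟨hneg, by simpa using LFunction_re_two_pos.le⟩)
  have hz : LFunction χ x = 0 := Complex.ext hx0 (LFunction_im_eq_zero h2 hχ x)
  rcases lt_or_ge x 1 with h1 | h1
  · exact h x hx.1 h1 hz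
  · exact LFunction_ne_zero_of_one_le_re χ (Or.inl hχ) (by simpa using h1) hz

lemma exists_LFunction_bound_closedBall : ∃ C : ℝ, 1 ≤ C ∧ ∀ (q : ℕ) [NeZero q]
    (χ : DirichletCharacter ℂ q), χ ≠ 1 → ∀ s ∈ Metric.closedBall (2 : ℂ) (3 / 2),
    ‖LFunction χ s‖ ≤ C * q := by
  obtain ⟨C, hC, hb⟩ := norm_LFunction_le_of_harmless (δ := 1 / 2) (by norm_num) le_rfl
  refine ⟨4 * C + 1, by linarith, fun q _ χ hχ s hs => ?_⟩
  rw [mem_closedBall_iff_norm] at hs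
  have hre := abs_le.mp ((Complex.abs_re_le_norm _).trans hs)
  have him := (Complex.abs_im_le_norm _).trans hs
  simp only [Complex.sub_re, Complex.sub_im, Complex.re_ofNat, Complex.im_ofNat, sub_zero]
    at hre him
  have := hb q χ s (by linarith) (by linarith) (Or.inl hχ)
  refine this.trans ?_
  rw [show (2 * (1 / 2) : ℝ) = 1 by norm_num, Real.rpow_one, anCond]
  have hq : (0 : ℝ) ≤ q := Nat.cast_nonneg q
  have : q * (2 + |s.im|) ≤ (q : ℝ) * 4 := by gcongr; linarith
  nlinarith

end Quadratic

section Siegel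

open Complex Filter Topology Set DirichletCharacter
open scoped ComplexOrder

lemma LSeriesSummable_toArithmeticFunction {q : ℕ} (χ : DirichletCharacter ℂ q) {s : ℂ}
    (hs : 1 < s.re) : LSeriesSummable (fun n => toArithmeticFunction (χ ·) n) s :=
  (LSeriesSummable_congr s fun {n} hn => by simp [toArithmeticFunction, hn]).mpr
    (LSeriesSummable_of_one_lt_re χ hs)

lemma LSeries_toArithmeticFunction {q : ℕ} [NeZero q] (χ : DirichletCharacter ℂ q) {s : ℂ}
    (hs : 1 < s.re) : LSeries (fun n => toArithmeticFunction (χ ·) n) s = LFunction χ s := by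
  rw [LFunction_eq_LSeries χ hs]
  exact LSeries_congr (fun {n} hn => by simp [toArithmeticFunction, hn]) s

lemma LSeries_zetaMul {q : ℕ} [NeZero q] (χ : DirichletCharacter ℂ q) {s : ℂ} (hs : 1 < s.re) :
    LSeries (fun n => zetaMul χ n) s = riemannZeta s * LFunction χ s := by
  rw [← LSeries_toArithmeticFunction χ hs, ← ArithmeticFunction.LSeries_zeta_eq_riemannZeta hs]
  exact ArithmeticFunction.LSeries_mul' (ArithmeticFunction.LSeriesSummable_zeta_iff.mpr hs)
    (LSeriesSummable_toArithmeticFunction χ hs)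

lemma LSeriesSummable_biquadraticCoeff {q₁ q₂ q₃ : ℕ} (χ₁ : DirichletCharacter ℂ q₁)
    (χ₂ : DirichletCharacter ℂ q₂) (χ₃ : DirichletCharacter ℂ q₃) {s : ℂ} (hs : 1 < s.re) :
    LSeriesSummable (fun n => biquadraticCoeff χ₁ χ₂ χ₃ n) s :=
  ArithmeticFunction.LSeriesSummable_mul (LSeriesSummable_zetaMul χ₁ hs)
    (ArithmeticFunction.LSeriesSummable_mul (LSeriesSummable_toArithmeticFunction χ₂ hs)
      (LSeriesSummable_toArithmeticFunction χ₃ hs))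

lemma LSeries_biquadraticCoeff {q₁ q₂ q₃ : ℕ} [NeZero q₁] [NeZero q₂] [NeZero q₃]
    (χ₁ : DirichletCharacter ℂ q₁) (χ₂ : DirichletCharacter ℂ q₂) (χ₃ : DirichletCharacter ℂ q₃)
    {s : ℂ} (hs : 1 < s.re) : LSeries (fun n => biquadraticCoeff χ₁ χ₂ χ₃ n) s =
      riemannZeta s * (LFunction χ₁ s * LFunction χ₂ s * LFunction χ₃ s) := by
  have h2 := LSeriesSummable_toArithmeticFunction χ₂ hs
  have h3 := LSeriesSummable_toArithmeticFunction χ₃ hs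
  have := ArithmeticFunction.LSeries_mul' (LSeriesSummable_zetaMul χ₁ hs)
    (ArithmeticFunction.LSeriesSummable_mul h2 h3)
  rw [ArithmeticFunction.LSeries_mul' h2 h3, LSeries_zetaMul χ₁ hs,
    LSeries_toArithmeticFunction χ₂ hs, LSeries_toArithmeticFunction χ₃ hs] at this
  rw [biquadraticCoeff, this]; ring

lemma value_one_lower_bound_quadratic : ∃ C : ℝ, 1 ≤ C ∧ ∀ (q : ℕ) [NeZero q]
    (χ : DirichletCharacter ℂ q), χ ^ 2 = 1 → χ ≠ 1 → ∀ β : ℝ, 7 / 8 ≤ β → β < 1 →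
    0 ≤ (LFunction χ β).re → (1 - β) / (16 * (C * q) ^ (4 * (1 - β))) ≤ ‖LFunction χ 1‖ := by
  obtain ⟨C₁, hC₁, h₁⟩ := exists_value_one_lower_bound
  obtain ⟨C₂, hC₂, h₂⟩ := exists_LFunction_bound_closedBall
  refine ⟨C₁ * C₂, one_le_mul_of_one_le_of_one_le hC₁ hC₂, fun q _ χ hχ2 hχ β hβ hβ1 hneg => ?_⟩
  have hq : (1 : ℝ) ≤ q := by exact_mod_cast NeZero.one_le
  have hreal : LFunction χ 1 = ((LFunction χ 1).re : ℝ) :=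
    Complex.ext (by simp) (by simpa using LFunction_im_eq_zero hχ2 hχ 1)
  have key := h₁ (fun n => zetaMul χ n) (LFunction χ) (C₂ * q) β (LFunction χ 1).re
    (fun n => zetaMul_nonneg hχ2 n) (fun s hs => LSeriesSummable_zetaMul χ hs)
    (isMultiplicative_zetaMul χ).map_one ?_ (differentiable_LFunction hχ) hreal
    (one_le_mul_of_one_le_of_one_le hC₂ hq) (h₂ q χ hχ) hβ hβ1 ?_
  · rw [mul_assoc]
    exact key.trans (Complex.re_le_norm _)
  · exact fun s hs => LSeries_zetaMul χ hs
  · rw [Complex.mul_re, LFunction_im_eq_zero hχ2 hχ β, mul_zero, sub_zero]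
    exact mul_nonpos_of_nonpos_of_nonneg (riemannZeta_re_nonpos hβ hβ1) hneg

lemma LFunction_eq_ofReal {q : ℕ} [NeZero q] {χ : DirichletCharacter ℂ q} (h2 : χ ^ 2 = 1)
    (hχ : χ ≠ 1) (x : ℝ) : LFunction χ x = ((LFunction χ x).re : ℝ) :=
  Complex.ext (by simp) (by simpa using LFunction_im_eq_zero h2 hχ x)

lemma value_one_lower_bound_biquadratic : ∃ C : ℝ, 1 ≤ C ∧ ∀ (q₁ q₂ q₃ : ℕ) [NeZero q₁]
    [NeZero q₂] [NeZero q₃] (χ₁ : DirichletCharacter ℂ q₁) (χ₂ : DirichletCharacter ℂ q₂)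
    (χ₃ : DirichletCharacter ℂ q₃), χ₁ ^ 2 = 1 → χ₁ ≠ 1 → χ₂ ^ 2 = 1 → χ₂ ≠ 1 → χ₃ ^ 2 = 1 →
    χ₃ ≠ 1 → (∀ n : ℕ, χ₃ n = χ₁ n * χ₂ n) → ∀ β : ℝ, 7 / 8 ≤ β → β < 1 → LFunction χ₁ β = 0 →
    (1 - β) / (16 * (C * (q₁ * q₂ * q₃)) ^ (4 * (1 - β))) ≤
      ‖LFunction χ₁ 1‖ * ‖LFunction χ₂ 1‖ * ‖LFunction χ₃ 1‖ := by
  obtain ⟨C₁, hC₁, h₁⟩ := exists_value_one_lower_bound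
  obtain ⟨C₂, hC₂, h₂⟩ := exists_LFunction_bound_closedBall
  refine ⟨C₁ * C₂ ^ 3, one_le_mul_of_one_le_of_one_le hC₁ (one_le_pow₀ hC₂), ?_⟩
  intro q₁ q₂ q₃ _ _ _ χ₁ χ₂ χ₃ h1 h1' h2 h2' h3 h3' hmul β hβ hβ1 h0
  have e1 := LFunction_eq_ofReal h1 h1' 1
  have e2 := LFunction_eq_ofReal h2 h2' 1
  have e3 := LFunction_eq_ofReal h3 h3' 1
  rw [Complex.ofReal_one] at e1 e2 e3
  have hc1 : (1 : ℝ) ≤ q₁ := by exact_mod_cast NeZero.one_le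
  have hc2 : (1 : ℝ) ≤ q₂ := by exact_mod_cast NeZero.one_le
  have hc3 : (1 : ℝ) ≤ q₃ := by exact_mod_cast NeZero.one_le
  have key := h₁ (fun n => biquadraticCoeff χ₁ χ₂ χ₃ n)
    (fun s => LFunction χ₁ s * LFunction χ₂ s * LFunction χ₃ s) ((C₂ * q₁) * (C₂ * q₂) * (C₂ * q₃)) β
    ((LFunction χ₁ 1).re * (LFunction χ₂ 1).re * (LFunction χ₃ 1).re)
    (fun n => biquadraticCoeff_nonneg h1 h2 hmul n)
    (fun s hs => LSeriesSummable_biquadraticCoeff χ₁ χ₂ χ₃ hs) ?_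
    (fun s hs => LSeries_biquadraticCoeff χ₁ χ₂ χ₃ hs)
    (((differentiable_LFunction h1').mul (differentiable_LFunction h2')).mul
      (differentiable_LFunction h3')) ?_ ?_ ?_ hβ hβ1 ?_
  · refine (le_of_eq ?_).trans (key.trans ?_)
    · congr 3; ring
    · rw [e1, e2, e3, Complex.norm_real, Complex.norm_real, Complex.norm_real, Complex.ofReal_re,
        Complex.ofReal_re, Complex.ofReal_re, ← norm_mul, ← norm_mul]
      exact le_abs_self _
  · exact ((isMultiplicative_zetaMul χ₁).mul ((isMultiplicative_toArithmeticFunction χ₂).mul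
      (isMultiplicative_toArithmeticFunction χ₃))).map_one
  · simp only [Complex.ofReal_mul]
    rw [← e1, ← e2, ← e3]
  · exact one_le_mul_of_one_le_of_one_le (one_le_mul_of_one_le_of_one_le
      (one_le_mul_of_one_le_of_one_le hC₂ hc1) (one_le_mul_of_one_le_of_one_le hC₂ hc2))
      (one_le_mul_of_one_le_of_one_le hC₂ hc3)
  · intro s hs
    simp only [norm_mul]
    gcongr
    · exact h₂ q₁ χ₁ h1' s hs
    · exact h₂ q₂ χ₂ h2' s hs
    · exact h₂ q₃ χ₃ h3' s hs
  · simp [h0]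

/-- **Siegel's theorem**. -/
theorem exists_siegel_lower_bound {ε : ℝ} (hε : 0 < ε) (hε1 : ε ≤ 1) : ∃ c : ℝ, 0 < c ∧
    ∀ (q : ℕ) [NeZero q] (χ : DirichletCharacter ℂ q), χ ^ 2 = 1 → χ ≠ 1 →
    c * (q : ℝ) ^ (-ε) ≤ ‖LFunction χ 1‖ := by
  obtain ⟨C, hC, hone⟩ := value_one_lower_bound_quadratic
  -- the conclusion at one fixed `β`
  have fixed : ∀ β : ℝ, 1 - ε / 32 ≤ β → β < 1 → ∀ (q : ℕ) [NeZero q] (χ : DirichletCharacter ℂ q),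
      χ ^ 2 = 1 → χ ≠ 1 → 0 ≤ (LFunction χ β).re →
      (1 - β) / (16 * C) * (q : ℝ) ^ (-ε) ≤ ‖LFunction χ 1‖ := by
    intro β hβ hβ1 q _ χ h2 hχ h0
    have hq : (1 : ℝ) ≤ q := by exact_mod_cast NeZero.one_le
    refine le_trans ?_ (hone q χ h2 hχ β (by linarith) hβ1 h0)
    rw [Real.mul_rpow (by linarith) (by linarith), Real.rpow_neg (by linarith), ← div_eq_mul_inv,
      div_div, mul_assoc]
    have hC' : C ^ (4 * (1 - β)) ≤ C := by
      conv_rhs => rw [← Real.rpow_one C]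
      exact Real.rpow_le_rpow_of_exponent_le hC (by linarith)
    have hq' : (q : ℝ) ^ (4 * (1 - β)) ≤ (q : ℝ) ^ ε :=
      Real.rpow_le_rpow_of_exponent_le hq (by linarith)
    have : 0 < 1 - β := by linarith
    gcongr
  by_cases H : ∃ (q₁ : ℕ) (_ : NeZero q₁) (χ₁ : DirichletCharacter ℂ q₁) (β : ℝ),
      χ₁ ^ 2 = 1 ∧ χ₁ ≠ 1 ∧ 1 - ε / 32 ≤ β ∧ β < 1 ∧ LFunction χ₁ β = 0
  swap
  · push Not at H
    refine ⟨(1 - (1 - ε / 32)) / (16 * C), by apply div_pos <;> linarith, fun q _ χ h2 hχ => ?_⟩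
    refine fixed _ le_rfl (by linarith) q χ h2 hχ (LFunction_re_pos_of_ne_zero h2 hχ (by linarith)
      fun x hx hx1 => H q _ χ x h2 hχ hx hx1).le
  obtain ⟨q₁, _, χ₁, β, h12, h1ne, hβ, hβ1, h0⟩ := H
  obtain ⟨C₂, hC₂, htwo⟩ := value_one_lower_bound_biquadratic
  obtain ⟨C₃, hC₃, hub⟩ := norm_LFunction_le_of_harmless (δ := ε / 8) (by linarith) (by linarith)
  have hβ0 : 0 < 1 - β := by linarith
  have hc1 : (1 : ℝ) ≤ q₁ := by exact_mod_cast NeZero.one_le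
  have hL1 : 0 < ‖LFunction χ₁ 1‖ := norm_pos_iff.mpr (LFunction_apply_one_ne_zero h1ne)
  set c₂ : ℝ := (1 - β) / (16 * (C₂ * q₁ ^ 2)) / (‖LFunction χ₁ 1‖ * (C₃ * (2 * q₁))) with hc₂
  have hc₂0 : 0 < c₂ := by positivity
  refine ⟨min ((1 - β) / (16 * C)) c₂, lt_min (by positivity) hc₂0, fun q _ χ h2 hχ => ?_⟩
  have hq : (1 : ℝ) ≤ q := by exact_mod_cast NeZero.one_le
  have hqε : 0 < (q : ℝ) ^ (-ε) := by positivity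
  have hd1 : q₁ ∣ q₁ * q := dvd_mul_right _ _
  have hd2 : q ∣ q₁ * q := dvd_mul_left _ _
  have : NeZero (q₁ * q) := ⟨mul_ne_zero (NeZero.ne _) (NeZero.ne _)⟩
  set ψ₁ := changeLevel hd1 χ₁ with hψ₁
  set ψ₂ := changeLevel hd2 χ with hψ₂
  have hψ₁2 : ψ₁ ^ 2 = 1 := by rw [hψ₁, ← map_pow, h12, map_one]
  have hψ₂2 : ψ₂ ^ 2 = 1 := by rw [hψ₂, ← map_pow, h2, map_one]
  by_cases hψ : ψ₁ * ψ₂ = 1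
  · have heq : ψ₁ = ψ₂ := by
      calc ψ₁ = ψ₁ * ψ₂ ^ 2 := by rw [hψ₂2, mul_one]
        _ = (ψ₁ * ψ₂) * ψ₂ := by rw [pow_two, mul_assoc]
        _ = ψ₂ := by rw [hψ, one_mul]
    have hβ' : (β : ℂ) ≠ 1 := by exact_mod_cast hβ1.ne
    have e1 := LFunction_changeLevel hd1 χ₁ (s := β) (Or.inl h1ne)
    have e2 := LFunction_changeLevel hd2 χ (s := β) (Or.inl hχ)
    rw [h0, zero_mul, ← hψ₁, heq, hψ₂, e2, mul_eq_zero] at e1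
    have hz : LFunction χ β = 0 := by
      refine e1.resolve_right (Finset.prod_ne_zero_iff.mpr fun p hp hz => ?_)
      have hpp := Nat.prime_of_mem_primeFactors hp
      have hn : ‖χ p * (p : ℂ) ^ (-(β : ℂ))‖ < 1 := by
        rw [norm_mul, Complex.norm_natCast_cpow_of_pos hpp.pos]
        have : (p : ℝ) ^ (-(β : ℂ)).re < 1 :=
          Real.rpow_lt_one_of_one_lt_of_neg (by exact_mod_cast hpp.one_lt)
            (by simp; linarith)
        have h1 := χ.norm_le_one p
        have : 0 ≤ (p : ℝ) ^ (-(β : ℂ)).re := by positivity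
        nlinarith [norm_nonneg (χ p)]
      rw [← sub_eq_zero.mp hz, norm_one] at hn
      exact lt_irrefl _ hn
    refine le_trans ?_ (fixed β hβ hβ1 q χ h2 hχ (by rw [hz]; simp))
    gcongr
    exact min_le_left _ _
  have hψ2 : (ψ₁ * ψ₂) ^ 2 = 1 := by rw [mul_pow, hψ₁2, hψ₂2, one_mul]
  have hmul : ∀ n : ℕ, (ψ₁ * ψ₂) n = χ₁ n * χ n := by
    intro n
    rw [MulChar.mul_apply]
    by_cases hu : IsUnit ((n : ℕ) : ZMod (q₁ * q))
    · have e1 := changeLevel_eq_cast_of_dvd χ₁ hd1 hu.unit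
      have e2 := changeLevel_eq_cast_of_dvd χ hd2 hu.unit
      rw [IsUnit.unit_spec, ZMod.cast_natCast hd1] at e1
      rw [IsUnit.unit_spec, ZMod.cast_natCast hd2] at e2
      rw [hψ₁, hψ₂, e1, e2]
    · rw [MulChar.map_nonunit _ hu, zero_mul, eq_comm, mul_eq_zero]
      rw [ZMod.isUnit_iff_coprime, Nat.coprime_mul_iff_right, not_and_or, ← ZMod.isUnit_iff_coprime,
        ← ZMod.isUnit_iff_coprime] at hu
      exact hu.imp (fun h => MulChar.map_nonunit _ h) (fun h => MulChar.map_nonunit _ h)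
  have key := htwo q₁ q (q₁ * q) χ₁ χ (ψ₁ * ψ₂) h12 h1ne h2 hχ hψ2 hψ hmul β (by linarith) hβ1 h0
  have hub' := hub (q₁ * q) (ψ₁ * ψ₂) 1 (by simp; linarith) (by simp) (Or.inl hψ)
  set E : ℝ := (q : ℝ) ^ (ε / 4) with hE
  have hE0 : 0 < E := by positivity
  have hE2 : (q : ℝ) ^ (-ε) ≤ 1 / E ^ 2 := by
    rw [Real.rpow_neg (by linarith), ← one_div, hE, ← Real.rpow_natCast, ← Real.rpow_mul (by linarith)]
    gcongr
    push_cast; linarith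
  have hpow1 : (C₂ * (q₁ * q * ((q₁ * q : ℕ) : ℝ))) ^ (4 * (1 - β)) ≤ C₂ * q₁ ^ 2 * E := by
    have : C₂ * (q₁ * q * ((q₁ * q : ℕ) : ℝ)) = (C₂ * q₁ ^ 2) * (q : ℝ) ^ 2 := by push_cast; ring
    have h1 : 1 ≤ C₂ * (q₁ : ℝ) ^ 2 := one_le_mul_of_one_le_of_one_le hC₂ (one_le_pow₀ hc1)
    rw [this, Real.mul_rpow (by positivity) (by positivity)]
    gcongr
    · conv_rhs => rw [← Real.rpow_one (C₂ * (q₁ : ℝ) ^ 2)]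
      exact Real.rpow_le_rpow_of_exponent_le h1 (by linarith)
    · rw [hE, ← Real.rpow_natCast, ← Real.rpow_mul (by linarith)]
      exact Real.rpow_le_rpow_of_exponent_le hq (by push_cast; linarith)
  have hpow2 : ‖LFunction (ψ₁ * ψ₂) 1‖ ≤ C₃ * (2 * q₁) * E := by
    refine hub'.trans ?_
    rw [mul_assoc]
    gcongr
    have : anCond (q₁ * q) (1 : ℂ).im = (2 * q₁) * q := by simp [anCond]; ring
    rw [this, Real.mul_rpow (by positivity) (by positivity), show 2 * (ε / 8) = ε / 4 by ring]
    gcongr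
    conv_rhs => rw [← Real.rpow_one (2 * (q₁ : ℝ))]
    exact Real.rpow_le_rpow_of_exponent_le (by linarith) (by linarith)
  have hpos : 0 < 16 * (C₂ * (q₁ * q * ((q₁ * q : ℕ) : ℝ))) ^ (4 * (1 - β)) := by
    push_cast
    have : (0 : ℝ) < q₁ := by linarith
    have : (0 : ℝ) < q := by linarith
    positivity
  have key2 : (1 - β) / (16 * (C₂ * q₁ ^ 2 * E)) ≤
      ‖LFunction χ₁ 1‖ * ‖LFunction χ 1‖ * (C₃ * (2 * q₁) * E) :=
    (div_le_div_of_nonneg_left hβ0.le hpos (by gcongr)).trans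
      (key.trans (mul_le_mul_of_nonneg_left hpow2 (by positivity)))
  have : c₂ / E ^ 2 ≤ ‖LFunction χ 1‖ := by
    rw [hc₂, div_div, div_div, div_le_iff₀ (by positivity)]
    rw [div_le_iff₀ (by positivity)] at key2
    linarith
  refine le_trans ?_ this
  rw [← mul_one_div c₂]
  exact mul_le_mul (min_le_right _ _) hE2 hqε.le hc₂0.le

end Siegel

section LowerBound

open Complex Filter Topology Set DirichletCharacter

lemma anCond_pos (q : ℕ) [NeZero q] (t : ℝ) : 0 < anCond q t := by
  linarith [two_le_anCond q t]

lemma anCond_rpow_le_two_mul {q : ℕ} [NeZero q] {δ : ℝ} (hδ : 0 < δ) (hδ2 : δ ≤ 1 / 2) {t T : ℝ}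
    (h : |t| ≤ 2 * |T| + 2) : anCond q t ^ (2 * δ) ≤ 2 * (anCond q T ^ δ) ^ 2 := by
  have h1 : anCond q t ≤ 2 * anCond q T := by
    rw [anCond, anCond]
    have hq : (0 : ℝ) ≤ q := Nat.cast_nonneg q
    nlinarith
  have hT := anCond_pos q T
  calc anCond q t ^ (2 * δ) ≤ (2 * anCond q T) ^ (2 * δ) := by
        gcongr
        exact (anCond_pos q t).le
    _ = 2 ^ (2 * δ) * (anCond q T ^ δ) ^ 2 := by
        rw [Real.mul_rpow (by norm_num) hT.le, ← Real.rpow_natCast (anCond q T ^ δ),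
          ← Real.rpow_mul hT.le, mul_comm δ]
        norm_num
    _ ≤ 2 * (anCond q T ^ δ) ^ 2 := by
        gcongr
        conv_rhs => rw [← Real.rpow_one 2]
        exact Real.rpow_le_rpow_of_exponent_le (by norm_num) (by linarith)

lemma one_le_anCond_rpow (q : ℕ) [NeZero q] (t : ℝ) {δ : ℝ} (hδ : 0 < δ) : 1 ≤ anCond q t ^ δ :=
  Real.one_le_rpow (by linarith [two_le_anCond q t]) hδ.le

lemma ne_one_of_harmless {q : ℕ} {χ : DirichletCharacter ℂ q} {z : ℂ} (h : Harmless χ z.im) :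
    z ≠ 1 ∨ χ ≠ 1 := by
  rcases h with h | h
  · exact Or.inr h
  · refine Or.inl ?_
    rintro rfl
    norm_num at h

lemma norm_deriv_LFunction_le {δ : ℝ} (hδ : 0 < δ) (hδ2 : δ ≤ 1 / 2) : ∃ C : ℝ, 1 ≤ C ∧
    ∀ (q : ℕ) [NeZero q] (χ : DirichletCharacter ℂ q) (T : ℝ) (z : ℂ), 1 - δ / 2 ≤ z.re →
      z.re ≤ 3 → |z.im| ≤ |T| + 1 → (χ ≠ 1 ∨ 3 / 4 ≤ |z.im|) →
      ‖deriv (LFunction χ) z‖ ≤ C * (anCond q T ^ δ) ^ 2 := by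
  obtain ⟨C, hC, hb⟩ := norm_LFunction_le_of_harmless hδ hδ2
  refine ⟨4 * C / δ + 1, by linarith [show 0 < 4 * C / δ by positivity], ?_⟩
  intro q _ χ T z h1 h3 hT hz
  have hball : ∀ w ∈ Metric.closedBall z (δ / 2), 1 - δ ≤ w.re ∧ w.re ≤ 4 ∧
      |w.im| ≤ 2 * |T| + 2 ∧ Harmless χ w.im := by
    intro w hw
    rw [mem_closedBall_iff_norm] at hw
    have hre := abs_le.mp ((Complex.abs_re_le_norm _).trans hw)
    have him := (Complex.abs_im_le_norm _).trans hw
    rw [Complex.sub_re] at hre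
    rw [Complex.sub_im] at him
    have h4 := abs_sub_abs_le_abs_sub w.im z.im
    have h5 := abs_sub_abs_le_abs_sub z.im w.im
    rw [abs_sub_comm] at h5
    refine ⟨by linarith, by linarith, by linarith [abs_nonneg T], hz.imp_right fun h => by linarith⟩
  have hd : ∀ w ∈ Metric.closedBall z (δ / 2), DifferentiableAt ℂ (LFunction χ) w := fun w hw =>
    differentiableAt_LFunction χ w (ne_one_of_harmless (hball w hw).2.2.2)
  have := Complex.norm_deriv_le_of_forall_mem_sphere_norm_le (c := z) (R := δ / 2)
    (f := LFunction χ) (C := C * (2 * (anCond q T ^ δ) ^ 2)) (by linarith) ?_ ?_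
  · refine this.trans ?_
    rw [show C * (2 * (anCond q T ^ δ) ^ 2) / (δ / 2) = 4 * C / δ * (anCond q T ^ δ) ^ 2 by
      field_simp; ring]
    gcongr
    linarith
  · refine DifferentiableOn.diffContOnCl fun w hw => ?_
    exact (hd w (Metric.closure_ball_subset_closedBall hw)).differentiableWithinAt
  · intro w hw
    obtain ⟨h1, h2, h3, h4⟩ := hball w (Metric.sphere_subset_closedBall hw)
    refine (hb q χ w h1 h2 h4).trans ?_
    gcongr
    exact anCond_rpow_le_two_mul hδ hδ2 h3

lemma norm_LFunction_sub_le {δ : ℝ} (hδ : 0 < δ) (hδ2 : δ ≤ 1 / 2) : ∃ C : ℝ, 1 ≤ C ∧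
    ∀ (q : ℕ) [NeZero q] (χ : DirichletCharacter ℂ q) (T : ℝ) (S : Set ℂ), Convex ℝ S →
      (∀ z ∈ S, 1 - δ / 2 ≤ z.re ∧ z.re ≤ 3 ∧ |z.im| ≤ |T| + 1 ∧ (χ ≠ 1 ∨ 3 / 4 ≤ |z.im|)) →
      ∀ s₁ ∈ S, ∀ s₂ ∈ S,
      ‖LFunction χ s₁ - LFunction χ s₂‖ ≤ C * (anCond q T ^ δ) ^ 2 * ‖s₁ - s₂‖ := by
  obtain ⟨C, hC, hb⟩ := norm_deriv_LFunction_le hδ hδ2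
  refine ⟨C, hC, fun q _ χ T S hS h s₁ h₁ s₂ h₂ => ?_⟩
  refine hS.norm_image_sub_le_of_norm_deriv_le (𝕜 := ℂ) (fun z hz => ?_) (fun z hz => ?_) h₂ h₁
  · refine differentiableAt_LFunction χ z (ne_one_of_harmless ((h z hz).2.2.2.imp_right ?_))
    intro h; linarith
  · obtain ⟨h1, h2, h3, h4⟩ := h z hz
    exact hb q χ T z h1 h2 h3 h4

/-- The quantitative form of the `3-4-1` inequality. -/
lemma norm_LFunction_pow_four_ge {δ : ℝ} (hδ : 0 < δ) (hδ2 : δ ≤ 1 / 2) : ∃ c : ℝ, 0 < c ∧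
    ∀ (q : ℕ) [NeZero q] (χ : DirichletCharacter ℂ q) (x t w : ℝ), 0 < x → x ≤ 1 → 0 < w → w ≤ 1 →
      (χ ^ 2 ≠ 1 ∨ w ≤ x ∨ w ≤ |t|) →
      c * x ^ 3 * w ≤ ‖LFunction χ (1 + x + I * t)‖ ^ 4 * (anCond q t ^ δ) ^ 8 := by
  obtain ⟨C, hC, hb⟩ := norm_LFunction_le hδ hδ2
  refine ⟨1 / ((4 * C) ^ 3 * (4 * C)), by positivity, fun q _ χ x t w hx hx1 hw hw1 h => ?_⟩
  set P := anCond q t ^ δ with hP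
  have hP0 : 0 < P := by rw [hP]; exact Real.rpow_pos_of_pos (anCond_pos q t) δ
  have hA : ‖LFunctionTrivChar q (1 + x)‖ ≤ 4 * C * P ^ 2 / x := by
    have := hb q 1 (1 + x) (by simp; linarith) (by simp; linarith) (by simp [hx.ne'])
    refine this.trans ?_
    rw [show ‖(1 + (x : ℂ)) - 1‖ = x by simp [abs_of_pos hx]]
    have h1 : anCond q (1 + (x : ℂ)).im ^ (2 * δ) ≤ 2 * P ^ 2 :=
      anCond_rpow_le_two_mul hδ hδ2 (by simp; positivity)
    have h2 : 1 + ‖charMean (1 : DirichletCharacter ℂ q)‖ / x ≤ 2 / x := by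
      rw [le_div_iff₀ hx, add_mul, div_mul_cancel₀ _ hx.ne']
      linarith [norm_charMean_le (1 : DirichletCharacter ℂ q)]
    calc _ ≤ C * (2 * P ^ 2) * (2 / x) := by gcongr
      _ = _ := by ring
  have hD : ‖LFunction (χ ^ 2) (1 + x + 2 * I * t)‖ ≤ 4 * C * P ^ 2 / w := by
    have him : (1 + (x : ℂ) + 2 * I * t).im = 2 * t := by simp
    have hre : (1 + (x : ℂ) + 2 * I * t).re = 1 + x := by simp
    have := hb q (χ ^ 2) (1 + x + 2 * I * t) (by rw [hre]; linarith) (by rw [hre]; linarith)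
      (fun h => by have := congrArg Complex.re h; rw [hre, Complex.one_re] at this; linarith)
    refine this.trans ?_
    have h1 : anCond q (1 + (x : ℂ) + 2 * I * t).im ^ (2 * δ) ≤ 2 * P ^ 2 :=
      anCond_rpow_le_two_mul hδ hδ2 (by rw [him, abs_mul]; norm_num)
    have h2 : 1 + ‖charMean (χ ^ 2)‖ / ‖(1 + (x : ℂ) + 2 * I * t) - 1‖ ≤ 2 / w := by
      have hw' : 1 ≤ 1 / w := by rw [le_div_iff₀ hw]; linarith
      have e : 2 / w = 1 / w + 1 / w := by ring
      rcases h with h | h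
      · rw [charMean_eq_zero h, norm_zero, zero_div]; linarith
      · have hn : w ≤ ‖(1 + (x : ℂ) + 2 * I * t) - 1‖ := by
          rcases h with h | h
          · refine h.trans ((le_abs_self x).trans (le_trans (le_of_eq ?_) (Complex.abs_re_le_norm _)))
            simp
          · refine h.trans (le_trans ?_ (Complex.abs_im_le_norm _))
            rw [Complex.sub_im, him, Complex.one_im, sub_zero, abs_mul]
            norm_num
            linarith [abs_nonneg t]
        have : ‖charMean (χ ^ 2)‖ / ‖(1 + (x : ℂ) + 2 * I * t) - 1‖ ≤ 1 / w := by
          gcongr; exact norm_charMean_le _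
        linarith
    calc _ ≤ C * (2 * P ^ 2) * (2 / w) := by gcongr
      _ = _ := by ring
  have h341 := norm_LFunction_product_ge_one χ hx t
  rw [norm_mul, norm_mul, norm_pow, norm_pow] at h341
  set B := ‖LFunction χ (1 + x + I * t)‖
  have : 1 ≤ (4 * C * P ^ 2 / x) ^ 3 * B ^ 4 * (4 * C * P ^ 2 / w) :=
    h341.le.trans (by gcongr)
  rw [show (4 * C * P ^ 2 / x) ^ 3 * B ^ 4 * (4 * C * P ^ 2 / w)
    = ((4 * C) ^ 3 * (4 * C)) * (B ^ 4 * P ^ 8) / (x ^ 3 * w) by field_simp,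
    le_div_iff₀ (by positivity)] at this
  rw [mul_assoc, div_mul_eq_mul_div, div_le_iff₀ (by positivity)]
  linarith

end LowerBound

section LogDeriv

open Complex Filter Topology Set DirichletCharacter

lemma convex_reProdIm {s t : Set ℝ} (hs : Convex ℝ s) (ht : Convex ℝ t) : Convex ℝ (s ×ℂ t) :=
  (hs.linear_preimage Complex.reLm).inter (ht.linear_preimage Complex.imLm)

theorem exists_norm_LFunction_ge {ε : ℝ} (hε : 0 < ε) (hε1 : ε ≤ 1) : ∃ c : ℝ, 0 < c ∧
    ∀ (q : ℕ) [NeZero q] (χ : DirichletCharacter ℂ q) (s : ℂ), 1 < s.re → s.re ≤ 2 →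
      (χ ≠ 1 ∨ 1 ≤ |s.im|) → c / anCond q s.im ^ ε ≤ ‖LFunction χ s‖ := by
  set δ := ε / 17 with hδe
  have hδ : 0 < δ := by positivity
  have hδ2 : δ ≤ 1 / 2 := by rw [hδe]; linarith
  obtain ⟨K, hK, hlip⟩ := norm_LFunction_sub_le hδ hδ2
  obtain ⟨c₁', hc₁', h341⟩ := norm_LFunction_pow_four_ge hδ hδ2
  obtain ⟨c₂', hc₂', hS⟩ := exists_siegel_lower_bound (ε := δ) hδ (by linarith)
  set c₁ := min c₁' 1
  have hc₁ : 0 < c₁ := lt_min hc₁' one_pos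
  have hc₁1 : c₁ ≤ 1 := min_le_right _ _
  set c₂ := min c₂' 1
  have hc₂ : 0 < c₂ := lt_min hc₂' one_pos
  have hc₂1 : c₂ ≤ 1 := min_le_right _ _
  refine ⟨c₁ * c₂ / (64 * K ^ 4), by positivity, fun q _ χ s hs1 hs2 hst => ?_⟩
  set t := s.im with ht
  set x := s.re - 1 with hx
  have hx0 : 0 < x := by linarith
  have hx1 : x ≤ 1 := by linarith
  have hsx : s = 1 + x + I * t := by apply Complex.ext <;> simp [hx, ht]
  set P := anCond q t ^ δ with hP
  have hP1 : 1 ≤ P := one_le_anCond_rpow q t hδ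
  have hP17 : anCond q t ^ ε = P ^ 17 := by
    rw [hP, ← Real.rpow_natCast, ← Real.rpow_mul (anCond_pos q t).le]
    congr 1; rw [hδe]; push_cast; ring
  rw [hP17]
  have hq1 : (1 : ℝ) ≤ q := by exact_mod_cast NeZero.one_le
  set τ := c₂ / (4 * K * P ^ 3) with hτ
  have hτ0 : 0 < τ := by positivity
  have hKP : 1 ≤ K * P ^ 3 := one_le_mul_of_one_le_of_one_le hK (one_le_pow₀ hP1)
  have hτ1 : τ ≤ 1 / 4 := by
    rw [hτ, div_le_iff₀ (by positivity)]; linarith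
  set η := c₁ * τ / (16 * K ^ 4 * P ^ 16) with hη
  have hη0 : 0 < η := by positivity
  have hητ : η ≤ τ := by
    rw [hη, div_le_iff₀ (by positivity)]
    have : 1 ≤ K ^ 4 * P ^ 16 := one_le_mul_of_one_le_of_one_le (one_le_pow₀ hK) (one_le_pow₀ hP1)
    nlinarith
  have hgoal : K * P ^ 2 * η = c₁ * c₂ / (64 * K ^ 4) / P ^ 17 := by
    rw [hη, hτ]; field_simp; norm_num
  rw [← hgoal]
  by_cases hcase : χ ^ 2 ≠ 1 ∨ τ ≤ x ∨ τ ≤ |t|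
  · have large : ∀ y : ℝ, 0 < y → y ≤ 1 → η ≤ y → (χ ^ 2 ≠ 1 ∨ τ ≤ y ∨ τ ≤ |t|) →
        2 * (K * P ^ 2 * η) ≤ ‖LFunction χ (1 + y + I * t)‖ := by
      intro y hy0 hy1 hyη hyc
      have h := h341 q χ y t τ hy0 hy1 hτ0 (by linarith) hyc
      refine le_of_pow_le_pow_left₀ (n := 4) (by norm_num) (norm_nonneg _) ?_
      refine le_of_mul_le_mul_right (le_trans ?_ h) (show 0 < P ^ 8 by positivity)
      calc (2 * (K * P ^ 2 * η)) ^ 4 * P ^ 8 = (16 * K ^ 4 * P ^ 16) * η * η ^ 3 := by ring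
        _ = c₁ * η ^ 3 * τ := by
            rw [hη, mul_div_cancel₀ _ (by positivity : (16 * K ^ 4 * P ^ 16) ≠ 0)]; ring
        _ ≤ c₁' * y ^ 3 * τ := by gcongr; exact min_le_left _ _
    rcases le_or_gt η x with h | h
    · rw [hsx]
      have : 0 < K * P ^ 2 * η := by positivity
      linarith [large x hx0 hx1 h hcase]
    · have h1 := large η hη0 (by linarith) le_rfl (hcase.imp_right fun h' =>
        h'.imp_left fun h'' => h''.trans h.le)
      have h2 := hlip q χ t (Icc 1 3 ×ℂ {t}) (convex_reProdIm (convex_Icc 1 3) (convex_singleton t))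
        (fun z hz => ?_) (1 + η + I * t) ?_ (1 + x + I * t) ?_
      · rw [← hsx] at h2
        have h3 : ‖(1 + (η : ℂ) + I * t) - s‖ ≤ η := by
          rw [hsx, show (1 + (η : ℂ) + I * t) - (1 + x + I * t) = ((η - x : ℝ) : ℂ) by push_cast; ring,
            Complex.norm_real, Real.norm_eq_abs, abs_le]
          constructor <;> linarith
        have h4 := norm_sub_norm_le (LFunction χ (1 + η + I * t)) (LFunction χ s)
        have h5 : K * P ^ 2 * ‖(1 + (η : ℂ) + I * t) - s‖ ≤ K * P ^ 2 * η := by gcongr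
        linarith
      · rw [Complex.mem_reProdIm] at hz
        have hz1 : z.im = t := hz.2
        rw [hz1]
        refine ⟨by linarith [hz.1.1], hz.1.2, by linarith, hst.imp_right fun h => by linarith⟩
      · rw [Complex.mem_reProdIm]; simp; constructor <;> linarith
      · rw [Complex.mem_reProdIm]; simp; constructor <;> linarith
  · push Not at hcase
    obtain ⟨hχ2, hxτ, htτ⟩ := hcase
    have hχ : χ ≠ 1 := hst.resolve_right fun h => by linarith
    have h2 := hlip q χ t (Icc 1 3 ×ℂ Icc (-|t|) |t|) (convex_reProdIm (convex_Icc 1 3) (convex_Icc _ _))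
        (fun z hz => ?_) 1 ?_ s ?_
    · have h3 : ‖1 - s‖ ≤ 2 * τ := by
        refine (Complex.norm_le_abs_re_add_abs_im _).trans ?_
        simp only [Complex.sub_re, Complex.sub_im, Complex.one_re, Complex.one_im, zero_sub, abs_neg]
        rw [abs_sub_comm, ← hx, abs_of_pos hx0]
        linarith
      have h4 : c₂ / P ≤ ‖LFunction χ 1‖ := by
        refine le_trans ?_ (hS q χ hχ2 hχ)
        rw [Real.rpow_neg (by linarith), ← div_eq_mul_inv]
        have : (q : ℝ) ^ δ ≤ P := by
          rw [hP]
          refine Real.rpow_le_rpow (by linarith) ?_ hδ.le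
          rw [anCond]; nlinarith [abs_nonneg t]
        gcongr
        exact min_le_left _ _
      have h5 := norm_sub_norm_le (LFunction χ 1) (LFunction χ s)
      have h6 : K * P ^ 2 * ‖1 - s‖ ≤ c₂ / P / 2 := by
        calc _ ≤ K * P ^ 2 * (2 * τ) := by gcongr
          _ = _ := by rw [hτ]; field_simp; norm_num
      have h7 : K * P ^ 2 * η ≤ c₂ / P / 2 := le_trans (by gcongr; linarith)
        (show K * P ^ 2 * (2 * τ) ≤ c₂ / P / 2 from le_of_eq (by rw [hτ]; field_simp; norm_num))
      linarith
    · rw [Complex.mem_reProdIm] at hz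
      refine ⟨by linarith [hz.1.1], hz.1.2, by linarith [abs_le.mpr hz.2], Or.inl hχ⟩
    · rw [Complex.mem_reProdIm]; simp
    · rw [Complex.mem_reProdIm]
      exact ⟨⟨hs1.le, by linarith⟩, ⟨neg_abs_le _, le_abs_self _⟩⟩

lemma exists_iteratedDeriv_logDeriv_LFunction_le (k : ℕ) : ∃ C : ℝ, 0 < C ∧
    ∀ (q : ℕ) [NeZero q] (χ : DirichletCharacter ℂ q) (s : ℂ), 1 < s.re → s.re ≤ 2 →
      (χ ≠ 1 ∨ 1 ≤ |s.im|) →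
      AnalyticAt ℂ (fun z => deriv (LFunction χ) z / LFunction χ z) s ∧
      ‖iteratedDeriv k (fun z => deriv (LFunction χ) z / LFunction χ z) s‖
        ≤ C * anCond q s.im ^ (1 / 2 : ℝ) := by
  set δ : ℝ := 1 / (6 * (k + 1)) with hδe
  have hδ : 0 < δ := by positivity
  have hδ6 : δ ≤ 1 / 6 := by
    rw [hδe]; apply one_div_le_one_div_of_le (by norm_num); linarith [(Nat.cast_nonneg k : (0:ℝ) ≤ k)]
  have hδ2 : δ ≤ 1 / 2 := by linarith
  obtain ⟨K, hK, hlip⟩ := norm_LFunction_sub_le hδ hδ2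
  obtain ⟨K₂, hK₂, hder⟩ := norm_deriv_LFunction_le hδ hδ2
  obtain ⟨c₀, hc₀, hlow⟩ := exists_norm_LFunction_ge (ε := δ) hδ (by linarith)
  set c := min c₀ δ
  have hc : 0 < c := lt_min hc₀ hδ
  have hcδ : c ≤ δ := min_le_right _ _
  refine ⟨k.factorial * (2 * K₂ / c) * (2 * K / c) ^ k, by positivity, fun q _ χ s hs1 hs2 hst => ?_⟩
  set P := anCond q s.im ^ δ with hP
  have hP1 : 1 ≤ P := one_le_anCond_rpow q s.im hδ
  set r := c / (2 * K * P ^ 3) with hr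
  have hr0 : 0 < r := by positivity
  have hKP : 1 ≤ K * P ^ 3 := one_le_mul_of_one_le_of_one_le hK (one_le_pow₀ hP1)
  have hrδ : r ≤ δ / 2 := by
    rw [hr, div_le_iff₀ (by positivity)]; nlinarith
  have hball : ∀ z ∈ Metric.closedBall s r, 1 - δ / 2 ≤ z.re ∧ z.re ≤ 3 ∧ |z.im| ≤ |s.im| + 1 ∧
      (χ ≠ 1 ∨ 3 / 4 ≤ |z.im|) := by
    intro w hw
    rw [mem_closedBall_iff_norm] at hw
    have hre := abs_le.mp ((Complex.abs_re_le_norm _).trans hw)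
    have him := (Complex.abs_im_le_norm _).trans hw
    rw [Complex.sub_re] at hre
    rw [Complex.sub_im] at him
    have h4 := abs_sub_abs_le_abs_sub w.im s.im
    have h5 := abs_sub_abs_le_abs_sub s.im w.im
    rw [abs_sub_comm] at h5
    refine ⟨by linarith, by linarith, by linarith, hst.imp_right fun h => by linarith⟩
  have hLz : ∀ z ∈ Metric.closedBall s r, c / (2 * P) ≤ ‖LFunction χ z‖ := by
    intro z hz
    have h1 := hlip q χ s.im _ (convex_closedBall s r) hball s (Metric.mem_closedBall_self hr0.le) z hz
    have h2 : ‖s - z‖ ≤ r := by rw [← dist_eq_norm, dist_comm]; exact hz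
    have h3 : K * P ^ 2 * ‖s - z‖ ≤ c / (2 * P) := by
      calc _ ≤ K * P ^ 2 * r := by gcongr
        _ = _ := by rw [hr]; field_simp
    have h4 := norm_sub_norm_le (LFunction χ s) (LFunction χ z)
    have h5 : c / P ≤ ‖LFunction χ s‖ := by
      refine le_trans ?_ (hlow q χ s hs1 hs2 hst)
      gcongr
      exact min_le_left _ _
    have h6 : c / P = c / (2 * P) + c / (2 * P) := by field_simp; norm_num
    linarith
  have hne : ∀ z ∈ Metric.closedBall s r, LFunction χ z ≠ 0 := fun z hz h => by
    have := hLz z hz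
    rw [h, norm_zero] at this
    exact absurd this (not_le.mpr (by positivity))
  have hharm : ∀ z ∈ Metric.closedBall s r, z ≠ 1 ∨ χ ≠ 1 := fun z hz =>
    ne_one_of_harmless ((hball z hz).2.2.2.imp_right fun h => by linarith)
  have hLan : ∀ z, (z ≠ 1 ∨ χ ≠ 1) → AnalyticAt ℂ (LFunction χ) z := by
    intro z hz
    rcases hz with hz | hz
    · refine DifferentiableOn.analyticAt (s := {1}ᶜ) (fun w hw => ?_) (isOpen_compl_singleton.mem_nhds hz)
      exact (differentiableAt_LFunction χ w (Or.inl hw)).differentiableWithinAt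
    · exact (differentiable_LFunction hz).analyticAt z
  have han : ∀ z ∈ Metric.closedBall s r,
      AnalyticAt ℂ (fun z => deriv (LFunction χ) z / LFunction χ z) z := fun z hz =>
    (hLan z (hharm z hz)).deriv.div (hLan z (hharm z hz)) (hne z hz)
  refine ⟨han s (Metric.mem_closedBall_self hr0.le), ?_⟩
  have := Complex.norm_iteratedDeriv_le_of_forall_mem_sphere_norm_le (c := s) (R := r)
    (C := 2 * K₂ / c * P ^ 3) (f := fun z => deriv (LFunction χ) z / LFunction χ z) k hr0 ?_ ?_
  · refine this.trans (le_of_eq ?_)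
    have hPQ : anCond q s.im ^ (1 / 2 : ℝ) = P ^ 3 * (P ^ 3) ^ k := by
      rw [← pow_succ', ← pow_mul, hP, ← Real.rpow_natCast, ← Real.rpow_mul (anCond_pos q _).le]
      congr 1; rw [hδe]; push_cast; field_simp; norm_num
    rw [hPQ, hr, div_pow, div_pow, mul_pow, mul_pow]
    field_simp
  · refine DifferentiableOn.diffContOnCl fun w hw => ?_
    exact (han w (Metric.closure_ball_subset_closedBall hw)).differentiableAt.differentiableWithinAt
  · intro z hz
    have hz' := Metric.sphere_subset_closedBall hz
    obtain ⟨h1, h2, h3, h4⟩ := hball z hz'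
    rw [norm_div]
    calc _ ≤ K₂ * P ^ 2 / (c / (2 * P)) := by
          gcongr
          · exact hder q χ s.im z h1 h2 h3 h4
          · exact hLz z hz'
      _ = _ := by field_simp

end LogDeriv

section DirichletDeriv

open Complex Filter Topology Set DirichletCharacter

lemma logMul_iterate_apply (f : ℕ → ℂ) (k n : ℕ) :
    LSeries.logMul^[k] f n = (Complex.log n) ^ k * f n := by
  induction k with
  | zero => simp
  | succ k ih => rw [Function.iterate_succ_apply', LSeries.logMul, ih, pow_succ']; ring

lemma abscissaOfAbsConv_le_one_of_forall {f : ℕ → ℂ}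
    (h : ∀ s : ℂ, 1 < s.re → LSeriesSummable f s) : LSeries.abscissaOfAbsConv f ≤ 1 :=
  LSeries.abscissaOfAbsConv_le_of_forall_lt_LSeriesSummable' fun y hy => by
    refine h y ?_
    rw [Complex.ofReal_re]
    exact_mod_cast hy

lemma norm_LSeries_logMul_iterate {f : ℕ → ℂ} (h : ∀ s : ℂ, 1 < s.re → LSeriesSummable f s)
    (k : ℕ) {s : ℂ} (hs : 1 < s.re) {F : ℂ → ℂ} (hF : ∀ z : ℂ, 1 < z.re → LSeries f z = F z) :
    ‖LSeries (LSeries.logMul^[k] f) s‖ = ‖iteratedDeriv k F s‖ := by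
  have hlt : LSeries.abscissaOfAbsConv f < s.re :=
    (abscissaOfAbsConv_le_one_of_forall h).trans_lt (by exact_mod_cast hs)
  have he : LSeries f =ᶠ[𝓝 s] F := by
    filter_upwards [(isOpen_lt continuous_const Complex.continuous_re).mem_nhds
      (show (1 : ℝ) < s.re from hs)] with z hz using hF z hz
  rw [← he.iteratedDeriv_eq k, LSeries_iteratedDeriv k hlt, norm_mul]
  simp

lemma exists_iteratedDeriv_riemannZeta_le (k : ℕ) : ∃ C : ℝ, 0 < C ∧ ∀ s : ℂ, 1 < s.re → s.re ≤ 2 →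
    1 ≤ |s.im| → ‖iteratedDeriv k riemannZeta s‖ ≤ C * anCond 1 s.im ^ (1 / 2 : ℝ) := by
  obtain ⟨C, hC, hb⟩ := norm_LFunction_le_of_harmless (δ := 1 / 4) (by norm_num) (by norm_num)
  refine ⟨k.factorial * (2 * C) / (1 / 4) ^ k, by positivity, fun s hs1 hs2 ht => ?_⟩
  have hball : ∀ z ∈ Metric.closedBall s (1 / 4), 1 - 1 / 4 ≤ z.re ∧ z.re ≤ 4 ∧
      |z.im| ≤ 2 * |s.im| + 2 ∧ 1 / 2 ≤ |z.im| := by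
    intro w hw
    rw [mem_closedBall_iff_norm] at hw
    have hre := abs_le.mp ((Complex.abs_re_le_norm _).trans hw)
    have him := (Complex.abs_im_le_norm _).trans hw
    rw [Complex.sub_re] at hre
    rw [Complex.sub_im] at him
    have h4 := abs_sub_abs_le_abs_sub w.im s.im
    have h5 := abs_sub_abs_le_abs_sub s.im w.im
    rw [abs_sub_comm] at h5
    refine ⟨by linarith, by linarith, by linarith, by linarith⟩
  have := Complex.norm_iteratedDeriv_le_of_forall_mem_sphere_norm_le (c := s) (R := 1 / 4)
    (C := C * (2 * anCond 1 s.im ^ (1 / 2 : ℝ))) (f := riemannZeta) k (by norm_num) ?_ ?_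
  · refine this.trans (le_of_eq ?_); ring
  · refine DifferentiableOn.diffContOnCl fun w hw => ?_
    have hw' := hball w (Metric.closure_ball_subset_closedBall hw)
    refine (differentiableAt_riemannZeta ?_).differentiableWithinAt
    rintro rfl
    norm_num at hw'
  · intro z hz
    obtain ⟨h1, h2, h3, h4⟩ := hball z (Metric.sphere_subset_closedBall hz)
    have := hb 1 1 z h1 h2 (Or.inr h4)
    rw [LFunction_modOne_eq] at this
    refine this.trans ?_
    have h5 := anCond_rpow_le_two_mul (q := 1) (δ := 1 / 4) (by norm_num) (by norm_num) h3
    rw [← Real.rpow_natCast, ← Real.rpow_mul (anCond_pos 1 s.im).le,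
      show (1 / 4 : ℝ) * (2 : ℕ) = 1 / 2 by norm_num] at h5
    gcongr

lemma exists_iteratedDeriv_zeta_compact (k : ℕ) : ∃ C : ℝ, 0 < C ∧ ∀ s : ℂ, 1 < s.re → s.re ≤ 2 →
    |s.im| ≤ 1 → ‖iteratedDeriv k (fun z => - (deriv riemannZeta z / riemannZeta z) - riemannZeta z) s‖
      ≤ C := by
  set Z : ℂ → ℂ := LFun₁ (1 : DirichletCharacter ℂ 1) with hZ
  have hZd : Differentiable ℂ Z := differentiable_LFun₁ _
  have hZs : ∀ s : ℂ, s ≠ 1 → Z s = (s - 1) * riemannZeta s := by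
    intro s hs
    simp [hZ, LFun₁, Function.update_of_ne hs]
  have hZ1 : Z 1 = 1 := by simp [hZ, LFun₁, charMean_modOne]
  have hZne : ∀ s : ℂ, 1 ≤ s.re → Z s ≠ 0 := by
    intro s hs
    rcases eq_or_ne s 1 with rfl | h1
    · rw [hZ1]; exact one_ne_zero
    · rw [hZs s h1]
      exact mul_ne_zero (sub_ne_zero.mpr h1) (riemannZeta_ne_zero_of_one_le_re hs)
  set G : ℂ → ℂ := fun z => - (deriv Z z / Z z) - dslope Z 1 z with hG
  have hDd : Differentiable ℂ (dslope Z 1) := by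
    have := (Complex.differentiableOn_dslope (f := Z) (c := 1) (s := univ) univ_mem).mpr
      hZd.differentiableOn
    exact differentiableOn_univ.mp this
  have hGan : AnalyticOnNhd ℂ G {z | Z z ≠ 0} := fun z hz =>
    ((hZd.analyticAt z).deriv.div (hZd.analyticAt z) hz).neg.sub (hDd.analyticAt z)
  have hcont : ContinuousOn (iteratedDeriv k G) {z | Z z ≠ 0} := by
    rw [iteratedDeriv_eq_iterate]
    exact (AnalyticOnNhd.iterated_deriv hGan k).continuousOn
  have hK : IsCompact (Icc (1 : ℝ) 2 ×ℂ Icc (-1 : ℝ) 1) := isCompact_Icc.reProdIm isCompact_Icc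
  obtain ⟨C, hC⟩ := hK.exists_bound_of_continuousOn (hcont.mono fun z hz => hZne z hz.1.1)
  refine ⟨|C| + 1, by positivity, fun s hs1 hs2 ht => ?_⟩
  have he : (fun z => - (deriv riemannZeta z / riemannZeta z) - riemannZeta z) =ᶠ[𝓝 s] G := by
    filter_upwards [(isOpen_lt continuous_const Complex.continuous_re).mem_nhds
      (show (1 : ℝ) < s.re from hs1)] with z hz
    have hz' : 1 < z.re := hz
    have hz1 : z ≠ 1 := by rintro rfl; simp at hz'
    have hz1' := sub_ne_zero.mpr hz1
    have hζ := riemannZeta_ne_zero_of_one_le_re hz'.le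
    have hd : deriv Z z = riemannZeta z + (z - 1) * deriv riemannZeta z := by
      have : Z =ᶠ[𝓝 z] fun w => (w - 1) * riemannZeta w := by
        filter_upwards [isOpen_compl_singleton.mem_nhds hz1] with w hw using hZs w hw
      rw [this.deriv_eq, deriv_fun_mul (by fun_prop) (differentiableAt_riemannZeta hz1)]
      simp
    simp only [hG]
    rw [dslope_of_ne _ hz1, slope_def_field, hZ1, hd, hZs z hz1]
    field_simp
    ring
  rw [he.iteratedDeriv_eq k]
  refine (hC s ⟨⟨hs1.le, hs2⟩, abs_le.mp ht⟩).trans ?_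
  linarith [le_abs_self C]

open ArithmeticFunction in
theorem exists_LSeries_logMul_vonMangoldt_le (k : ℕ) : ∃ C : ℝ, 0 < C ∧
    (∀ (q : ℕ) [NeZero q] (χ : DirichletCharacter ℂ q), χ ≠ 1 → ∀ s : ℂ, 1 < s.re → s.re ≤ 2 →
      ‖LSeries (LSeries.logMul^[k] (fun n => χ n * (Λ n : ℂ))) s‖
        ≤ C * anCond q s.im ^ (1 / 2 : ℝ)) ∧
    ∀ s : ℂ, 1 < s.re → s.re ≤ 2 →
      ‖LSeries (LSeries.logMul^[k] (fun n => (Λ n : ℂ) - 1)) s‖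
        ≤ C * anCond 1 s.im ^ (1 / 2 : ℝ) := by
  obtain ⟨C₁, hC₁, h₁⟩ := exists_iteratedDeriv_logDeriv_LFunction_le k
  obtain ⟨C₂, hC₂, h₂⟩ := exists_iteratedDeriv_riemannZeta_le k
  obtain ⟨C₃, hC₃, h₃⟩ := exists_iteratedDeriv_zeta_compact k
  have hL : ∀ (q : ℕ) [NeZero q] (χ : DirichletCharacter ℂ q) (z : ℂ), 1 < z.re →
      LSeries (fun n => χ n * (Λ n : ℂ)) z = -(deriv (LFunction χ) z / LFunction χ z) := by
    intro q _ χ z hz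
    have := LSeries_twist_vonMangoldt_eq χ hz
    rw [← LFunction_eq_LSeries χ hz, ← deriv_LFunction_eq_deriv_LSeries χ hz] at this
    rw [← neg_div, ← this]; rfl
  refine ⟨C₁ + C₂ + C₃, by positivity, fun q _ χ hχ s hs1 hs2 => ?_, fun s hs1 hs2 => ?_⟩
  · have hsum : ∀ z : ℂ, 1 < z.re → LSeriesSummable (fun n => χ n * (Λ n : ℂ)) z := fun z hz =>
      LSeriesSummable_twist_vonMangoldt χ hz
    rw [norm_LSeries_logMul_iterate hsum k hs1
      (hL q χ), iteratedDeriv_fun_neg, norm_neg]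
    refine (h₁ q χ s hs1 hs2 (Or.inl hχ)).2.trans ?_
    have := anCond_pos q s.im
    gcongr
    linarith
  · have hsum1 : ∀ z : ℂ, 1 < z.re → LSeriesSummable (fun _ => (1 : ℂ)) z := fun z hz =>
      LSeriesSummable_one_iff.mpr hz
    have hsum : ∀ z : ℂ, 1 < z.re → LSeriesSummable (fun n => (Λ n : ℂ) - 1) z := fun z hz =>
      (LSeriesSummable_vonMangoldt hz).sub (hsum1 z hz)
    rw [norm_LSeries_logMul_iterate hsum k hs1
      (F := fun z => - (deriv riemannZeta z / riemannZeta z) - riemannZeta z)]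
    · have h1 : 1 ≤ anCond 1 s.im ^ (1 / 2 : ℝ) := one_le_anCond_rpow 1 _ (by norm_num)
      rcases le_total 1 |s.im| with ht | ht
      · have h4 := h₁ 1 1 s hs1 hs2 (Or.inr ht)
        rw [LFunction_modOne_eq] at h4
        have hs : s ≠ 1 := by rintro rfl; simp at hs1
        have hζ : AnalyticAt ℂ riemannZeta s :=
          DifferentiableOn.analyticAt (s := {1}ᶜ)
            (fun w hw => (differentiableAt_riemannZeta hw).differentiableWithinAt)
            (isOpen_compl_singleton.mem_nhds hs)
        have hn : AnalyticAt ℂ (fun z => -(deriv riemannZeta z / riemannZeta z)) s := h4.1.neg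
        rw [iteratedDeriv_fun_sub hn.contDiffAt hζ.contDiffAt, iteratedDeriv_fun_neg]
        refine (norm_sub_le _ _).trans ?_
        rw [norm_neg]
        nlinarith [h4.2, h₂ s hs1 hs2 ht]
      · refine (h₃ s hs1 hs2 ht).trans ?_
        nlinarith
    · intro z hz
      rw [show (fun n => (Λ n : ℂ) - 1) = (fun n => (Λ n : ℂ)) - fun _ => 1 from rfl,
        LSeries_sub (LSeriesSummable_vonMangoldt hz) (hsum1 z hz),
        LSeries_vonMangoldt_eq_deriv_riemannZeta_div hz, neg_div]
      congr 1
      exact LSeries_one_eq_riemannZeta hz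

end DirichletDeriv

section CesaroMean

open Complex Filter Topology Set MeasureTheory

lemma one_add_sq_le_norm_mul {σ t : ℝ} (hσ : 1 ≤ σ) :
    1 + t ^ 2 ≤ ‖((σ : ℂ) + t * I) * ((σ : ℂ) + t * I + 1)‖ := by
  have h1 : 1 + t ^ 2 ≤ ‖(σ : ℂ) + t * I‖ ^ 2 := by
    rw [Complex.sq_norm, Complex.normSq_apply]; simp; nlinarith
  have h2 : 1 + t ^ 2 ≤ ‖(σ : ℂ) + t * I + 1‖ ^ 2 := by
    rw [Complex.sq_norm, Complex.normSq_apply]; simp; nlinarith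
  rw [norm_mul]
  have h0 : 0 ≤ 1 + t ^ 2 := by positivity
  refine le_of_sq_le_sq ?_ (by positivity) 
  rw [mul_pow, sq (1 + t ^ 2)]
  gcongr

lemma add_mul_I_ne_zero {σ : ℝ} (hσ : 0 < σ) (t : ℝ) : (σ : ℂ) + t * I ≠ 0 := by
  intro h
  have := congrArg Complex.re h
  simp at this
  exact hσ.ne' this

lemma add_mul_I_add_one_ne_zero {σ : ℝ} (hσ : 0 < σ) (t : ℝ) : (σ : ℂ) + t * I + 1 ≠ 0 := by
  intro h
  have := congrArg Complex.re h
  simp at this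
  linarith

lemma integrable_cesaroKernel {σ : ℝ} (hσ : 1 ≤ σ) :
    Integrable fun t : ℝ => 1 / (((σ : ℂ) + t * I) * ((σ : ℂ) + t * I + 1)) := by
  refine integrable_inv_one_add_sq.mono' ?_ (Eventually.of_forall fun t => ?_)
  · refine Continuous.aestronglyMeasurable ?_
    refine continuous_const.div (by fun_prop) fun t => ?_
    exact mul_ne_zero (add_mul_I_ne_zero (by linarith) t) (add_mul_I_add_one_ne_zero (by linarith) t)
  · rw [norm_div, norm_one, ← one_div]
    exact one_div_le_one_div_of_le (by positivity) (one_add_sq_le_norm_mul hσ)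

/-- Perron's formula with the Cesàro weight. -/
lemma integral_cpow_mul_cesaroKernel {σ y : ℝ} (hσ : 1 ≤ σ) (hy : 0 < y) :
    ∫ t : ℝ, (y : ℂ) ^ (-((σ : ℂ) + t * I)) *
      (1 / (((σ : ℂ) + t * I) * ((σ : ℂ) + t * I + 1))) = (2 * π * max (1 - y) 0 : ℝ) := by
  set f : ℝ → ℂ := fun t => indicator (Ioc 0 1) (fun _ => 1 : ℝ → ℂ) t -
    indicator (Ioc 0 1) (fun t : ℝ => (t : ℂ) ^ (1 : ℂ)) t with hf
  have hfy : ∀ t : ℝ, 0 < t → f t = (max (1 - t) 0 : ℝ) := by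
    intro t ht
    simp only [hf, indicator, mem_Ioc, ht, true_and]
    split_ifs with h
    · rw [max_eq_left (by linarith)]; simp
    · rw [max_eq_right (by linarith)]; simp
  have hm : ∀ s : ℂ, 0 < s.re → HasMellin f s (1 / (s * (s + 1))) := by
    intro s hs
    have h1 := hasMellin_one_Ioc hs
    have h2 := hasMellin_cpow_Ioc 1 (s := s) (by simp; linarith)
    have h3 := hasMellin_sub h1.1 h2.1
    refine ⟨h3.1, h3.2.trans ?_⟩
    rw [h1.2, h2.2]
    have : s ≠ 0 := by rintro rfl; simp at hs
    have : s + 1 ≠ 0 := by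
      intro h
      have := congrArg Complex.re h
      simp at this
      linarith
    field_simp
    ring
  have hre : ∀ t : ℝ, 0 < ((σ : ℂ) + t * I).re := fun t => by simp; linarith
  have hv : VerticalIntegrable (mellin f) σ := by
    refine (integrable_cesaroKernel hσ).congr (Eventually.of_forall fun t => ?_)
    exact ((hm _ (hre t)).2).symm
  have hc : ContinuousAt f y := by
    have : f =ᶠ[𝓝 y] fun t => ((max (1 - t) 0 : ℝ) : ℂ) := by
      filter_upwards [isOpen_Ioi.mem_nhds hy] with t ht using hfy t ht
    refine ContinuousAt.congr ?_ this.symm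
    fun_prop
  have hs0 : 0 < (σ : ℂ).re := by simp; linarith
  have := mellinInv_mellin_eq σ f hy (hm σ hs0).1 hv hc
  rw [hfy y hy, mellinInv] at this
  have h2 : ∀ t : ℝ, (y : ℂ) ^ (-((σ : ℂ) + t * I)) • mellin f ((σ : ℂ) + t * I) =
      (y : ℂ) ^ (-((σ : ℂ) + t * I)) *
      (1 / (((σ : ℂ) + t * I) * ((σ : ℂ) + t * I + 1))) := fun t => by
    rw [(hm _ (hre t)).2, smul_eq_mul]
  simp_rw [h2] at this
  rw [ofReal_mul, ← this, Complex.real_smul, ← mul_assoc, ← ofReal_mul,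
    mul_one_div_cancel (by positivity), ofReal_one, one_mul]

lemma rpow_half_div_le (t : ℝ) :
    (2 + |t|) ^ (1 / 2 : ℝ) / (1 + t ^ 2) ≤ 4 * (1 + ‖t‖) ^ (-(3 / 2 : ℝ)) := by
  rw [Real.norm_eq_abs]
  have ha := abs_nonneg t
  have h1 : (2 + |t|) ^ (1 / 2 : ℝ) ≤ 2 * (1 + |t|) ^ (1 / 2 : ℝ) := by
    calc (2 + |t|) ^ (1 / 2 : ℝ) ≤ (4 * (1 + |t|)) ^ (1 / 2 : ℝ) :=
          Real.rpow_le_rpow (by positivity) (by linarith) (by norm_num)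
      _ = _ := by
          rw [Real.mul_rpow (by norm_num) (by positivity),
            show (4 : ℝ) = 2 ^ (2 : ℝ) by norm_num, ← Real.rpow_mul (by norm_num)]
          norm_num
  have h2 : (1 + |t|) ^ 2 ≤ 2 * (1 + t ^ 2) := by
    rw [← sq_abs t]; nlinarith [sq_nonneg (|t| - 1)]
  rw [div_le_iff₀ (by positivity)]
  have h3 : (1 + |t|) ^ (1 / 2 : ℝ) = (1 + |t|) ^ (-(3 / 2 : ℝ)) * (1 + |t|) ^ 2 := by
    rw [← Real.rpow_natCast, ← Real.rpow_add (by positivity)]; norm_num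
  calc _ ≤ 2 * (1 + |t|) ^ (1 / 2 : ℝ) := h1
    _ = 2 * (1 + |t|) ^ (-(3 / 2 : ℝ)) * (1 + |t|) ^ 2 := by rw [h3]; ring
    _ ≤ 2 * (1 + |t|) ^ (-(3 / 2 : ℝ)) * (2 * (1 + t ^ 2)) := by gcongr
    _ = _ := by ring

theorem exists_cesaro_bound : ∃ C : ℝ, 0 < C ∧ ∀ (b : ℕ → ℂ) (K : ℝ), 0 ≤ K →
    (∀ s : ℂ, 1 < s.re → LSeriesSummable b s) →
    (∀ s : ℂ, 1 < s.re → s.re ≤ 2 → ‖LSeries b s‖ ≤ K * (2 + |s.im|) ^ (1 / 2 : ℝ)) →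
    ∀ x : ℝ, 3 ≤ x → ‖∑ n ∈ Finset.Icc 1 ⌊x⌋₊, b n * ((1 - n / x : ℝ) : ℂ)‖ ≤ C * K * x := by
  have hJ : Integrable fun t : ℝ => (1 + ‖t‖) ^ (-(3 / 2 : ℝ)) :=
    integrable_one_add_norm (by norm_num)
  set J : ℝ := ∫ t : ℝ, (1 + ‖t‖) ^ (-(3 / 2 : ℝ)) with hJd
  have hJ0 : 0 ≤ J := integral_nonneg fun t => by positivity
  refine ⟨rexp 1 * 4 * J + 1, by positivity, fun b K hK hsum hb x hx => ?_⟩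
  have hx0 : 0 < x := by linarith
  have hlog : 1 ≤ Real.log x := by
    rw [Real.le_log_iff_exp_le hx0]; linarith [Real.exp_one_lt_d9]
  set σ : ℝ := 1 + 1 / Real.log x with hσ
  have hσ1 : 1 < σ := by rw [hσ]; have : 0 < 1 / Real.log x := by positivity
                         linarith
  have hσ2 : σ ≤ 2 := by rw [hσ]; have : 1 / Real.log x ≤ 1 := by rw [div_le_one] <;> linarith
                         linarith
  have hxσ : x ^ σ = rexp 1 * x := by
    rw [hσ, Real.rpow_add hx0, Real.rpow_one, Real.rpow_def_of_pos hx0]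
    rw [mul_one_div_cancel (by linarith)]; ring
  set ker : ℝ → ℂ := fun t => 1 / (((σ : ℂ) + t * I) * ((σ : ℂ) + t * I + 1)) with hker
  set F : ℕ → ℝ → ℂ := fun n t =>
    LSeries.term b ((σ : ℂ) + t * I) n * ((x : ℂ) ^ ((σ : ℂ) + t * I) * ker t) with hF
  have hFn : ∀ n : ℕ, n ≠ 0 → ∀ t, F n t =
      b n * (((n / x : ℝ) : ℂ) ^ (-((σ : ℂ) + t * I)) * ker t) := by
    intro n hn t
    have hn' : (0 : ℝ) < n := by positivity
    simp only [hF]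
    rw [LSeries.term_of_ne_zero hn, ofReal_div, Complex.div_cpow_ofReal_nonneg hn'.le hx0.le,
      Complex.cpow_neg, Complex.cpow_neg, ofReal_natCast]
    have : (x : ℂ) ^ ((σ : ℂ) + t * I) ≠ 0 := by
      simp [Complex.cpow_eq_zero_iff, hx0.ne']
    field_simp
  have hint : ∀ n, ∫ t, F n t = if n = 0 then 0 else
      b n * ((2 * π * max (1 - n / x) 0 : ℝ) : ℂ) := by
    intro n
    split_ifs with hn
    · simp [hF, hn]
    · simp_rw [hFn n hn]
      rw [integral_const_mul, integral_cpow_mul_cesaroKernel hσ1.le (by positivity)]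
  have hnorm : ∀ n t, ‖F n t‖ = ‖LSeries.term b (σ : ℂ) n‖ * (x ^ σ * ‖ker t‖) := by
    intro n t
    simp only [hF]
    rw [norm_mul, norm_mul, Complex.norm_cpow_eq_rpow_re_of_pos hx0]
    simp [LSeries.norm_term_eq]
  have hkint : Integrable ker := integrable_cesaroKernel hσ1.le
  have hFint : ∀ n, Integrable (F n) := by
    intro n
    refine ((hkint.norm.const_mul (x ^ σ)).const_mul ‖LSeries.term b (σ : ℂ) n‖).mono' ?_
      (Eventually.of_forall fun t => (hnorm n t).le)
    rcases eq_or_ne n 0 with rfl | hn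
    · simp only [hF, LSeries.term_zero, zero_mul]; exact aestronglyMeasurable_const
    · refine AEStronglyMeasurable.congr ?_ (Eventually.of_forall fun t => (hFn n hn t).symm)
      refine AEStronglyMeasurable.const_mul (AEStronglyMeasurable.mul ?_ hkint.1) _
      refine Continuous.aestronglyMeasurable ?_
      refine Continuous.const_cpow (by fun_prop) (Or.inl ?_)
      rw [Ne, ofReal_eq_zero]; positivity
  have hFsum : Summable fun n => ∫ t, ‖F n t‖ := by
    simp_rw [hnorm]
    simp_rw [integral_const_mul]
    exact (hsum σ (by simpa using hσ1)).norm.mul_right _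
  have key := integral_tsum_of_summable_integral_norm hFint hFsum
  have hL : ∀ t, ∑' n, F n t = LSeries b ((σ : ℂ) + t * I) *
      ((x : ℂ) ^ ((σ : ℂ) + t * I) * ker t) := by
    intro t
    simp only [hF]
    rw [tsum_mul_right]; rfl
  simp_rw [hL, hint] at key
  have hfin : ∑' n : ℕ, (if n = 0 then 0 else b n * ((2 * π * max (1 - n / x) 0 : ℝ) : ℂ)) =
      (2 * π : ℝ) * ∑ n ∈ Finset.Icc 1 ⌊x⌋₊, b n * ((1 - n / x : ℝ) : ℂ) := by
    rw [tsum_eq_sum (s := Finset.Icc 1 ⌊x⌋₊), Finset.mul_sum]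
    · refine Finset.sum_congr rfl fun n hn => ?_
      rw [Finset.mem_Icc] at hn
      rw [if_neg (by omega), max_eq_left]
      · push_cast; ring
      · rw [sub_nonneg, div_le_one hx0]
        exact (Nat.le_floor_iff hx0.le).mp hn.2
    · intro n hn
      rw [Finset.mem_Icc] at hn
      split_ifs with h0
      · rfl
      · have : x < n := by
          rw [← Nat.floor_lt hx0.le]; omega
        rw [max_eq_right]
        · simp
        · rw [sub_nonpos, one_le_div hx0]; exact this.le
  rw [hfin] at key
  have hbd : ‖∫ t : ℝ, LSeries b ((σ : ℂ) + t * I) *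
      ((x : ℂ) ^ ((σ : ℂ) + t * I) * ker t)‖ ≤ ∫ t : ℝ, K * (rexp 1 * x) * (4 *
        (1 + ‖t‖) ^ (-(3 / 2 : ℝ))) := by
    refine norm_integral_le_of_norm_le ((hJ.const_mul 4).const_mul _)
      (Eventually.of_forall fun t => ?_)
    rw [norm_mul, norm_mul, Complex.norm_cpow_eq_rpow_re_of_pos hx0]
    have h1 := hb ((σ : ℂ) + t * I) (by simpa using hσ1) (by simpa using hσ2)
    have h2 : ‖ker t‖ ≤ 1 / (1 + t ^ 2) := by
      simp only [hker]
      rw [norm_div, norm_one]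
      exact one_div_le_one_div_of_le (by positivity) (one_add_sq_le_norm_mul hσ1.le)
    have him : ((σ : ℂ) + t * I).im = t := by simp
    have hre : ((σ : ℂ) + t * I).re = σ := by simp
    rw [him] at h1
    rw [hre, hxσ]
    calc _ ≤ (K * (2 + |t|) ^ (1 / 2 : ℝ)) * (rexp 1 * x * (1 / (1 + t ^ 2))) := by
          gcongr
      _ = K * (rexp 1 * x) * ((2 + |t|) ^ (1 / 2 : ℝ) / (1 + t ^ 2)) := by ring
      _ ≤ _ := by
          gcongr
          exact rpow_half_div_le t
  rw [← key, integral_const_mul, integral_const_mul, ← hJd, norm_mul, Complex.norm_real,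
    Real.norm_of_nonneg (by positivity)] at hbd
  have h6 : 1 ≤ 2 * π := by linarith [pi_gt_three]
  set S := ‖∑ n ∈ Finset.Icc 1 ⌊x⌋₊, b n * ((1 - n / x : ℝ) : ℂ)‖
  have hS : 0 ≤ S := norm_nonneg _
  have : 0 ≤ K * x := by positivity
  nlinarith

end CesaroMean

section PartialSummation

lemma norm_sum_mul_sub_le {f w : ℕ → ℂ} {a N : ℕ} {M : ℝ} (haN : a ≤ N)
    (hM : ∀ m, a ≤ m → m ≤ N → ‖∑ n ∈ Finset.Ico a m, f n‖ ≤ M) :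
    ‖∑ n ∈ Finset.Ico a N, f n * w n - (∑ n ∈ Finset.Ico a N, f n) * w N‖ ≤
      M * ∑ n ∈ Finset.Ico a N, ‖w n - w (n + 1)‖ := by
  induction N, haN using Nat.le_induction with
  | base => simp
  | succ N haN ih =>
    have ih := ih fun m h1 h2 => hM m h1 (by omega)
    rw [Finset.sum_Ico_succ_top haN, Finset.sum_Ico_succ_top haN, Finset.sum_Ico_succ_top haN]
    have h1 := hM (N + 1) (by omega) le_rfl
    rw [Finset.sum_Ico_succ_top haN] at h1
    set F := ∑ n ∈ Finset.Ico a N, f n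
    calc _ = ‖(∑ n ∈ Finset.Ico a N, f n * w n - F * w N) + (F + f N) * (w N - w (N + 1))‖ := by
          congr 1; ring
      _ ≤ _ := by
          refine (norm_add_le _ _).trans ?_
          rw [norm_mul, mul_add]
          gcongr

lemma norm_sum_mul_le {f w : ℕ → ℂ} {a N : ℕ} {M : ℝ} (haN : a ≤ N)
    (hM : ∀ m, a ≤ m → m ≤ N → ‖∑ n ∈ Finset.Ico a m, f n‖ ≤ M) :
    ‖∑ n ∈ Finset.Ico a N, f n * w n‖ ≤
      M * (‖w N‖ + ∑ n ∈ Finset.Ico a N, ‖w n - w (n + 1)‖) := by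
  have h1 := norm_sum_mul_sub_le (w := w) haN hM
  have h2 := norm_le_norm_add_norm_sub' (∑ n ∈ Finset.Ico a N, f n * w n)
    ((∑ n ∈ Finset.Ico a N, f n) * w N)
  have h3 : ‖(∑ n ∈ Finset.Ico a N, f n) * w N‖ ≤ M * ‖w N‖ := by
    rw [norm_mul]
    gcongr
    exact hM N haN le_rfl
  linarith

lemma norm_sum_mul_le_of_antitone {f : ℕ → ℂ} {w : ℕ → ℝ} {a N : ℕ} {M : ℝ} (haN : a ≤ N)
    (hw : ∀ n, a ≤ n → n < N → w (n + 1) ≤ w n) (hw0 : 0 ≤ w N)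
    (hM : ∀ m, a ≤ m → m ≤ N → ‖∑ n ∈ Finset.Ico a m, f n‖ ≤ M) :
    ‖∑ n ∈ Finset.Ico a N, f n * (w n : ℂ)‖ ≤ M * w a := by
  refine (norm_sum_mul_le (w := fun n => (w n : ℂ)) haN hM).trans (le_of_eq ?_)
  congr 1
  have : ∑ n ∈ Finset.Ico a N, ‖(w n : ℂ) - (w (n + 1) : ℂ)‖ =
      ∑ n ∈ Finset.Ico a N, (w n - w (n + 1)) := by
    refine Finset.sum_congr rfl fun n hn => ?_
    rw [Finset.mem_Ico] at hn
    rw [← Complex.ofReal_sub, Complex.norm_real, Real.norm_of_nonneg]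
    linarith [hw n hn.1 hn.2]
  rw [this, Complex.norm_real, Real.norm_of_nonneg hw0]
  have : ∑ n ∈ Finset.Ico a N, (w n - w (n + 1)) = w a - w N := by
    have := Finset.sum_Ico_sub w haN
    rw [← neg_sub (w N), ← this, ← Finset.sum_neg_distrib]
    exact Finset.sum_congr rfl fun _ _ => by ring
  linarith

lemma log_pow_le_factorial_mul {x : ℝ} (hx : 1 ≤ x) (m : ℕ) :
    Real.log x ^ m ≤ m.factorial * x := by
  have h := Real.pow_div_factorial_le_exp (Real.log x) (Real.log_nonneg hx) m
  rw [Real.exp_log (by linarith), div_le_iff₀ (by positivity)] at h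
  linarith

lemma one_le_log_natCast {N : ℕ} (hN : 3 ≤ N) : 1 ≤ Real.log N := by
  have : (3 : ℝ) ≤ N := by exact_mod_cast hN
  rw [Real.le_log_iff_exp_le (by linarith)]
  linarith [Real.exp_one_lt_d9]

lemma log_natCast_le_two_mul {n N : ℕ} (hN : 3 ≤ N) (hn : n ≤ 2 * N) :
    Real.log n ≤ 2 * Real.log N := by
  rcases Nat.eq_zero_or_pos n with rfl | h0
  · simp; have := one_le_log_natCast hN; linarith
  · have : (n : ℝ) ≤ (N : ℝ) ^ 2 := by
      have : n ≤ N ^ 2 := hn.trans (by nlinarith)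
      exact_mod_cast this
    calc Real.log n ≤ Real.log ((N : ℝ) ^ 2) := Real.log_le_log (by positivity) this
      _ = _ := by rw [Real.log_pow]; norm_num

/-- Sums of a sequence are recovered from Cesàro means on a short interval. -/
lemma norm_sum_le_of_cesaro {b : ℕ → ℂ} {K₁ B : ℝ} {N h : ℕ} (hN : 3 ≤ N) (hh : 0 < h)
    (hhN : h ≤ N)
    (hc : ∀ x : ℝ, 3 ≤ x → ‖∑ n ∈ Finset.Icc 1 ⌊x⌋₊, b n * ((1 - n / x : ℝ) : ℂ)‖ ≤ K₁ * x)
    (hK : 0 ≤ K₁) (hB0 : 0 ≤ B) (hB : ∀ n, n ≤ 2 * N → ‖b n‖ ≤ B) :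
    ‖∑ n ∈ Finset.Icc 1 N, b n‖ ≤ 5 * K₁ * N * (N / h) + h * B := by
  have hS : ∀ M : ℕ, 3 ≤ M → ‖∑ n ∈ Finset.Icc 1 M, b n * ((M : ℂ) - n)‖ ≤ K₁ * (M : ℝ) ^ 2 := by
    intro M hM
    have hM' : (3 : ℝ) ≤ M := by exact_mod_cast hM
    have hMc : (M : ℂ) ≠ 0 := by
      have : M ≠ 0 := by omega
      exact_mod_cast this
    have h1 := hc M hM'
    rw [Nat.floor_natCast] at h1
    have : ∑ n ∈ Finset.Icc 1 M, b n * ((M : ℂ) - n) =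
        M * ∑ n ∈ Finset.Icc 1 M, b n * ((1 - n / M : ℝ) : ℂ) := by
      rw [Finset.mul_sum]
      refine Finset.sum_congr rfl fun n _ => ?_
      push_cast
      field_simp
    rw [this, norm_mul, Complex.norm_natCast]
    nlinarith
  have hNR : (3 : ℝ) ≤ N := by exact_mod_cast hN
  have hhR : (0 : ℝ) < h := by exact_mod_cast hh
  have hhNR : (h : ℝ) ≤ N := by exact_mod_cast hhN
  have h1 := hS N hN
  have h2 := hS (N + h) (by omega)
  have hsplit : Finset.Icc 1 (N + h) = Finset.Icc 1 N ∪ Finset.Ioc N (N + h) := by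
    ext; simp only [Finset.mem_Icc, Finset.mem_union, Finset.mem_Ioc]; omega
  have hdisj : Disjoint (Finset.Icc 1 N) (Finset.Ioc N (N + h)) := by
    rw [Finset.disjoint_left]; intro x; simp only [Finset.mem_Icc, Finset.mem_Ioc]; omega
  rw [hsplit, Finset.sum_union hdisj] at h2
  set E := ∑ n ∈ Finset.Ioc N (N + h), b n * (((N + h : ℕ) : ℂ) - n) with hE
  have hEb : ‖E‖ ≤ h * (B * h) := by
    refine (norm_sum_le _ _).trans ?_
    calc _ ≤ ∑ n ∈ Finset.Ioc N (N + h), B * h := by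
          refine Finset.sum_le_sum fun n hn => ?_
          rw [Finset.mem_Ioc] at hn
          rw [norm_mul]
          have : ‖((N + h : ℕ) : ℂ) - n‖ ≤ h := by
            rw [← Nat.cast_sub hn.2, Complex.norm_natCast]
            have : N + h - n ≤ h := by omega
            exact_mod_cast this
          gcongr
          exact hB n (by omega)
      _ = _ := by rw [Finset.sum_const, Nat.card_Ioc, nsmul_eq_mul]; simp
  have hid : ∑ n ∈ Finset.Icc 1 N, b n * (((N + h : ℕ) : ℂ) - n) =
      ∑ n ∈ Finset.Icc 1 N, b n * ((N : ℂ) - n) + h * ∑ n ∈ Finset.Icc 1 N, b n := by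
    rw [Finset.mul_sum, ← Finset.sum_add_distrib]
    refine Finset.sum_congr rfl fun n _ => ?_
    push_cast; ring
  rw [hid] at h2
  set S := ∑ n ∈ Finset.Icc 1 N, b n * ((N : ℂ) - n)
  set T := ∑ n ∈ Finset.Icc 1 N, b n
  have h3 : ‖(h : ℂ) * T‖ ≤ ‖S + h * T + E‖ + ‖S‖ + ‖E‖ := by
    have : (h : ℂ) * T = (S + h * T + E) - S - E := by ring
    calc _ = ‖(S + h * T + E) - S - E‖ := by rw [← this]
      _ ≤ _ := (norm_sub_le _ _).trans (add_le_add_left (norm_sub_le _ _) _)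
  rw [norm_mul, Complex.norm_natCast] at h3
  push_cast at h2
  have h4 : ((N : ℝ) + h) ^ 2 ≤ 4 * (N : ℝ) ^ 2 := by nlinarith
  have h5 : h * ‖T‖ ≤ 5 * K₁ * N ^ 2 + h * (B * h) := by nlinarith
  have h6 : 5 * K₁ * N * (N / h) + h * B = (5 * K₁ * N ^ 2 + h * (B * h)) / h := by
    field_simp
  rw [h6, le_div_iff₀ hhR]
  linarith

theorem exists_tauberian (A : ℕ) : ∃ C : ℝ, 0 < C ∧ ∀ (a : ℕ → ℂ) (K : ℝ), 1 ≤ K →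
    (∀ n, ‖a n‖ ≤ Real.log n + 1) →
    (∀ s : ℂ, 1 < s.re → LSeriesSummable (LSeries.logMul^[2 * A + 1] a) s) →
    (∀ s : ℂ, 1 < s.re → s.re ≤ 2 →
      ‖LSeries (LSeries.logMul^[2 * A + 1] a) s‖ ≤ K * (2 + |s.im|) ^ (1 / 2 : ℝ)) →
    ∀ N : ℕ, 3 ≤ N → ‖∑ n ∈ Finset.Icc 1 N, a n‖ ≤ C * K * (N / Real.log N ^ A) := by
  obtain ⟨C₀, hC₀, hces⟩ := exists_cesaro_bound
  set m := A + 1 with hm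
  set k := 2 * A + 1 with hk
  set C₁ : ℝ := 5 * C₀ + 3 ^ (k + 1) * (1 + m.factorial) with hC₁
  have hC₁0 : 0 < C₁ := by positivity
  refine ⟨2 * 2 ^ m * m.factorial + 2 * C₁ * 2 ^ k, by positivity,
    fun a K hK ha hsum hbd N hN => ?_⟩
  set b := LSeries.logMul^[k] a with hb
  have hbn : ∀ n, b n = ((Real.log n ^ k : ℝ) : ℂ) * a n := by
    intro n
    rw [hb, logMul_iterate_apply, ← Complex.natCast_log]
    push_cast; rfl
  have hbB : ∀ M : ℕ, 3 ≤ M → ∀ n, n ≤ 2 * M → ‖b n‖ ≤ (3 * Real.log M) ^ (k + 1) := by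
    intro M hM n hn
    have h1 := one_le_log_natCast hM
    have h2 := log_natCast_le_two_mul hM hn
    have h0 : 0 ≤ Real.log n := Real.log_natCast_nonneg n
    rw [hbn, norm_mul, Complex.norm_real, Real.norm_of_nonneg (by positivity),
      pow_succ (3 * Real.log M)]
    gcongr
    · linarith
    · linarith [ha n]
  have hT : ∀ M : ℕ, 3 ≤ M → ‖∑ n ∈ Finset.Icc 1 M, b n‖ ≤ C₁ * K * M * Real.log M ^ m := by
    intro M hM
    have hL := one_le_log_natCast hM
    have hMR : (3 : ℝ) ≤ M := by exact_mod_cast hM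
    set L := Real.log M with hLd
    have hLm : 1 ≤ L ^ m := one_le_pow₀ hL
    set h : ℕ := ⌈(M : ℝ) / L ^ m⌉₊ with hh
    have hq : 0 < (M : ℝ) / L ^ m := by positivity
    have h0 : 0 < h := Nat.ceil_pos.mpr hq
    have hhM : h ≤ M := Nat.ceil_le.mpr (div_le_self (by positivity) hLm)
    have hle : (M : ℝ) / L ^ m ≤ h := Nat.le_ceil _
    have hlt : (h : ℝ) ≤ M / L ^ m + 1 := (Nat.ceil_lt_add_one hq.le).le
    have hK0 : 0 ≤ K := by linarith
    have h1 := norm_sum_le_of_cesaro hM h0 hhM (hces b K hK0 hsum hbd) (by positivity)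
      (by positivity) (hbB M hM)
    have hhR : (0 : ℝ) < h := by exact_mod_cast h0
    have h2 : (M : ℝ) / h ≤ L ^ m := by
      rw [div_le_iff₀ (by positivity)] at hle ⊢; linarith
    have h3 : (h : ℝ) * L ^ m ≤ (1 + m.factorial) * M := by
      have h4 : L ^ m ≤ m.factorial * M := log_pow_le_factorial_mul (by linarith) m
      have : (M : ℝ) / L ^ m * L ^ m = M := by field_simp
      nlinarith
    have h5 : (h : ℝ) * (3 * L) ^ (k + 1) ≤ 3 ^ (k + 1) * (1 + m.factorial) * M * L ^ m := by
      rw [mul_pow, show k + 1 = m + m by omega, pow_add L]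
      calc _ = 3 ^ (m + m) * (h * L ^ m) * L ^ m := by ring
        _ ≤ 3 ^ (m + m) * ((1 + m.factorial) * M) * L ^ m := by gcongr
        _ = _ := by ring
    calc _ ≤ _ := h1
      _ ≤ 5 * (C₀ * K) * M * L ^ m + 3 ^ (k + 1) * (1 + m.factorial) * M * L ^ m * 1 := by
          rw [mul_one]; gcongr
      _ ≤ 5 * (C₀ * K) * M * L ^ m + 3 ^ (k + 1) * (1 + m.factorial) * M * L ^ m * K := by gcongr
      _ = _ := by rw [hC₁]; ring
  have hL := one_le_log_natCast hN
  set L := Real.log N with hLd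
  have hNR : (3 : ℝ) ≤ N := by exact_mod_cast hN
  have hT' : ∀ M : ℕ, M ≤ N → ‖∑ n ∈ Finset.Ico 1 (M + 1), b n‖ ≤ C₁ * K * N * L ^ m := by
    intro M hMN
    have hMNR : (M : ℝ) ≤ N := by exact_mod_cast hMN
    have hLm : 1 ≤ L ^ m := one_le_pow₀ hL
    rcases le_or_gt 3 M with h3 | h3
    · refine (hT M h3).trans ?_
      have := one_le_log_natCast h3
      have hK0 : 0 ≤ K := by linarith
      have : Real.log M ≤ L := Real.log_le_log (by positivity) hMNR
      gcongr
    · have hb1 : b 1 = 0 := by rw [hbn]; simp [hk]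
      have h1 : ‖∑ n ∈ Finset.Ico 1 (M + 1), b n‖ ≤ ‖b 2‖ := by
        interval_cases M
        · simp
        · simp [hb1]
        · rw [Finset.sum_Ico_succ_top (by norm_num)]; simp [hb1]
      have h2 : ‖b 2‖ ≤ 3 ^ (k + 1) := by
        rw [hbn, norm_mul, Complex.norm_real, Real.norm_of_nonneg (by positivity),
          pow_succ (3 : ℝ)]
        have hl2 : Real.log (2 : ℕ) ≤ 1 := by have := Real.log_two_lt_d9; push_cast; linarith
        gcongr
        · linarith
        · linarith [ha 2]
      refine (h1.trans h2).trans ?_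
      have h4 : (3 : ℝ) ^ (k + 1) ≤ C₁ := by
        rw [hC₁]
        have : (0 : ℝ) ≤ m.factorial := by positivity
        nlinarith [pow_pos (show (0 : ℝ) < 3 by norm_num) (k + 1)]
      calc _ ≤ C₁ * 1 * 1 * 1 := by linarith
        _ ≤ _ := by gcongr; linarith
  set s := Nat.sqrt N + 1 with hs
  have hsq : N < s ^ 2 := by rw [hs]; exact Nat.lt_succ_sqrt' N
  have hs2 : 2 ≤ s := by nlinarith
  have hsN : s ≤ N + 1 := by
    have := Nat.sqrt_le_self N; omega
  have hlogs : L / 2 ≤ Real.log s := by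
    have h1 : L ≤ Real.log ((s : ℝ) ^ 2) := by
      rw [hLd]
      refine Real.log_le_log (by positivity) ?_
      exact_mod_cast hsq.le
    rw [Real.log_pow] at h1
    push_cast at h1
    linarith
  rw [← Finset.Ico_add_one_right_eq_Icc, ← Finset.sum_Ico_consecutive _ (show 1 ≤ s by omega) hsN]
  have hfirst : ‖∑ n ∈ Finset.Ico 1 s, a n‖ ≤ (2 * 2 ^ m * m.factorial) * (N / L ^ A) := by
    have h1 : ‖∑ n ∈ Finset.Ico 1 s, a n‖ ≤ Nat.sqrt N * (2 * L) := by
      refine (norm_sum_le _ _).trans ?_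
      calc _ ≤ ∑ n ∈ Finset.Ico 1 s, 2 * L := by
            refine Finset.sum_le_sum fun n hn => (ha n).trans ?_
            rw [Finset.mem_Ico] at hn
            have : Real.log n ≤ L := Real.log_le_log (by exact_mod_cast hn.1)
              (by exact_mod_cast (show n ≤ N by omega))
            linarith
        _ = _ := by rw [Finset.sum_const, Nat.card_Ico, nsmul_eq_mul]; simp [hs]
    have hr : (Nat.sqrt N : ℝ) ≤ √N := Real.nat_sqrt_le_real_sqrt
    have hr1 : 1 ≤ √(N : ℝ) := by rw [Real.one_le_sqrt]; linarith
    have h2 : L ^ m ≤ 2 ^ m * (m.factorial * √N) := by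
      have h3 := log_pow_le_factorial_mul hr1 m
      rw [Real.log_sqrt (by positivity), div_pow, div_le_iff₀ (by positivity)] at h3
      linarith
    have hss : √(N : ℝ) * √N = N := Real.mul_self_sqrt (by positivity)
    have h4 : √(N : ℝ) * L ≤ 2 ^ m * m.factorial * (N / L ^ A) := by
      rw [← mul_div_assoc, le_div_iff₀ (by positivity)]
      calc _ = √(N : ℝ) * L ^ m := by rw [hm, pow_succ]; ring
        _ ≤ √(N : ℝ) * (2 ^ m * (m.factorial * √N)) := by gcongr
        _ = 2 ^ m * m.factorial * (√(N : ℝ) * √N) := by ring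
        _ = _ := by rw [hss]
    calc _ ≤ _ := h1
      _ ≤ √(N : ℝ) * (2 * L) := by gcongr
      _ ≤ _ := by linarith
  have hsecond : ‖∑ n ∈ Finset.Ico s (N + 1), a n‖ ≤ (2 * C₁ * 2 ^ k) * K * (N / L ^ A) := by
    have hpos : ∀ n, s ≤ n → 0 < Real.log n := fun n hn =>
      Real.log_pos (by exact_mod_cast (show 1 < n by omega))
    have he : ∑ n ∈ Finset.Ico s (N + 1), a n =
        ∑ n ∈ Finset.Ico s (N + 1), b n * (((Real.log n ^ k)⁻¹ : ℝ) : ℂ) := by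
      refine Finset.sum_congr rfl fun n hn => ?_
      have := hpos n (Finset.mem_Ico.mp hn).1
      rw [hbn, mul_right_comm, ← Complex.ofReal_mul, mul_inv_cancel₀ (by positivity)]
      simp
    rw [he]
    have hab := norm_sum_mul_le_of_antitone (f := b) (w := fun n : ℕ => (Real.log n ^ k)⁻¹)
      (M := 2 * (C₁ * K * N * L ^ m)) hsN ?_ ?_ ?_
    · refine hab.trans ?_
      have h1 : (Real.log s ^ k)⁻¹ ≤ 2 ^ k / L ^ k := by
        rw [inv_eq_one_div, div_le_div_iff₀ (pow_pos (hpos s le_rfl) k) (by positivity), one_mul,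
          ← mul_pow]
        gcongr
        linarith
      calc _ ≤ 2 * (C₁ * K * N * L ^ m) * (2 ^ k / L ^ k) := by gcongr
        _ = _ := by
          rw [show k = m + A by omega, pow_add L]
          field_simp
          rw [hm]
          ring
    · intro n h1 h2
      have := hpos n h1
      have h0 : (0 : ℝ) < n := by exact_mod_cast (show 0 < n by omega)
      exact inv_anti₀ (by positivity) (pow_le_pow_left₀ this.le
        (Real.log_le_log h0 (by push_cast; linarith)) k)
    · have := hpos (N + 1) hsN
      positivity
    · intro M h1 h2
      have h3 := Finset.sum_Ico_consecutive b (show 1 ≤ s by omega) h1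
      have h4 := hT' (M - 1) (by omega)
      have h5 := hT' (s - 1) (by omega)
      rw [show M - 1 + 1 = M by omega] at h4
      rw [show s - 1 + 1 = s by omega] at h5
      have : ∑ n ∈ Finset.Ico s M, b n = ∑ n ∈ Finset.Ico 1 M, b n - ∑ n ∈ Finset.Ico 1 s, b n := by
        rw [← h3]; ring
      rw [this]
      exact (norm_sub_le _ _).trans (by linarith)
  calc _ ≤ _ := norm_add_le _ _
    _ ≤ (2 * 2 ^ m * m.factorial) * 1 * (N / L ^ A) + (2 * C₁ * 2 ^ k) * K * (N / L ^ A) := by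
        rw [mul_one]; exact add_le_add hfirst hsecond
    _ ≤ (2 * 2 ^ m * m.factorial) * K * (N / L ^ A) + (2 * C₁ * 2 ^ k) * K * (N / L ^ A) := by
        gcongr
    _ = _ := by ring

end PartialSummation

section PrimesInProgressions

open Complex Filter Topology Set DirichletCharacter ArithmeticFunction

lemma LSeriesSummable_logMul_iterate {f : ℕ → ℂ} (h : ∀ s : ℂ, 1 < s.re → LSeriesSummable f s)
    (k : ℕ) {s : ℂ} (hs : 1 < s.re) : LSeriesSummable (LSeries.logMul^[k] f) s := by
  refine LSeriesSummable_of_abscissaOfAbsConv_lt_re ?_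
  rw [LSeries.absicssaOfAbsConv_logPowMul]
  exact (abscissaOfAbsConv_le_one_of_forall h).trans_lt (by exact_mod_cast hs)

theorem exists_psi_character_bound (A : ℕ) : ∃ C : ℝ, 0 < C ∧
    (∀ (q : ℕ) [NeZero q] (χ : DirichletCharacter ℂ q), χ ≠ 1 → ∀ N : ℕ, 3 ≤ N →
      ‖∑ n ∈ Finset.Icc 1 N, χ n * (Λ n : ℂ)‖ ≤ C * q * (N / Real.log N ^ A)) ∧
    ∀ N : ℕ, 3 ≤ N → ‖∑ n ∈ Finset.Icc 1 N, ((Λ n : ℂ) - 1)‖ ≤ C * (N / Real.log N ^ A) := by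
  obtain ⟨C₁, hC₁, h₁⟩ := exists_tauberian A
  obtain ⟨C₂, hC₂, h₂, h₃⟩ := exists_LSeries_logMul_vonMangoldt_le (2 * A + 1)
  have hlog : ∀ n : ℕ, 0 ≤ Real.log n := Real.log_natCast_nonneg
  refine ⟨C₁ * (C₂ + 1), by positivity, fun q _ χ hχ N hN => ?_, fun N hN => ?_⟩
  · have hq : (1 : ℝ) ≤ q := by exact_mod_cast Nat.one_le_iff_ne_zero.mpr (NeZero.ne q)
    have := h₁ (fun n => χ n * (Λ n : ℂ)) ((C₂ + 1) * q) (by nlinarith) ?_ ?_ ?_ N hN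
    · calc _ ≤ _ := this
        _ = _ := by ring
    · intro n
      rw [norm_mul, Complex.norm_real, Real.norm_of_nonneg vonMangoldt_nonneg]
      have h1 : ‖χ n‖ ≤ 1 := norm_le_one χ _
      have h2 : Λ n ≤ Real.log n := vonMangoldt_le_log
      have h3 : 0 ≤ Λ n := vonMangoldt_nonneg
      nlinarith [norm_nonneg (χ n)]
    · exact fun s hs => LSeriesSummable_logMul_iterate
        (fun z hz => LSeriesSummable_twist_vonMangoldt χ hz) _ hs
    · intro s hs1 hs2
      refine (h₂ q χ hχ s hs1 hs2).trans ?_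
      rw [anCond, Real.mul_rpow (by positivity) (by positivity), ← mul_assoc]
      have : (q : ℝ) ^ (1 / 2 : ℝ) ≤ q := by
        conv_rhs => rw [← Real.rpow_one (q : ℝ)]
        exact Real.rpow_le_rpow_of_exponent_le hq (by norm_num)
      gcongr
      linarith
  · have := h₁ (fun n => (Λ n : ℂ) - 1) (C₂ + 1) (by linarith) ?_ ?_ ?_ N hN
    · exact this
    · intro n
      rw [← Complex.ofReal_one, ← Complex.ofReal_sub, Complex.norm_real, Real.norm_eq_abs,
        abs_le]
      have h2 : Λ n ≤ Real.log n := vonMangoldt_le_log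
      have h3 : 0 ≤ Λ n := vonMangoldt_nonneg
      constructor <;> linarith [hlog n]
    · exact fun s hs => LSeriesSummable_logMul_iterate
        (fun z hz => (LSeriesSummable_vonMangoldt hz).sub (LSeriesSummable_one_iff.mpr hz)) _ hs
    · intro s hs1 hs2
      refine (h₃ s hs1 hs2).trans ?_
      rw [anCond, Nat.cast_one, one_mul]
      gcongr
      linarith

/-- The prime powers up to `N` that are not coprime to `q` contribute at most `q log N`. -/
lemma sum_vonMangoldt_not_coprime_le (q N : ℕ) [NeZero q] :
    ∑ n ∈ Finset.Icc 1 N with ¬ n.Coprime q, Λ n ≤ q * Real.log N := by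
  set P := ∏ p ∈ q.primeFactors, p ^ Nat.log p N with hP
  have hpp : ∀ p ∈ q.primeFactors, p.Prime := fun p hp => Nat.prime_of_mem_primeFactors hp
  have hP0 : P ≠ 0 := Finset.prod_ne_zero_iff.mpr fun p hp => pow_ne_zero _ (hpp p hp).ne_zero
  have hle : ∑ n ∈ Finset.Icc 1 N with ¬ n.Coprime q, Λ n ≤ ∑ d ∈ P.divisors, Λ d := by
    rw [← Finset.sum_filter_ne_zero]
    refine Finset.sum_le_sum_of_subset_of_nonneg ?_ fun _ _ _ => vonMangoldt_nonneg
    intro n hn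
    simp only [Finset.mem_filter, Finset.mem_Icc] at hn
    obtain ⟨⟨⟨h1, h2⟩, hco⟩, hne⟩ := hn
    rw [vonMangoldt_ne_zero_iff, isPrimePow_nat_iff] at hne
    obtain ⟨p, k, hp, hk, rfl⟩ := hne
    rw [Nat.coprime_pow_left_iff hk, hp.coprime_iff_not_dvd, not_not] at hco
    have hmem : p ∈ q.primeFactors := Nat.mem_primeFactors.mpr ⟨hp, hco, NeZero.ne q⟩
    rw [Nat.mem_divisors]
    refine ⟨(pow_dvd_pow p ?_).trans (Finset.dvd_prod_of_mem _ hmem), hP0⟩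
    exact Nat.le_log_of_pow_le hp.one_lt h2
  refine hle.trans ?_
  rw [vonMangoldt_sum, hP, Nat.cast_prod, Real.log_prod
    (fun p hp => by exact_mod_cast pow_ne_zero _ (hpp p hp).ne_zero)]
  have hcard : q.primeFactors.card ≤ q := by
    calc q.primeFactors.card ≤ (Finset.Icc 1 q).card := by
          refine Finset.card_le_card fun p hp => ?_
          rw [Finset.mem_Icc]
          exact ⟨(hpp p hp).one_le, Nat.le_of_mem_primeFactors hp⟩
      _ = q := by simp
  calc _ ≤ ∑ p ∈ q.primeFactors, Real.log N := by
        refine Finset.sum_le_sum fun p hp => ?_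
        rcases Nat.eq_zero_or_pos N with rfl | hN
        · simp
        · have h0 : 0 < p ^ Nat.log p N := pow_pos (hpp p hp).pos _
          refine Real.log_le_log (by exact_mod_cast h0) ?_
          exact_mod_cast Nat.pow_log_le_self p hN.ne'
    _ = q.primeFactors.card * Real.log N := by rw [Finset.sum_const, nsmul_eq_mul]
    _ ≤ _ := by
      have := Real.log_natCast_nonneg N
      gcongr

theorem exists_siegelWalfisz (A : ℕ) : ∃ C : ℝ, 0 < C ∧ ∀ (q : ℕ) [NeZero q] (b : ZMod q),
    IsUnit b → ∀ N : ℕ, 3 ≤ N →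
      |(∑ n ∈ Finset.Icc 1 N with ((n : ℕ) : ZMod q) = b, Λ n) - N / q.totient|
        ≤ C * q * (N / Real.log N ^ A) := by
  obtain ⟨C, hC, h₁, h₂⟩ := exists_psi_character_bound A
  refine ⟨C + C + (A + 1).factorial, by positivity, fun q _ b hb N hN => ?_⟩
  have hq : (1 : ℝ) ≤ q := by exact_mod_cast Nat.one_le_iff_ne_zero.mpr (NeZero.ne q)
  have hL := one_le_log_natCast hN
  have hNR : (3 : ℝ) ≤ N := by exact_mod_cast hN
  set E := (N : ℝ) / Real.log N ^ A with hE
  have hE0 : 0 < E := by positivity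
  have hlogE : Real.log N ≤ (A + 1).factorial * E := by
    rw [hE, ← mul_div_assoc, le_div_iff₀ (by positivity), ← pow_succ']
    exact log_pow_le_factorial_mul (by linarith) (A + 1)
  have hφ : (1 : ℝ) ≤ q.totient := by
    exact_mod_cast Nat.totient_pos.mpr (Nat.pos_of_ne_zero (NeZero.ne q))
  have hone : ‖(∑ n ∈ Finset.Icc 1 N, (1 : DirichletCharacter ℂ q) n * (Λ n : ℂ)) - N‖ ≤
      C * q * E + (A + 1).factorial * q * E := by
    have h3 := h₂ N hN
    rw [Finset.sum_sub_distrib, Finset.sum_const, Nat.card_Icc, nsmul_eq_mul, mul_one,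
      add_tsub_cancel_right] at h3
    have h4 : ∑ n ∈ Finset.Icc 1 N, (1 : DirichletCharacter ℂ q) n * (Λ n : ℂ) =
        ∑ n ∈ Finset.Icc 1 N, (Λ n : ℂ) -
          ((∑ n ∈ Finset.Icc 1 N with ¬ n.Coprime q, Λ n : ℝ) : ℂ) := by
      rw [eq_sub_iff_add_eq, Complex.ofReal_sum, Finset.sum_filter, ← Finset.sum_add_distrib]
      refine Finset.sum_congr rfl fun n _ => ?_
      by_cases hn : n.Coprime q
      · rw [if_neg (not_not.mpr hn), MulChar.one_apply ((ZMod.isUnit_iff_coprime n q).mpr hn)]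
        simp
      · rw [if_pos hn, MulChar.map_nonunit _ (by rwa [ZMod.isUnit_iff_coprime])]
        simp
    have h5 := sum_vonMangoldt_not_coprime_le q N
    have h6 : 0 ≤ ∑ n ∈ Finset.Icc 1 N with ¬ n.Coprime q, Λ n :=
      Finset.sum_nonneg fun _ _ => vonMangoldt_nonneg
    rw [h4, sub_right_comm]
    refine (norm_sub_le _ _).trans (add_le_add (h3.trans ?_) ?_)
    · nlinarith [mul_pos hC hE0]
    · rw [Complex.norm_real, Real.norm_of_nonneg h6]
      refine h5.trans ?_
      calc _ ≤ q * ((A + 1).factorial * E) := by gcongr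
        _ = _ := by ring
  have hid : (q.totient : ℂ) * ((∑ n ∈ Finset.Icc 1 N with ((n : ℕ) : ZMod q) = b, Λ n : ℝ) : ℂ) =
      ∑ χ : DirichletCharacter ℂ q, χ b⁻¹ * ∑ n ∈ Finset.Icc 1 N, χ n * (Λ n : ℂ) := by
    simp_rw [Finset.mul_sum]
    rw [Finset.sum_comm, Complex.ofReal_sum, Finset.sum_filter, Finset.mul_sum]
    refine Finset.sum_congr rfl fun n _ => ?_
    have := sum_char_inv_mul_char_eq ℂ hb (n : ZMod q)
    simp_rw [← mul_assoc]
    rw [← Finset.sum_mul, this]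
    simp only [eq_comm (a := b)]
    split_ifs <;> simp
  have hdiff : ‖(q.totient : ℂ) *
      ((∑ n ∈ Finset.Icc 1 N with ((n : ℕ) : ZMod q) = b, Λ n : ℝ) : ℂ) - N‖ ≤
      q.totient * (C * q * E) + (C * q * E + (A + 1).factorial * q * E) := by
    rw [hid, ← Finset.sum_erase_add _ _ (Finset.mem_univ (1 : DirichletCharacter ℂ q)),
      add_sub_assoc]
    have hb1 : (1 : DirichletCharacter ℂ q) b⁻¹ = 1 := by
      obtain ⟨u, rfl⟩ := hb
      rw [ZMod.inv_coe_unit]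
      exact MulChar.one_apply_coe _
    rw [hb1, one_mul]
    refine (norm_add_le _ _).trans (add_le_add ((norm_sum_le _ _).trans ?_) hone)
    calc _ ≤ ∑ χ ∈ Finset.univ.erase (1 : DirichletCharacter ℂ q), C * q * E := by
          refine Finset.sum_le_sum fun χ hχ => ?_
          rw [norm_mul]
          have h3 := h₁ q χ (Finset.ne_of_mem_erase hχ) N hN
          have h4 : ‖χ b⁻¹‖ ≤ 1 := norm_le_one χ _
          calc _ ≤ 1 * (C * q * E) := by gcongr
            _ = _ := one_mul _
      _ ≤ ∑ χ : DirichletCharacter ℂ q, C * q * E :=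
          Finset.sum_le_sum_of_subset_of_nonneg (Finset.erase_subset _ _)
            fun _ _ _ => by positivity
      _ = _ := by
          rw [Finset.sum_const, nsmul_eq_mul, Finset.card_univ, ← Nat.card_eq_fintype_card,
            DirichletCharacter.card_eq_totient_of_hasEnoughRootsOfUnity]
  set S := ∑ n ∈ Finset.Icc 1 N with ((n : ℕ) : ZMod q) = b, Λ n
  rw [show (q.totient : ℂ) * (S : ℂ) - N = ((q.totient * S - N : ℝ) : ℂ) by push_cast; ring,
    Complex.norm_real, Real.norm_eq_abs] at hdiff
  have h7 : S - N / q.totient = (q.totient * S - N) / q.totient := by field_simp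
  rw [h7, abs_div, abs_of_pos (by linarith : (0 : ℝ) < q.totient), div_le_iff₀ (by linarith)]
  refine hdiff.trans ?_
  have h8 : 0 ≤ C * q * E := by positivity
  have h9 : (0 : ℝ) ≤ (A + 1).factorial * q * E := by positivity
  nlinarith

end PrimesInProgressions

section ExponentialSums

/-- The additive character `x ↦ exp (2πix)` on the reals. -/
noncomputable def expChar (x : ℝ) : ℂ := Complex.exp (Complex.I * (2 * π * x : ℝ))

lemma expChar_add (x y : ℝ) : expChar (x + y) = expChar x * expChar y := by
  rw [expChar, expChar, expChar, ← Complex.exp_add]; congr 1; push_cast; ring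

@[simp] lemma expChar_zero : expChar 0 = 1 := by simp [expChar]

@[simp] lemma norm_expChar (x : ℝ) : ‖expChar x‖ = 1 := by
  rw [expChar, Complex.norm_exp]; simp

@[simp] lemma expChar_intCast (n : ℤ) : expChar n = 1 := by
  rw [expChar, Complex.exp_eq_one_iff]
  exact ⟨n, by push_cast; ring⟩

lemma expChar_add_intCast (x : ℝ) (n : ℤ) : expChar (x + n) = expChar x := by
  rw [expChar_add, expChar_intCast, mul_one]

lemma conj_expChar (x : ℝ) : (starRingEnd ℂ) (expChar x) = expChar (-x) := by
  rw [expChar, expChar, ← Complex.exp_conj]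
  rw [map_mul, Complex.conj_I, Complex.conj_ofReal]
  congr 1
  push_cast
  ring

/-- The distance to the nearest integer. -/
noncomputable def distInt (x : ℝ) : ℝ := |x - round x|

lemma distInt_nonneg (x : ℝ) : 0 ≤ distInt x := abs_nonneg _

lemma four_mul_distInt_le (x : ℝ) : 4 * distInt x ≤ ‖expChar x - 1‖ := by
  have h1 : expChar x = expChar (x - round x) := by
    conv_lhs => rw [← sub_add_cancel x (round x : ℝ)]
    rw [expChar_add_intCast]
  rw [h1, expChar, Complex.norm_exp_I_mul_ofReal_sub_one, distInt]
  set y := x - round x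
  have hy : |y| ≤ 1 / 2 := abs_sub_round x
  have h2 := Real.mul_abs_le_abs_sin (x := π * y) (by
    rw [abs_mul, abs_of_pos pi_pos]; nlinarith [pi_pos])
  rw [abs_mul, abs_of_pos pi_pos, ← mul_assoc, div_mul_cancel₀ _ pi_ne_zero] at h2
  rw [show 2 * π * y / 2 = π * y by ring, Real.norm_eq_abs, abs_mul, abs_of_pos (by norm_num : (0 : ℝ) < 2)]
  linarith

lemma norm_sum_expChar_mul_distInt_le (α : ℝ) (a b : ℕ) :
    ‖∑ n ∈ Finset.Ico a b, expChar (α * n)‖ * distInt α ≤ 1 / 2 := by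
  rcases le_or_gt a b with hab | hab
  · have h := Finset.sum_Ico_sub (fun n : ℕ => expChar (α * n)) hab
    have h2 : ∑ n ∈ Finset.Ico a b, (expChar (α * (n + 1 : ℕ)) - expChar (α * n)) =
        (∑ n ∈ Finset.Ico a b, expChar (α * n)) * (expChar α - 1) := by
      rw [Finset.sum_mul]
      refine Finset.sum_congr rfl fun n _ => ?_
      rw [show α * ((n + 1 : ℕ) : ℝ) = α * n + α by push_cast; ring, expChar_add]
      ring
    rw [h2] at h
    have h3 := congrArg norm h
    rw [norm_mul] at h3
    have h4 := norm_sub_le (expChar (α * b)) (expChar (α * a))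
    rw [norm_expChar, norm_expChar] at h4
    have := four_mul_distInt_le α
    nlinarith [norm_nonneg (∑ n ∈ Finset.Ico a b, expChar (α * n))]
  · rw [Finset.Ico_eq_empty (by omega)]; simp

lemma norm_sum_expChar_le (α : ℝ) (a b : ℕ) :
    ‖∑ n ∈ Finset.Ico a b, expChar (α * n)‖ ≤ (b - a : ℕ) := by
  refine (norm_sum_le _ _).trans ?_
  simp

lemma sum_Icc_neg_natAbs_le (n : ℕ) {h : ℕ → ℝ} (hh : ∀ k, 0 ≤ h k) :
    ∑ u ∈ Finset.Icc (-(n : ℤ)) n, h u.natAbs ≤ 2 * ∑ k ∈ Finset.range (n + 1), h k := by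
  set A := (Finset.range (n + 1)).image (fun k : ℕ => (k : ℤ))
  set B := (Finset.range (n + 1)).image (fun k : ℕ => -(k : ℤ))
  have hsub : Finset.Icc (-(n : ℤ)) n ⊆ A ∪ B := by
    intro u hu
    rw [Finset.mem_Icc] at hu
    simp only [A, B, Finset.mem_union, Finset.mem_image, Finset.mem_range]
    rcases le_total 0 u with h0 | h0
    · exact Or.inl ⟨u.natAbs, by omega, by omega⟩
    · exact Or.inr ⟨u.natAbs, by omega, by omega⟩
  have hA : ∑ u ∈ A, h u.natAbs = ∑ k ∈ Finset.range (n + 1), h k := by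
    rw [Finset.sum_image (by intro x _ y _ hxy; simpa using hxy)]
    simp
  have hB : ∑ u ∈ B, h u.natAbs = ∑ k ∈ Finset.range (n + 1), h k := by
    rw [Finset.sum_image (by intro x _ y _ hxy; simpa using hxy)]
    simp
  have hI : 0 ≤ ∑ u ∈ A ∩ B, h u.natAbs := Finset.sum_nonneg fun _ _ => hh _
  have hU := Finset.sum_union_inter (s₁ := A) (s₂ := B) (f := fun u : ℤ => h u.natAbs)
  have := Finset.sum_le_sum_of_subset_of_nonneg hsub
    (f := fun u : ℤ => h u.natAbs) (fun _ _ _ => hh _)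
  linarith

lemma sum_inv_range_le (q : ℕ) : ∑ k ∈ Finset.range (q + 1), ((k : ℝ))⁻¹ ≤ 1 + Real.log q := by
  have h := harmonic_le_one_add_log q
  rw [harmonic] at h
  push_cast at h
  rw [Finset.sum_range_succ']
  simpa using h

/-- A rational approximation of Dirichlet quality. -/
def IsDirichletApprox (α : ℝ) (a : ℤ) (q : ℕ) : Prop :=
  0 < q ∧ IsCoprime a (q : ℤ) ∧ |α - a / q| ≤ 1 / (q : ℝ) ^ 2

lemma sum_block_le {α : ℝ} {a : ℤ} {q : ℕ} (hα : IsDirichletApprox α a q) (γ : ℝ) {g : ℕ → ℝ}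
    {Y : ℝ} (hY : ∀ j, g j ≤ Y) (hY0 : 0 ≤ Y) (hg : ∀ j, g j * distInt (γ + α * j) ≤ 1) :
    ∑ j ∈ Finset.range q, g j ≤ 4 * Y + 8 * q * (1 + Real.log (q + 1)) := by
  obtain ⟨hq, hco, hap⟩ := hα
  have hqR : (0 : ℝ) < q := by exact_mod_cast hq
  set t : ℕ → ℤ := fun r => a * r - q * round (γ + α * r) + round (q * γ) with ht
  have hdiff : ∀ r ∈ Finset.range q,
      |q * ((γ + α * r) - round (γ + α * r)) - t r| ≤ 3 / 2 := by
    intro r hr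
    rw [Finset.mem_range] at hr
    have hrR : (r : ℝ) ≤ q := by exact_mod_cast hr.le
    have h1 : q * ((γ + α * r) - round (γ + α * r)) - t r =
        (q * γ - round (q * γ)) + q * r * (α - a / q) := by
      simp only [ht]; push_cast; field_simp; ring
    have h2 : |q * r * (α - a / q)| ≤ 1 := by
      rw [abs_mul, abs_of_nonneg (by positivity)]
      calc _ ≤ (q : ℝ) * q * (1 / (q : ℝ) ^ 2) := by gcongr
        _ = 1 := by field_simp
    rw [h1]
    refine (abs_add_le _ _).trans ?_
    linarith [abs_sub_round ((q : ℝ) * γ)]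
  have hinj : Set.InjOn t (Finset.range q) := by
    intro r hr s hs hrs
    rw [Finset.mem_coe, Finset.mem_range] at hr hs
    simp only [ht] at hrs
    have h1 : (q : ℤ) ∣ a * ((r : ℤ) - s) :=
      ⟨round (γ + α * r) - round (γ + α * s), by linear_combination hrs⟩
    have h2 : (q : ℤ) ∣ (r : ℤ) - s := hco.symm.dvd_of_dvd_mul_left h1
    have h3 := Int.eq_zero_of_abs_lt_dvd h2 (by rw [abs_lt]; omega)
    omega
  set h : ℕ → ℝ := fun k => (if k ≤ 1 then Y else 0) + 4 * q * (k : ℝ)⁻¹ with hh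
  have hh0 : ∀ k, 0 ≤ h k := by
    intro k; simp only [hh]
    refine add_nonneg ?_ (by positivity)
    split_ifs <;> simp [hY0]
  have hgt : ∀ r ∈ Finset.range q, g r ≤ h (t r).natAbs := by
    intro r hr
    have h1 := hdiff r hr
    simp only [hh]
    split_ifs with hk
    · have := hY r
      have : (0 : ℝ) ≤ 4 * q * ((t r).natAbs : ℝ)⁻¹ := by positivity
      linarith [hY r]
    · rw [zero_add]
      have hk2 : (2 : ℝ) ≤ (t r).natAbs := by exact_mod_cast (show 2 ≤ (t r).natAbs by omega)
      have habs : ((t r).natAbs : ℝ) = |(t r : ℝ)| := by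
        rw [Nat.cast_natAbs]; push_cast; rfl
      set T := ((t r).natAbs : ℝ)
      have h3 : T ≤ q * distInt (γ + α * r) + 3 / 2 := by
        rw [habs, distInt]
        have h4 := abs_sub_abs_le_abs_sub (t r : ℝ) (q * ((γ + α * r) - round (γ + α * r)))
        rw [abs_sub_comm, abs_mul, abs_of_pos hqR] at h4
        linarith
      rw [← div_eq_mul_inv, le_div_iff₀ (by linarith)]
      rcases le_or_gt (g r) 0 with hg0 | hg0
      · nlinarith
      · have h5 : T ≤ 4 * (q * distInt (γ + α * r)) := by linarith
        have h6 := hg r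
        calc g r * T ≤ g r * (4 * (q * distInt (γ + α * r))) := by gcongr
          _ = 4 * q * (g r * distInt (γ + α * r)) := by ring
          _ ≤ 4 * q * 1 := by gcongr
          _ = _ := mul_one _
  have htmem : ∀ r ∈ Finset.range q, t r ∈ Finset.Icc (-((q + 1 : ℕ) : ℤ)) ((q + 1 : ℕ) : ℤ) := by
    intro r hr
    have h1 := hdiff r hr
    have h2 : |(q : ℝ) * ((γ + α * r) - round (γ + α * r))| ≤ q * (1 / 2) := by
      rw [abs_mul, abs_of_pos hqR]
      gcongr
      exact abs_sub_round _
    rw [abs_le] at h1 h2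
    have hq1 : (1 : ℝ) ≤ q := by exact_mod_cast hq
    rw [Finset.mem_Icc]
    constructor
    · have : (-((q + 1 : ℕ) : ℤ) : ℝ) ≤ t r := by push_cast; linarith
      exact_mod_cast this
    · have : (t r : ℝ) ≤ ((q + 1 : ℕ) : ℤ) := by push_cast; linarith
      exact_mod_cast this
  calc ∑ j ∈ Finset.range q, g j ≤ ∑ j ∈ Finset.range q, h (t j).natAbs := Finset.sum_le_sum hgt
    _ = ∑ u ∈ (Finset.range q).image t, h u.natAbs :=
        (Finset.sum_image (f := fun u : ℤ => h u.natAbs) hinj).symm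
    _ ≤ ∑ u ∈ Finset.Icc (-((q + 1 : ℕ) : ℤ)) ((q + 1 : ℕ) : ℤ), h u.natAbs :=
        Finset.sum_le_sum_of_subset_of_nonneg (Finset.image_subset_iff.mpr htmem)
          fun _ _ _ => hh0 _
    _ ≤ 2 * ∑ k ∈ Finset.range (q + 1 + 1), h k := sum_Icc_neg_natAbs_le _ hh0
    _ ≤ 2 * (2 * Y + 4 * q * (1 + Real.log (q + 1))) := by
        gcongr
        simp only [hh]
        rw [Finset.sum_add_distrib, ← Finset.mul_sum]
        have h1 := sum_inv_range_le (q + 1)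
        push_cast at h1
        have h2 : ∑ k ∈ Finset.range (q + 1 + 1), (if k ≤ 1 then Y else 0) ≤ 2 * Y := by
          rw [← Finset.sum_filter, Finset.sum_const, nsmul_eq_mul]
          have : ((Finset.range (q + 1 + 1)).filter (· ≤ 1)).card ≤ 2 := by
            calc _ ≤ (Finset.range 2).card := Finset.card_le_card fun x hx => by
                  simp only [Finset.mem_filter, Finset.mem_range] at hx ⊢; omega
              _ = 2 := by simp
          have : (((Finset.range (q + 1 + 1)).filter (· ≤ 1)).card : ℝ) ≤ 2 := by exact_mod_cast this
          gcongr
        gcongr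
    _ = _ := by ring

lemma sum_range_le_of_block {α : ℝ} {a : ℤ} {q : ℕ} (hα : IsDirichletApprox α a q) (γ : ℝ)
    {g : ℕ → ℝ} {Y : ℝ} (hg0 : ∀ j, 0 ≤ g j) (hY : ∀ j, g j ≤ Y)
    (hg : ∀ j, g j * distInt (γ + α * j) ≤ 1) (H : ℕ) :
    ∑ j ∈ Finset.range H, g j ≤ (H / q + 1) * (4 * Y + 8 * q * (1 + Real.log (q + 1))) := by
  have hY0 : 0 ≤ Y := (hg0 0).trans (hY 0)
  have hq := hα.1
  have hqR : (0 : ℝ) < q := by exact_mod_cast hq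
  set D := 4 * Y + 8 * q * (1 + Real.log (q + 1)) with hD
  have hD0 : 0 ≤ D := by
    have : 0 ≤ Real.log ((q : ℝ) + 1) := Real.log_nonneg (by linarith)
    positivity
  have hind : ∀ t : ℕ, ∑ j ∈ Finset.range (q * t), g j ≤ t * D := by
    intro t
    induction t with
    | zero => simp
    | succ t ih =>
      rw [mul_add, mul_one, Finset.sum_range_add]
      have := sum_block_le hα (γ + α * (q * t : ℕ)) (g := fun j => g (q * t + j))
        (fun j => hY _) hY0 (fun j => by
          have := hg (q * t + j)
          rwa [show γ + α * ((q * t + j : ℕ) : ℝ) = γ + α * (q * t : ℕ) + α * j by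
            push_cast; ring] at this)
      push_cast
      linarith
  have h1 : H ≤ q * (H / q + 1) := by
    have := Nat.lt_mul_div_succ H hq; omega
  have h2 : ((H / q : ℕ) : ℝ) ≤ H / q := Nat.cast_div_le
  calc _ ≤ ∑ j ∈ Finset.range (q * (H / q + 1)), g j :=
        Finset.sum_le_sum_of_subset_of_nonneg (Finset.range_mono h1) fun _ _ _ => hg0 _
    _ ≤ ((H / q + 1 : ℕ) : ℝ) * D := hind _
    _ ≤ _ := by push_cast; gcongr

lemma inv_le_distInt {α : ℝ} {a : ℤ} {q : ℕ} (hα : IsDirichletApprox α a q) {j : ℕ} (hj : 0 < j)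
    (hjq : 2 * j ≤ q) : 1 / (2 * q) ≤ distInt (α * j) := by
  obtain ⟨hq, hco, hap⟩ := hα
  have hqR : (0 : ℝ) < q := by exact_mod_cast hq
  have hjR : 2 * (j : ℝ) ≤ q := by exact_mod_cast hjq
  rw [distInt]
  set z := round (α * j)
  have hne : a * j - q * z ≠ 0 := by
    intro h
    have h1 : (q : ℤ) ∣ a * j := ⟨z, by linarith⟩
    have h2 : (q : ℤ) ∣ j := hco.symm.dvd_of_dvd_mul_left h1
    have h3 : q ∣ j := by exact_mod_cast h2
    have := Nat.le_of_dvd hj h3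
    omega
  have h1 : (1 : ℝ) ≤ |(a : ℝ) * j - q * z| := by
    exact_mod_cast Int.one_le_abs hne
  have h2 : (a : ℝ) * j - q * z = q * (α * j - z) - q * j * (α - a / q) := by
    field_simp; ring
  have h3 : |q * j * (α - a / q)| ≤ 1 / 2 := by
    rw [abs_mul, abs_of_nonneg (by positivity)]
    calc _ ≤ (q : ℝ) * (q / 2) * (1 / (q : ℝ) ^ 2) := by gcongr; linarith
      _ = _ := by field_simp
  rw [h2] at h1
  have h4 := abs_sub (q * (α * j - z)) (q * j * (α - a / q))
  rw [abs_mul, abs_of_pos hqR] at h4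
  rw [div_le_iff₀ (by positivity)]
  linarith

end ExponentialSums

section BilinearSums

lemma one_add_log_le {q N : ℕ} (hN : 3 ≤ N) (hqN : q ≤ N) :
    1 + Real.log (q + 1) ≤ 3 * Real.log N := by
  have h1 := one_le_log_natCast hN
  have h2 := log_natCast_le_two_mul (n := q + 1) hN (by omega)
  push_cast at h2
  linarith

lemma natLog_two_add_one_le {M N : ℕ} (hN : 3 ≤ N) (hM : M ≤ N) :
    ((Nat.log 2 M + 1 : ℕ) : ℝ) ≤ 3 * Real.log N := by
  have h1 := one_le_log_natCast hN
  rcases Nat.eq_zero_or_pos M with rfl | h0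
  · simp; linarith
  have h2 : Nat.log 2 M * Real.log 2 ≤ Real.log N := by
    rw [← Real.log_pow]
    refine Real.log_le_log (by positivity) ?_
    exact_mod_cast (Nat.pow_log_le_self 2 h0.ne').trans hM
  have := Real.log_two_gt_d9
  push_cast
  nlinarith [(Nat.cast_nonneg (Nat.log 2 M) : (0 : ℝ) ≤ _)]

lemma sum_Icc_eq_sum_dyadic {E : Type*} [AddCommMonoid E] (s : Finset ℕ) (M : ℕ)
    (hs : ∀ m ∈ s, m ≤ M) (f : ℕ → E) :
    ∑ m ∈ s, f m =
      ∑ i ∈ Finset.range (Nat.log 2 M + 1), ∑ m ∈ s with Nat.log 2 m = i, f m := by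
  refine (Finset.sum_fiberwise_of_maps_to (fun m hm => ?_) f).symm
  rw [Finset.mem_range, Nat.lt_succ_iff]
  exact Nat.log_mono_right (hs m hm)

lemma mem_dyadic {m i : ℕ} (hm : 0 < m) (hi : Nat.log 2 m = i) : 2 ^ i ≤ m ∧ m < 2 ^ i * 2 := by
  subst hi
  exact ⟨Nat.pow_log_le_self 2 hm.ne', by
    have := Nat.lt_pow_succ_log_self (b := 2) (by norm_num) m; rwa [pow_succ] at this⟩

theorem sum_typeI_le {α : ℝ} {a : ℤ} {q : ℕ} (hα : IsDirichletApprox α a q) {N M : ℕ}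
    (hN : 3 ≤ N) (hq : q ≤ N) (hM : M ≤ N) {g : ℕ → ℝ} (hg0 : ∀ j, 0 ≤ g j)
    (hY : ∀ j, 0 < j → g j ≤ N / j) (hg : ∀ j, g j * distInt (α * j) ≤ 1) :
    ∑ m ∈ Finset.Icc 1 M, g m ≤ 432 * (N / q + M + q) * Real.log N ^ 2 := by
  have hL := one_le_log_natCast hN
  have hℓ := one_add_log_le hN hq
  set ℓ := 1 + Real.log ((q : ℝ) + 1) with hℓd
  set L := Real.log N with hLd
  have hq0 := hα.1
  have hqR : (0 : ℝ) < q := by exact_mod_cast hq0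
  have hℓ0 : 0 ≤ ℓ := by
    have : 0 ≤ Real.log ((q : ℝ) + 1) := Real.log_nonneg (by linarith)
    positivity
  have hblock : ∀ i ∈ Finset.range (Nat.log 2 M + 1),
      ∑ m ∈ Finset.Icc 1 M with Nat.log 2 m = i, g m ≤ 144 * (N / q + M + q) * L := by
    intro i hi
    have hpos : 0 ≤ 144 * ((N : ℝ) / q + M + q) * L := by positivity
    rcases Finset.eq_empty_or_nonempty {m ∈ Finset.Icc 1 M | Nat.log 2 m = i} with he | ⟨m₀, hm₀⟩
    · rw [he]; simpa using hpos
    have hdy : ∀ m ∈ ({m ∈ Finset.Icc 1 M | Nat.log 2 m = i} : Finset ℕ),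
        0 < m ∧ m ≤ M ∧ 2 ^ i ≤ m ∧ m < 2 ^ i * 2 := by
      intro m hm
      rw [Finset.mem_filter, Finset.mem_Icc] at hm
      have := mem_dyadic (by omega) hm.2
      exact ⟨by omega, by omega, this.1, this.2⟩
    have hPM : 2 ^ i ≤ M := (hdy m₀ hm₀).2.2.1.trans (hdy m₀ hm₀).2.1
    set P := 2 ^ i with hP
    have hP0 : 0 < P := by positivity
    have hPR : (0 : ℝ) < P := by exact_mod_cast hP0
    have hPMR : (P : ℝ) ≤ M := by exact_mod_cast hPM
    set S : Finset ℕ := {m ∈ Finset.Icc 1 M | Nat.log 2 m = i} with hS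
    set g' : ℕ → ℝ := fun j => if j ∈ S then g j else 0 with hg'
    have hsum : ∑ m ∈ S, g m ≤ ∑ m ∈ Finset.range (P * 2), g' m := by
      calc _ = ∑ m ∈ S, g' m := Finset.sum_congr rfl fun m hm => by simp [hg', hm]
        _ ≤ _ := by
          refine Finset.sum_le_sum_of_subset_of_nonneg (fun m hm => ?_) fun m _ _ => ?_
          · exact Finset.mem_range.mpr (hdy m hm).2.2.2
          · simp only [hg']; split_ifs; simp
    have hg'0 : ∀ j, 0 ≤ g' j := fun j => by simp only [hg']; split_ifs <;> simp [hg0]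
    have hg'd : ∀ j, g' j * distInt (0 + α * j) ≤ 1 := fun j => by
      simp only [hg', zero_add]; split_ifs
      · exact hg j
      · simp
    refine hsum.trans ?_
    rcases le_or_gt (P * 4) q with hPq | hPq
    · have hb := sum_range_le_of_block hα 0 (Y := 2 * q) hg'0 (fun j => ?_) hg'd (P * 2)
      · refine hb.trans ?_
        have h1 : ((P * 2 : ℕ) : ℝ) / q ≤ 1 := by
          rw [div_le_one hqR]; exact_mod_cast (show P * 2 ≤ q by omega)
        have h3 : (0 : ℝ) ≤ N / q := by positivity
        have hMR : (0 : ℝ) ≤ M := by positivity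
        calc _ ≤ (1 + 1) * (4 * (2 * q) + 8 * q * (3 * L)) := by gcongr
          _ ≤ 144 * (0 + 0 + q) * L := by nlinarith
          _ ≤ _ := by gcongr
      · simp only [hg']
        split_ifs with hj
        · obtain ⟨h1, h2, h3, h4⟩ := hdy j hj
          have h5 := inv_le_distInt hα h1 (by omega)
          have h6 := hg j
          have h7 : g j * (1 / (2 * q)) ≤ 1 :=
            (mul_le_mul_of_nonneg_left h5 (hg0 j)).trans h6
          rw [mul_one_div, div_le_one (by positivity)] at h7
          exact h7
        · positivity
    · have hb := sum_range_le_of_block hα 0 (Y := N / P) hg'0 (fun j => ?_) hg'd (P * 2)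
      · refine hb.trans ?_
        have h4 : (q : ℝ) ≤ P * 4 := by exact_mod_cast hPq.le
        have h5 : (N : ℝ) / P ≤ 4 * (N / q) := by
          rw [div_le_iff₀ hPR, ← mul_div_assoc, div_mul_eq_mul_div, le_div_iff₀ hqR]
          nlinarith [(Nat.cast_nonneg N : (0 : ℝ) ≤ N)]
        have h6 : (((P * 2 : ℕ) : ℝ) / q + 1) * (4 * (N / P) + 8 * q * ℓ) =
            8 * (N / q) + 4 * (N / P) + 16 * P * ℓ + 8 * q * ℓ := by
          push_cast; field_simp; ring
        rw [h6]
        have h3 : (0 : ℝ) ≤ N / q := by positivity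
        have hMR : (0 : ℝ) ≤ M := by positivity
        calc _ ≤ 8 * ((N : ℝ) / q) + 4 * (4 * (N / q)) + 16 * M * (3 * L) + 8 * q * (3 * L) := by
              gcongr
          _ ≤ _ := by nlinarith
      · simp only [hg']
        split_ifs with hj
        · obtain ⟨h1, h2, h3, h4⟩ := hdy j hj
          refine (hY j h1).trans ?_
          gcongr
        · positivity
  rw [sum_Icc_eq_sum_dyadic _ M (fun m hm => (Finset.mem_Icc.mp hm).2)]
  calc _ ≤ ∑ i ∈ Finset.range (Nat.log 2 M + 1), 144 * ((N : ℝ) / q + M + q) * L :=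
        Finset.sum_le_sum hblock
    _ = ((Nat.log 2 M + 1 : ℕ) : ℝ) * (144 * ((N : ℝ) / q + M + q) * L) := by
        rw [Finset.sum_const, Finset.card_range, nsmul_eq_mul]
    _ ≤ (3 * L) * (144 * ((N : ℝ) / q + M + q) * L) := by
        gcongr
        exact natLog_two_add_one_le hN hM
    _ = _ := by ring

lemma sum_sq_norm_bilinear_le {α : ℝ} {a : ℤ} {q : ℕ} (hα : IsDirichletApprox α a q)
    {N U P K : ℕ} {b : ℕ → ℂ} {B : ℝ} (hB : ∀ k ≤ N, ‖b k‖ ≤ B) (hKN : K ≤ N) (hU : 0 < U) :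
    ∑ m ∈ Finset.Ico P (P * 2),
        ‖∑ k ∈ Finset.range (K + 1) with U < k ∧ m * k ≤ N, b k * expChar (α * (m * k))‖ ^ 2 ≤
      B ^ 2 * ((K + 1) * ((((K + 1 : ℕ) : ℝ) / q + 1) *
        (4 * P + 8 * q * (1 + Real.log (q + 1))))) := by
  have hB0 : 0 ≤ B := (norm_nonneg _).trans (hB 0 (Nat.zero_le _))
  set c : ℕ → ℕ → ℂ := fun m k =>
    if U < k ∧ m * k ≤ N then b k * expChar (α * (m * k)) else 0 with hc
  have hz : ∀ m, ∑ k ∈ Finset.range (K + 1) with U < k ∧ m * k ≤ N,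
      b k * expChar (α * (m * k)) = ∑ k ∈ Finset.range (K + 1), c m k := fun m => by
    rw [Finset.sum_filter]
  simp_rw [hz]
  set T : ℕ → ℕ → ℕ := fun k k' => min (P * 2) (min (N / k + 1) (N / k' + 1)) with hT
  set g : ℕ → ℕ → ℝ := fun k' k =>
    ‖∑ m ∈ Finset.Ico P (T k k'), expChar ((-α * k' + α * k) * m)‖ with hg
  have hpair : ∀ k ∈ Finset.range (K + 1), ∀ k' ∈ Finset.range (K + 1),
      ‖∑ m ∈ Finset.Ico P (P * 2), c m k * (starRingEnd ℂ) (c m k')‖ ≤ B ^ 2 * g k' k := by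
    intro k hk k' hk'
    rw [Finset.mem_range] at hk hk'
    by_cases hkk : U < k ∧ U < k'
    · have h1 : ∑ m ∈ Finset.Ico P (P * 2), c m k * (starRingEnd ℂ) (c m k') =
          b k * (starRingEnd ℂ) (b k') *
            ∑ m ∈ Finset.Ico P (T k k'), expChar ((-α * k' + α * k) * m) := by
        have hset : Finset.Ico P (T k k') =
            {m ∈ Finset.Ico P (P * 2) | m * k ≤ N ∧ m * k' ≤ N} := by
          ext m
          simp only [hT, Finset.mem_Ico, Finset.mem_filter, lt_min_iff, Nat.lt_succ_iff,
            Nat.le_div_iff_mul_le (show 0 < k by omega),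
            Nat.le_div_iff_mul_le (show 0 < k' by omega)]
          tauto
        rw [hset, Finset.mul_sum, Finset.sum_filter]
        refine Finset.sum_congr rfl fun m _ => ?_
        simp only [hc, hkk.1, hkk.2, true_and]
        by_cases h2 : m * k ≤ N
        · by_cases h3 : m * k' ≤ N
          · rw [if_pos h2, if_pos h3, if_pos ⟨h2, h3⟩, map_mul, conj_expChar,
              show (-α * k' + α * k) * (m : ℝ) = α * (m * k) + -(α * (m * k')) by ring, expChar_add]
            ring
          · simp [h3]
        · simp [h2]
      rw [h1, norm_mul, norm_mul, RCLike.norm_conj, sq]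
      have := hB k (by omega)
      have := hB k' (by omega)
      gcongr
    · have h1 : ∑ m ∈ Finset.Ico P (P * 2), c m k * (starRingEnd ℂ) (c m k') = 0 := by
        refine Finset.sum_eq_zero fun m _ => ?_
        simp only [hc]
        rw [not_and_or] at hkk
        rcases hkk with h | h
        · rw [if_neg (fun h' => h h'.1)]; simp
        · rw [if_neg (c := U < k' ∧ _) (fun h' => h h'.1)]; simp
      rw [h1, norm_zero]
      positivity
  have hsum : ∀ k' ∈ Finset.range (K + 1), ∑ k ∈ Finset.range (K + 1), g k' k ≤
      (((K + 1 : ℕ) : ℝ) / q + 1) * (4 * P + 8 * q * (1 + Real.log (q + 1))) := by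
    intro k' _
    refine sum_range_le_of_block hα (-α * k') (fun j => norm_nonneg _) (fun j => ?_)
      (fun j => ?_) (K + 1)
    · refine (norm_sum_expChar_le _ _ _).trans ?_
      have : T j k' ≤ P * 2 := min_le_left _ _
      exact_mod_cast (show T j k' - P ≤ P by omega)
    · exact (norm_sum_expChar_mul_distInt_le _ _ _).trans (by norm_num)
  have hexp : ((∑ m ∈ Finset.Ico P (P * 2), ‖∑ k ∈ Finset.range (K + 1), c m k‖ ^ 2 : ℝ) : ℂ) =
      ∑ k' ∈ Finset.range (K + 1), ∑ k ∈ Finset.range (K + 1),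
        ∑ m ∈ Finset.Ico P (P * 2), c m k * (starRingEnd ℂ) (c m k') := by
    push_cast
    have h1 : ∀ m, ((‖∑ k ∈ Finset.range (K + 1), c m k‖ : ℂ)) ^ 2 =
        ∑ k' ∈ Finset.range (K + 1), ∑ k ∈ Finset.range (K + 1),
          c m k * (starRingEnd ℂ) (c m k') := by
      intro m
      rw [← Complex.mul_conj', map_sum, Finset.mul_sum]
      simp_rw [Finset.sum_mul]
    simp_rw [h1]
    rw [Finset.sum_comm]
    refine Finset.sum_congr rfl fun k' _ => ?_
    rw [Finset.sum_comm]
  have hnn : 0 ≤ ∑ m ∈ Finset.Ico P (P * 2), ‖∑ k ∈ Finset.range (K + 1), c m k‖ ^ 2 :=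
    Finset.sum_nonneg fun _ _ => by positivity
  rw [← Real.norm_of_nonneg hnn, ← Complex.norm_real, hexp]
  calc _ ≤ ∑ k' ∈ Finset.range (K + 1), ∑ k ∈ Finset.range (K + 1), B ^ 2 * g k' k :=
        (norm_sum_le _ _).trans (Finset.sum_le_sum fun k' hk' =>
          (norm_sum_le _ _).trans (Finset.sum_le_sum fun k hk => hpair k hk k' hk'))
    _ = B ^ 2 * ∑ k' ∈ Finset.range (K + 1), ∑ k ∈ Finset.range (K + 1), g k' k := by
        rw [Finset.mul_sum]
        refine Finset.sum_congr rfl fun _ _ => (Finset.mul_sum _ _ _).symm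
    _ ≤ B ^ 2 * ∑ k' ∈ Finset.range (K + 1),
        (((K + 1 : ℕ) : ℝ) / q + 1) * (4 * P + 8 * q * (1 + Real.log (q + 1))) := by
        gcongr with k' hk'
        exact hsum k' hk'
    _ = _ := by
        rw [Finset.sum_const, Finset.card_range, nsmul_eq_mul]; push_cast; ring

lemma typeII_block_le {N q B P W L ℓ k : ℝ} (hN : 0 ≤ N) (hq : 0 < q) (hk : 0 ≤ k) (hP : 0 ≤ P)
    (hL : 1 ≤ L) (hℓ0 : 0 ≤ ℓ) (hℓ : ℓ ≤ 3 * L) (hkP : k * P ≤ 2 * N) (hkW : k ≤ 4 * W)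
    (hPW : P ≤ W) :
    P * (B ^ 2 * (k * ((k / q + 1) * (4 * P + 8 * q * ℓ)))) ≤
      (16 * B * L) ^ 2 * (N * (N / q + W + q)) := by
  have e1 : P * (B ^ 2 * (k * ((k / q + 1) * (4 * P + 8 * q * ℓ)))) =
      B ^ 2 * (k * P) * (4 * (k * P) / q + 4 * P + 8 * k * ℓ + 8 * q * ℓ) := by
    field_simp
    ring
  have hW : 0 ≤ W := hP.trans hPW
  have h1 : 1 ≤ L ^ 2 := one_le_pow₀ hL
  have h2 : L ≤ L ^ 2 := le_self_pow₀ hL two_ne_zero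
  have hNq : 0 ≤ N / q := by positivity
  rw [e1]
  calc _ ≤ B ^ 2 * (2 * N) * (4 * (2 * N) / q + 4 * W + 8 * (4 * W) * (3 * L)
        + 8 * q * (3 * L)) := by gcongr
    _ = B ^ 2 * (2 * N) * (8 * (N / q) + (4 + 96 * L) * W + 24 * L * q) := by ring
    _ ≤ B ^ 2 * (2 * N) * ((128 * L ^ 2) * (N / q) + (128 * L ^ 2) * W
        + (128 * L ^ 2) * q) := by
      have e2 : 8 * (N / q) ≤ (128 * L ^ 2) * (N / q) :=
        mul_le_mul_of_nonneg_right (by linarith) hNq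
      have e3 : (4 + 96 * L) * W ≤ (128 * L ^ 2) * W :=
        mul_le_mul_of_nonneg_right (by linarith) hW
      have e4 : 24 * L * q ≤ (128 * L ^ 2) * q :=
        mul_le_mul_of_nonneg_right (by linarith) hq.le
      exact mul_le_mul_of_nonneg_left (by linarith) (by positivity)
    _ = _ := by ring

theorem norm_sum_typeII_le {α : ℝ} {a : ℤ} {q : ℕ} (hα : IsDirichletApprox α a q) {N U : ℕ}
    (hN : 3 ≤ N) (hq : q ≤ N) (hU : 0 < U) {u b : ℕ → ℂ} {B : ℝ} (hu : ∀ m, ‖u m‖ ≤ 1)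
    (hB : ∀ k ≤ N, ‖b k‖ ≤ B) :
    ‖∑ m ∈ Finset.Icc 1 N with U < m, u m *
        ∑ k ∈ Finset.Icc 1 N with U < k ∧ m * k ≤ N, b k * expChar (α * (m * k))‖ ≤
      48 * B * Real.log N ^ 2 * √(N * (N / q + N / U + q)) := by
  have hL := one_le_log_natCast hN
  have hB0 : 0 ≤ B := (norm_nonneg _).trans (hB 0 (Nat.zero_le _))
  have hℓ := one_add_log_le hN hq
  have hq0 := hα.1
  have hqR : (0 : ℝ) < q := by exact_mod_cast hq0
  have hUR : (0 : ℝ) < U := by exact_mod_cast hU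
  have hNR : (3 : ℝ) ≤ N := by exact_mod_cast hN
  set ℓ := 1 + Real.log ((q : ℝ) + 1) with hℓd
  set L := Real.log N with hLd
  have hℓ0 : 0 ≤ ℓ := by
    have : 0 ≤ Real.log ((q : ℝ) + 1) := Real.log_nonneg (by linarith)
    positivity
  set Δ := (N : ℝ) * (N / q + N / U + q) with hΔ
  have hΔ0 : 0 ≤ Δ := by positivity
  set z : ℕ → ℂ := fun m =>
    ∑ k ∈ Finset.Icc 1 N with U < k ∧ m * k ≤ N, b k * expChar (α * (m * k)) with hz
  have hblock : ∀ i ∈ Finset.range (Nat.log 2 N + 1),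
      ‖∑ m ∈ {m ∈ Finset.Icc 1 N | U < m} with Nat.log 2 m = i, u m * z m‖ ≤
        16 * B * L * √Δ := by
    intro i _
    have hzero : ∀ m, N < m * U → z m = 0 := by
      intro m hm
      refine Finset.sum_eq_zero fun k hk => ?_
      rw [Finset.mem_filter] at hk
      have : m * U ≤ m * k := Nat.mul_le_mul_left _ hk.2.1.le
      omega
    set P := 2 ^ i with hP
    have hP0 : 0 < P := by positivity
    have hPR : (0 : ℝ) < P := by exact_mod_cast hP0
    set S := {m ∈ {m ∈ Finset.Icc 1 N | U < m} | Nat.log 2 m = i} with hS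
    have hdy : ∀ m ∈ S, U < m ∧ m ≤ N ∧ P ≤ m ∧ m < P * 2 := by
      intro m hm
      rw [hS, Finset.mem_filter, Finset.mem_filter, Finset.mem_Icc] at hm
      have := mem_dyadic (by omega) hm.2
      exact ⟨by omega, by omega, this.1, this.2⟩
    by_cases hbig : N < P * U
    · rw [Finset.sum_eq_zero fun m hm => by
        rw [hzero m (hbig.trans_le (Nat.mul_le_mul_right _ (hdy m hm).2.2.1)), mul_zero]]
      simp only [norm_zero]
      positivity
    rcases Finset.eq_empty_or_nonempty S with he | ⟨m₀, hm₀⟩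
    · rw [he]; simp only [Finset.sum_empty, norm_zero]; positivity
    have hPU : U < P * 2 := (hdy m₀ hm₀).1.trans (hdy m₀ hm₀).2.2.2
    have hPN : P ≤ N := (hdy m₀ hm₀).2.2.1.trans (hdy m₀ hm₀).2.1
    set K := N / P with hK
    have hKN : K ≤ N := Nat.div_le_self _ _
    have hzK : ∀ m ∈ S, z m =
        ∑ k ∈ Finset.range (K + 1) with U < k ∧ m * k ≤ N, b k * expChar (α * (m * k)) := by
      intro m hm
      simp only [hz]
      refine Finset.sum_congr ?_ fun _ _ => rfl
      ext k
      simp only [Finset.mem_filter, Finset.mem_Icc, Finset.mem_range, Nat.lt_succ_iff, hK]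
      constructor
      · rintro ⟨-, h1, h2⟩
        refine ⟨?_, h1, h2⟩
        rw [Nat.le_div_iff_mul_le hP0, mul_comm]
        exact (Nat.mul_le_mul_right _ (hdy m hm).2.2.1).trans h2
      · rintro ⟨h0, h1, h2⟩
        exact ⟨⟨by omega, h0.trans hKN⟩, h1, h2⟩
    have hcs : ‖∑ m ∈ S, u m * z m‖ ^ 2 ≤ P * (B ^ 2 * ((K + 1) *
        ((((K + 1 : ℕ) : ℝ) / q + 1) * (4 * P + 8 * q * ℓ)))) := by
      calc ‖∑ m ∈ S, u m * z m‖ ^ 2 ≤ (∑ m ∈ S, ‖z m‖) ^ 2 := by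
            gcongr
            refine (norm_sum_le _ _).trans (Finset.sum_le_sum fun m _ => ?_)
            rw [norm_mul]
            exact mul_le_of_le_one_left (norm_nonneg _) (hu m)
        _ ≤ S.card * ∑ m ∈ S, ‖z m‖ ^ 2 := sq_sum_le_card_mul_sum_sq
        _ ≤ P * ∑ m ∈ S, ‖z m‖ ^ 2 := by
            have : S.card ≤ P := by
              calc S.card ≤ (Finset.Ico P (P * 2)).card := Finset.card_le_card fun m hm =>
                    Finset.mem_Ico.mpr (hdy m hm).2.2
                _ = P := by rw [Nat.card_Ico]; omega
            have : (S.card : ℝ) ≤ P := by exact_mod_cast this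
            have : 0 ≤ ∑ m ∈ S, ‖z m‖ ^ 2 := Finset.sum_nonneg fun _ _ => by positivity
            gcongr
        _ ≤ _ := by
            gcongr
            refine le_trans ?_ (sum_sq_norm_bilinear_le hα hB hKN hU)
            rw [Finset.sum_congr rfl fun m hm => by rw [hzK m hm]]
            exact Finset.sum_le_sum_of_subset_of_nonneg (fun m hm =>
              Finset.mem_Ico.mpr (hdy m hm).2.2) fun _ _ _ => by positivity
    have hK1 : ((K : ℝ) + 1) * P ≤ 2 * N := by
      have h1 : K * P ≤ N := Nat.div_mul_le_self _ _
      have h2 : (K : ℝ) * P ≤ N := by exact_mod_cast h1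
      have h3 : (P : ℝ) ≤ N := by exact_mod_cast hPN
      linarith
    have hPU' : (U : ℝ) ≤ P * 2 := by exact_mod_cast hPU.le
    have hPU2 : (P : ℝ) * U ≤ N := by exact_mod_cast (not_lt.mp hbig)
    have hmain : P * (B ^ 2 * ((K + 1) * ((((K + 1 : ℕ) : ℝ) / q + 1) * (4 * P + 8 * q * ℓ)))) ≤
        (16 * B * L * √Δ) ^ 2 := by
      rw [mul_pow, Real.sq_sqrt hΔ0]
      push_cast
      have hP1 : (P : ℝ) ≤ N / U := by rw [le_div_iff₀ hUR]; exact hPU2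
      have hkP : (K : ℝ) + 1 ≤ 4 * (N / U) := by
        rw [← mul_div_assoc, le_div_iff₀ hUR]
        nlinarith [(Nat.cast_nonneg K : (0 : ℝ) ≤ K)]
      exact typeII_block_le (by positivity) hqR (by positivity) (by positivity)
        hL hℓ0 hℓ hK1 hkP hP1
    exact le_of_sq_le_sq (hcs.trans hmain) (by positivity)
  rw [sum_Icc_eq_sum_dyadic _ N (fun m hm => (Finset.mem_Icc.mp (Finset.mem_filter.mp hm).1).2)]
  calc _ ≤ ∑ i ∈ Finset.range (Nat.log 2 N + 1), 16 * B * L * √Δ :=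
        (norm_sum_le _ _).trans (Finset.sum_le_sum hblock)
    _ = ((Nat.log 2 N + 1 : ℕ) : ℝ) * (16 * B * L * √Δ) := by
        rw [Finset.sum_const, Finset.card_range, nsmul_eq_mul]
    _ ≤ (3 * L) * (16 * B * L * √Δ) := by
        gcongr
        exact natLog_two_add_one_le hN le_rfl
    _ = _ := by ring

end BilinearSums

section Vaughan

open ArithmeticFunction hiding log
open ArithmeticFunction.zeta ArithmeticFunction.Moebius

/-- The restriction of an arithmetic function to `{n | n ≤ U}`. -/
noncomputable def truncLE (U : ℕ) (f : ArithmeticFunction ℝ) : ArithmeticFunction ℝ :=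
  ⟨fun n => if n ≤ U then f n else 0, by simp⟩

lemma truncLE_apply (U : ℕ) (f : ArithmeticFunction ℝ) (n : ℕ) :
    truncLE U f n = if n ≤ U then f n else 0 := rfl

lemma arith_sub_apply (f g : ArithmeticFunction ℝ) (n : ℕ) : (f - g) n = f n - g n := by
  rw [sub_eq_add_neg, ArithmeticFunction.add_apply, sub_eq_add_neg]
  rfl

lemma vaughan_identity (U : ℕ) :
    Λ = truncLE U Λ + truncLE U (μ : ArithmeticFunction ℝ) * ArithmeticFunction.log
      - (truncLE U (μ : ArithmeticFunction ℝ) * truncLE U Λ) * ζ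
      + ((μ : ArithmeticFunction ℝ) - truncLE U (μ : ArithmeticFunction ℝ)) *
        ((Λ - truncLE U Λ) * ζ) := by
  have h1 : (μ : ArithmeticFunction ℝ) * (ζ : ArithmeticFunction ℝ) = 1 :=
    coe_moebius_mul_coe_zeta
  have h2 : Λ * (ζ : ArithmeticFunction ℝ) = ArithmeticFunction.log := vonMangoldt_mul_zeta
  set m := (μ : ArithmeticFunction ℝ)
  set z := (ζ : ArithmeticFunction ℝ)
  linear_combination (truncLE U m) * h2 + (truncLE U Λ - Λ) * h1

lemma sum_Icc_mul_eq (f g : ArithmeticFunction ℝ) (F : ℕ → ℂ) (N : ℕ) :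
    ∑ n ∈ Finset.Icc 1 N, ((f * g) n : ℂ) * F n =
      ∑ m ∈ Finset.Icc 1 N, (f m : ℂ) *
        ∑ k ∈ Finset.Icc 1 N with m * k ≤ N, (g k : ℂ) * F (m * k) := by
  have h1 : ∀ n ∈ Finset.Icc 1 N, ((f * g) n : ℂ) * F n =
      ∑ x ∈ {x ∈ Finset.Icc 1 N ×ˢ Finset.Icc 1 N | x.1 * x.2 ≤ N} with x.1 * x.2 = n,
        (f x.1 : ℂ) * ((g x.2 : ℂ) * F (x.1 * x.2)) := by
    intro n hn
    rw [Finset.mem_Icc] at hn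
    rw [ArithmeticFunction.mul_apply,
      Nat.divisorsAntidiagonal_eq_prod_filter_of_le (by omega) hn.2]
    push_cast
    rw [Finset.sum_mul]
    refine Finset.sum_congr ?_ fun x hx => ?_
    · ext x
      simp only [Finset.mem_filter, Finset.mem_product, Finset.mem_Ioc, Finset.mem_Icc]
      constructor
      · rintro ⟨⟨h1, h2⟩, h3⟩
        exact ⟨⟨⟨⟨by omega, by omega⟩, by omega, by omega⟩, by omega⟩, h3⟩
      · rintro ⟨⟨⟨h1, h2⟩, -⟩, h3⟩
        exact ⟨⟨⟨by omega, by omega⟩, by omega, by omega⟩, h3⟩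
    · rw [Finset.mem_filter] at hx
      rw [hx.2]; ring
  rw [Finset.sum_congr rfl h1, Finset.sum_fiberwise_of_maps_to, Finset.sum_filter,
    Finset.sum_product]
  · refine Finset.sum_congr rfl fun m _ => ?_
    rw [Finset.mul_sum, ← Finset.sum_filter]
  · intro x hx
    simp only [Finset.mem_filter, Finset.mem_product, Finset.mem_Icc] at hx ⊢
    exact ⟨Nat.one_le_iff_ne_zero.mpr (Nat.mul_ne_zero (by omega) (by omega)), hx.2⟩

lemma exists_expChar_sum_bound (β : ℝ) (T : ℕ) : ∃ Y : ℝ, 0 ≤ Y ∧ Y ≤ T ∧ Y * distInt β ≤ 1 ∧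
    ∀ t ≤ T + 1, ‖∑ k ∈ Finset.Ico 1 t, expChar (β * k)‖ ≤ Y := by
  have h1 : ∀ t ≤ T + 1, ‖∑ k ∈ Finset.Ico 1 t, expChar (β * k)‖ ≤ T := fun t ht =>
    (norm_sum_expChar_le _ _ _).trans (by exact_mod_cast (by omega))
  by_cases h0 : distInt β = 0
  · exact ⟨T, by positivity, le_rfl, by simp [h0], h1⟩
  · have hd : 0 < distInt β := lt_of_le_of_ne (distInt_nonneg _) (Ne.symm h0)
    refine ⟨min T (1 / 2 / distInt β), by positivity, min_le_left _ _, ?_, fun t ht =>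
      le_min (h1 t ht) ?_⟩
    · calc _ ≤ 1 / 2 / distInt β * distInt β := by gcongr; exact min_le_right _ _
        _ ≤ 1 := by rw [div_mul_cancel₀ _ h0]; norm_num
    · rw [le_div_iff₀ hd]
      exact norm_sum_expChar_mul_distInt_le _ _ _

lemma filter_mul_le_eq_Ico {m N : ℕ} (hm : 0 < m) :
    {k ∈ Finset.Icc 1 N | m * k ≤ N} = Finset.Ico 1 (N / m + 1) := by
  ext k
  simp only [Finset.mem_filter, Finset.mem_Icc, Finset.mem_Ico, Nat.lt_succ_iff,
    Nat.le_div_iff_mul_le hm]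
  constructor
  · rintro ⟨⟨h1, h2⟩, h3⟩
    exact ⟨h1, by rw [mul_comm]; exact h3⟩
  · rintro ⟨h1, h2⟩
    rw [mul_comm] at h2
    exact ⟨⟨h1, (Nat.le_mul_of_pos_left k hm).trans h2⟩, h2⟩

/-- Type I sums with coefficients `f` bounded by `D`, supported on `m ≤ M`, and inner weight
`1` or `log`. -/
lemma norm_sum_typeI_le {α : ℝ} {a : ℤ} {q : ℕ} (hα : IsDirichletApprox α a q) {N M : ℕ}
    (hN : 3 ≤ N) (hq : q ≤ N) (hM : M ≤ N) {f g : ArithmeticFunction ℝ} {D E : ℝ}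
    (hf : ∀ m ≤ N, |f m| ≤ D) (hf0 : ∀ m, M < m → f m = 0)
    (hg : ∀ t ≤ N, ∀ Y : ℝ, ∀ c : ℕ → ℂ, 0 ≤ Y →
      (∀ s ≤ t + 1, ‖∑ k ∈ Finset.Ico 1 s, c k‖ ≤ Y) →
      ‖∑ k ∈ Finset.Ico 1 (t + 1), (g k : ℂ) * c k‖ ≤ E * Y) (hE : 0 ≤ E) :
    ‖∑ n ∈ Finset.Icc 1 N, ((f * g) n : ℂ) * expChar (α * n)‖ ≤
      D * (E * (432 * (N / q + M + q) * Real.log N ^ 2)) := by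
  have hD : 0 ≤ D := (abs_nonneg _).trans (hf 0 (Nat.zero_le _))
  choose Y hY0 hYT hYd hYs using fun m : ℕ => exists_expChar_sum_bound (α * m) (N / m)
  rw [sum_Icc_mul_eq]
  have hsub : ∑ m ∈ Finset.Icc 1 N, (f m : ℂ) *
        ∑ k ∈ Finset.Icc 1 N with m * k ≤ N, (g k : ℂ) * expChar (α * ((m * k : ℕ) : ℝ)) =
      ∑ m ∈ Finset.Icc 1 M, (f m : ℂ) *
        ∑ k ∈ Finset.Icc 1 N with m * k ≤ N, (g k : ℂ) * expChar (α * ((m * k : ℕ) : ℝ)) := by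
    refine (Finset.sum_subset (Finset.Icc_subset_Icc_right hM) fun m hm hm' => ?_).symm
    rw [Finset.mem_Icc] at hm hm'
    rw [hf0 m (by omega)]; simp
  rw [hsub]
  refine (norm_sum_le _ _).trans ?_
  have hterm : ∀ m ∈ Finset.Icc 1 M, ‖(f m : ℂ) *
        ∑ k ∈ Finset.Icc 1 N with m * k ≤ N, (g k : ℂ) * expChar (α * ((m * k : ℕ) : ℝ))‖ ≤
      D * (E * Y m) := by
    intro m hm
    rw [Finset.mem_Icc] at hm
    rw [norm_mul, Complex.norm_real, Real.norm_eq_abs, filter_mul_le_eq_Ico (by omega)]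
    refine mul_le_mul (hf m (by omega)) ?_ (norm_nonneg _) hD
    refine hg _ (Nat.div_le_self _ _) _ _ (hY0 m) fun s hs => ?_
    refine le_trans (le_of_eq ?_) (hYs m s hs)
    congr 1
    refine Finset.sum_congr rfl fun k _ => ?_
    congr 1
    push_cast; ring
  refine (Finset.sum_le_sum hterm).trans ?_
  rw [← Finset.mul_sum, ← Finset.mul_sum]
  gcongr
  refine sum_typeI_le hα hN hq hM hY0 (fun j _ => (hYT j).trans Nat.cast_div_le) hYd

lemma norm_sum_log_mul_le {N t : ℕ} (hN : 3 ≤ N) (ht : t ≤ N) {Y : ℝ} {c : ℕ → ℂ} (hY : 0 ≤ Y)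
    (hc : ∀ s ≤ t + 1, ‖∑ k ∈ Finset.Ico 1 s, c k‖ ≤ Y) :
    ‖∑ k ∈ Finset.Ico 1 (t + 1), ((ArithmeticFunction.log k : ℝ) : ℂ) * c k‖ ≤
      (4 * Real.log N) * Y := by
  have hL := one_le_log_natCast hN
  have hN1 := log_natCast_le_two_mul (n := N + 1) hN (by omega)
  have hl0 : 0 ≤ Real.log (N + 1 : ℕ) := Real.log_natCast_nonneg _
  have h1 : ‖∑ k ∈ Finset.Ico 1 (t + 1), c k * ((Real.log (N + 1 : ℕ) - Real.log k : ℝ) : ℂ)‖ ≤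
      Y * (Real.log (N + 1 : ℕ) - Real.log (1 : ℕ)) := by
    refine norm_sum_mul_le_of_antitone (w := fun k : ℕ => Real.log (N + 1 : ℕ) - Real.log k)
      (by omega) (fun n h _ => ?_) ?_ (fun m _ h => hc m h)
    · have : Real.log n ≤ Real.log (n + 1 : ℕ) :=
        Real.log_le_log (by exact_mod_cast h) (by push_cast; linarith)
      linarith
    · have : Real.log (t + 1 : ℕ) ≤ Real.log (N + 1 : ℕ) :=
        Real.log_le_log (by positivity) (by exact_mod_cast (by omega))
      linarith
  have h2 : ∑ k ∈ Finset.Ico 1 (t + 1), ((ArithmeticFunction.log k : ℝ) : ℂ) * c k =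
      (Real.log (N + 1 : ℕ) : ℂ) * ∑ k ∈ Finset.Ico 1 (t + 1), c k -
        ∑ k ∈ Finset.Ico 1 (t + 1), c k * ((Real.log (N + 1 : ℕ) - Real.log k : ℝ) : ℂ) := by
    rw [Finset.mul_sum, ← Finset.sum_sub_distrib]
    refine Finset.sum_congr rfl fun k _ => ?_
    rw [log_apply, Complex.ofReal_sub]; ring
  rw [h2]
  refine (norm_sub_le _ _).trans ?_
  rw [norm_mul, Complex.norm_real, Real.norm_of_nonneg hl0]
  have h3 := mul_le_mul hN1 (hc (t + 1) le_rfl) (norm_nonneg _) (by positivity)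
  rw [Nat.cast_one, Real.log_one, sub_zero] at h1
  have h4 := mul_le_mul_of_nonneg_left hN1 hY
  linarith

lemma abs_truncLE_moebius_le (U m : ℕ) : |truncLE U (μ : ArithmeticFunction ℝ) m| ≤ 1 := by
  rw [truncLE_apply]
  split_ifs
  · rw [intCoe_apply]; exact_mod_cast abs_moebius_le_one
  · simp

lemma abs_moebius_sub_truncLE_le (U m : ℕ) :
    |(μ m : ℝ) - truncLE U (μ : ArithmeticFunction ℝ) m| ≤ 1 := by
  rw [truncLE_apply]
  split_ifs
  · simp [intCoe_apply]
  · rw [sub_zero]; exact_mod_cast abs_moebius_le_one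

lemma truncLE_vonMangoldt_nonneg (U m : ℕ) : 0 ≤ truncLE U Λ m := by
  rw [truncLE_apply]
  split_ifs
  exacts [vonMangoldt_nonneg, le_rfl]

lemma truncLE_vonMangoldt_le (U m : ℕ) : truncLE U Λ m ≤ Λ m := by
  rw [truncLE_apply]
  split_ifs
  exacts [le_rfl, vonMangoldt_nonneg]

lemma abs_truncLE_mul_truncLE_le (U m : ℕ) :
    |(truncLE U (μ : ArithmeticFunction ℝ) * truncLE U Λ) m| ≤ Real.log m := by
  rw [ArithmeticFunction.mul_apply, ← vonMangoldt_sum,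
    ← Nat.sum_divisorsAntidiagonal' (f := fun _ y => Λ y)]
  refine (Finset.abs_sum_le_sum_abs _ _).trans (Finset.sum_le_sum fun x _ => ?_)
  rw [abs_mul, abs_of_nonneg (truncLE_vonMangoldt_nonneg U x.2)]
  exact (mul_le_of_le_one_left (truncLE_vonMangoldt_nonneg _ _)
    (abs_truncLE_moebius_le _ _)).trans (truncLE_vonMangoldt_le _ _)

lemma truncLE_mul_truncLE_eq_zero {U m : ℕ} (h : U ^ 2 < m) (f g : ArithmeticFunction ℝ) :
    (truncLE U f * truncLE U g) m = 0 := by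
  rw [ArithmeticFunction.mul_apply]
  refine Finset.sum_eq_zero fun x hx => ?_
  have hx := (Nat.mem_divisorsAntidiagonal.mp hx).1
  simp only [truncLE_apply]
  by_cases h1 : x.1 ≤ U
  · by_cases h2 : x.2 ≤ U
    · have := Nat.mul_le_mul h1 h2
      rw [← sq] at this
      omega
    · simp [h2]
  · simp [h1]

lemma norm_sub_truncLE_mul_zeta_le (U k : ℕ) :
    ‖(((Λ - truncLE U Λ) * (ζ : ArithmeticFunction ℝ)) k : ℂ)‖ ≤ Real.log k := by
  have h : ∀ i, 0 ≤ (Λ - truncLE U Λ) i := fun i => by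
    rw [arith_sub_apply]; linarith [truncLE_vonMangoldt_le U i]
  rw [Complex.norm_real, Real.norm_eq_abs, coe_mul_zeta_apply,
    abs_of_nonneg (Finset.sum_nonneg fun i _ => h i), ← vonMangoldt_sum]
  refine Finset.sum_le_sum fun i _ => ?_
  rw [arith_sub_apply]
  linarith [truncLE_vonMangoldt_nonneg U i]

lemma sub_truncLE_mul_zeta_eq_zero {U k : ℕ} (h : k ≤ U) :
    ((Λ - truncLE U Λ) * (ζ : ArithmeticFunction ℝ)) k = 0 := by
  rw [coe_mul_zeta_apply]
  refine Finset.sum_eq_zero fun i hi => ?_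
  rw [arith_sub_apply, truncLE_apply, if_pos ((Nat.divisor_le hi).trans h), sub_self]

theorem norm_sum_vonMangoldt_expChar_le {α : ℝ} {a : ℤ} {q : ℕ} (hα : IsDirichletApprox α a q)
    {N U : ℕ} (hN : 3 ≤ N) (hq : q ≤ N) (hU : 0 < U) (hUN : U ^ 2 ≤ N) :
    ‖∑ n ∈ Finset.Icc 1 N, (Λ n : ℂ) * expChar (α * n)‖ ≤
      4400 * Real.log N ^ 3 * (√(N * (N / q + N / U + q)) + U ^ 2) := by
  have hL := one_le_log_natCast hN
  have hUU : U ≤ U ^ 2 := Nat.le_self_pow two_ne_zero U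
  have hq0 := hα.1
  have hqR : (0 : ℝ) < q := by exact_mod_cast hq0
  have hqN : (q : ℝ) ≤ N := by exact_mod_cast hq
  have hUR : (U : ℝ) ≤ (U : ℝ) ^ 2 := by exact_mod_cast hUU
  have hlog : ∀ m ≤ N, Real.log m ≤ Real.log N := fun m hm => by
    rcases Nat.eq_zero_or_pos m with rfl | h
    · simp; positivity
    · exact Real.log_le_log (by exact_mod_cast h) (by exact_mod_cast hm)
  set L := Real.log N
  set e : ℕ → ℂ := fun n => expChar (α * n) with he
  set S : ArithmeticFunction ℝ → ℂ := fun f => ∑ n ∈ Finset.Icc 1 N, (f n : ℂ) * e n with hS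
  set Δ := (N : ℝ) * (N / q + N / U + q) with hΔ
  have hsplit : S Λ = S (truncLE U Λ) +
      S (truncLE U (μ : ArithmeticFunction ℝ) * ArithmeticFunction.log) -
      S ((truncLE U (μ : ArithmeticFunction ℝ) * truncLE U Λ) * ζ) +
      S (((μ : ArithmeticFunction ℝ) - truncLE U (μ : ArithmeticFunction ℝ)) *
        ((Λ - truncLE U Λ) * ζ)) := by
    simp only [hS]
    rw [← Finset.sum_add_distrib, ← Finset.sum_sub_distrib, ← Finset.sum_add_distrib]
    refine Finset.sum_congr rfl fun n _ => ?_
    conv_lhs => rw [vaughan_identity U]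
    simp only [ArithmeticFunction.add_apply, arith_sub_apply]
    push_cast
    ring
  have h1 : ‖S (truncLE U Λ)‖ ≤ U * L := by
    calc _ ≤ ∑ n ∈ Finset.Icc 1 N, truncLE U Λ n := by
          refine (norm_sum_le _ _).trans (Finset.sum_le_sum fun n _ => ?_)
          rw [norm_mul, norm_expChar, mul_one, Complex.norm_real,
            Real.norm_of_nonneg (truncLE_vonMangoldt_nonneg _ _)]
      _ = ∑ n ∈ Finset.Icc 1 U, truncLE U Λ n := by
          refine (Finset.sum_subset (Finset.Icc_subset_Icc_right (hUU.trans hUN)) ?_).symm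
          intro n hn hn'
          rw [Finset.mem_Icc] at hn hn'
          rw [truncLE_apply, if_neg (by omega)]
      _ ≤ ∑ n ∈ Finset.Icc 1 U, L := Finset.sum_le_sum fun n hn =>
          (truncLE_vonMangoldt_le _ _).trans (vonMangoldt_le_log.trans
            (hlog n (((Finset.mem_Icc.mp hn).2.trans hUU).trans hUN)))
      _ = U * L := by rw [Finset.sum_const, Nat.card_Icc, nsmul_eq_mul]; simp
  have h2 : ‖S (truncLE U (μ : ArithmeticFunction ℝ) * ArithmeticFunction.log)‖ ≤
      1 * (4 * L * (432 * (N / q + U + q) * L ^ 2)) := by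
    refine norm_sum_typeI_le hα hN hq (hUU.trans hUN) (fun m _ => abs_truncLE_moebius_le U m)
      (fun m hm => by rw [truncLE_apply, if_neg (by omega)])
      (fun t ht Y c hY hc => norm_sum_log_mul_le hN ht hY hc) (by positivity)
  have h3 : ‖S ((truncLE U (μ : ArithmeticFunction ℝ) * truncLE U Λ) * ζ)‖ ≤
      L * (1 * (432 * (N / q + (U ^ 2 : ℕ) + q) * L ^ 2)) := by
    refine norm_sum_typeI_le hα hN hq hUN
      (fun m hm => (abs_truncLE_mul_truncLE_le U m).trans (hlog m hm))
      (fun m hm => truncLE_mul_truncLE_eq_zero hm _ _) (fun t ht Y c hY hc => ?_) zero_le_one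
    rw [one_mul]
    refine le_trans (le_of_eq ?_) (hc (t + 1) le_rfl)
    congr 1
    refine Finset.sum_congr rfl fun k hk => ?_
    have : k ≠ 0 := by have := (Finset.mem_Ico.mp hk).1; omega
    simp [natCoe_apply, zeta_apply, this]
  have h4 : ‖S (((μ : ArithmeticFunction ℝ) - truncLE U (μ : ArithmeticFunction ℝ)) *
        ((Λ - truncLE U Λ) * ζ))‖ ≤ 48 * L * L ^ 2 * √Δ := by
    refine le_trans (le_of_eq ?_) (norm_sum_typeII_le hα hN hq hU
      (u := fun m => (((μ m : ℝ) - truncLE U (μ : ArithmeticFunction ℝ) m : ℝ) : ℂ))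
      (b := fun k => (((Λ - truncLE U Λ) * (ζ : ArithmeticFunction ℝ)) k : ℂ))
      (fun m => by rw [Complex.norm_real]; exact abs_moebius_sub_truncLE_le U m)
      (fun k hk => (norm_sub_truncLE_mul_zeta_le U k).trans (hlog k hk)))
    congr 1
    simp only [hS]
    rw [sum_Icc_mul_eq, Finset.sum_filter]
    refine Finset.sum_congr rfl fun m _ => ?_
    split_ifs with hm
    · rw [arith_sub_apply, intCoe_apply]
      congr 1
      rw [Finset.sum_filter, Finset.sum_filter]
      refine Finset.sum_congr rfl fun k _ => ?_
      by_cases hk : U < k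
      · simp [hk, he]
      · simp [hk, sub_truncLE_mul_zeta_eq_zero (not_lt.mp hk)]
    · rw [arith_sub_apply, truncLE_apply, if_pos (not_lt.mp hm), sub_self]
      simp
  have hNq : (N : ℝ) / q ≤ √Δ := by
    refine Real.le_sqrt_of_sq_le ?_
    have e1 : (1 : ℝ) ≤ q := by exact_mod_cast hq0
    calc ((N : ℝ) / q) ^ 2 = N / q * (N / q) := sq _
      _ ≤ N * (N / q) := by gcongr; exact div_le_self (by positivity) e1
      _ ≤ Δ := by rw [hΔ]; gcongr; linarith [show (0 : ℝ) ≤ N / U by positivity]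
  have hqD : (q : ℝ) ≤ √Δ := by
    refine Real.le_sqrt_of_sq_le ?_
    calc (q : ℝ) ^ 2 = q * q := sq _
      _ ≤ N * q := by gcongr
      _ ≤ Δ := by
        rw [hΔ]; gcongr
        linarith [show (0 : ℝ) ≤ N / U by positivity, show (0 : ℝ) ≤ N / q by positivity]
  have hL3 : L ≤ L ^ 3 := le_self_pow₀ hL (by norm_num)
  have hn : ‖S Λ‖ ≤ U * L + 1 * (4 * L * (432 * (N / q + U + q) * L ^ 2)) +
      L * (1 * (432 * (N / q + (U ^ 2 : ℕ) + q) * L ^ 2)) + 48 * L * L ^ 2 * √Δ := by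
    rw [hsplit]
    refine (norm_add_le _ _).trans (add_le_add ((norm_sub_le _ _).trans (add_le_add
      ((norm_add_le _ _).trans (add_le_add h1 h2)) h3)) h4)
  refine hn.trans ?_
  have hD0 : 0 ≤ √Δ := Real.sqrt_nonneg _
  push_cast
  calc _ ≤ (U : ℝ) ^ 2 * L ^ 3 + 1 * (4 * L * (432 * (√Δ + U ^ 2 + √Δ) * L ^ 2)) +
      L * (1 * (432 * (√Δ + U ^ 2 + √Δ) * L ^ 2)) + 48 * L * L ^ 2 * √Δ := by gcongr
    _ = L ^ 3 * (4368 * √Δ + 2161 * U ^ 2) := by ring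
    _ ≤ L ^ 3 * (4400 * √Δ + 4400 * U ^ 2) := by gcongr <;> norm_num
    _ = _ := by ring

end Vaughan

section RamanujanSums

open ArithmeticFunction hiding log
open ArithmeticFunction.zeta ArithmeticFunction.Moebius

lemma expChar_natCast (n : ℕ) : expChar n = 1 := by
  exact_mod_cast expChar_intCast n

lemma expChar_nat_mul (x : ℝ) (k : ℕ) : expChar (k * x) = expChar x ^ k := by
  induction k with
  | zero => simp
  | succ k ih => rw [pow_succ, ← ih, ← expChar_add]; congr 1; push_cast; ring

lemma expChar_eq_one_iff {x : ℝ} : expChar x = 1 ↔ ∃ z : ℤ, x = z := by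
  constructor
  · intro h
    have h1 := four_mul_distInt_le x
    rw [h, sub_self, norm_zero] at h1
    have h2 : distInt x = 0 := le_antisymm (by linarith) (distInt_nonneg x)
    exact ⟨round x, by rw [distInt, abs_eq_zero] at h2; linarith⟩
  · rintro ⟨z, rfl⟩
    exact expChar_intCast z

/-- The residues in `[0, q)` that are coprime to `q`. -/
def redRes (q : ℕ) : Finset ℕ := {a ∈ Finset.range q | q.Coprime a}

lemma mem_redRes {q a : ℕ} : a ∈ redRes q ↔ a < q ∧ q.Coprime a := by simp [redRes]

lemma card_redRes (q : ℕ) : (redRes q).card = q.totient := rfl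

lemma sum_range_expChar {q n : ℕ} (hq : 0 < q) :
    ∑ b ∈ Finset.range q, expChar ((b : ℝ) / q * n) = if q ∣ n then (q : ℂ) else 0 := by
  have hqR : (q : ℝ) ≠ 0 := by exact_mod_cast hq.ne'
  have h1 : ∀ b : ℕ, expChar ((b : ℝ) / q * n) = expChar (n / q) ^ b := fun b => by
    rw [← expChar_nat_mul]; congr 1; ring
  simp_rw [h1]
  split_ifs with h
  · obtain ⟨k, rfl⟩ := h
    have : expChar (((q * k : ℕ) : ℝ) / q) = 1 := by
      rw [Nat.cast_mul, mul_div_cancel_left₀ _ hqR]; exact expChar_natCast k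
    rw [this]
    simp
  · have hz : expChar ((n : ℝ) / q) ≠ 1 := by
      rw [Ne, expChar_eq_one_iff]
      rintro ⟨z, hz⟩
      apply h
      rw [div_eq_iff hqR] at hz
      have : (n : ℤ) = z * q := by exact_mod_cast hz
      exact Int.natCast_dvd_natCast.mp ⟨z, by rw [this]; ring⟩
    have h2 := geom_sum_eq hz q
    rw [h2, ← expChar_nat_mul, mul_div_cancel₀ _ hqR, expChar_natCast, sub_self, zero_div]

lemma sum_range_eq_sum_divisors_redRes {q : ℕ} (hq : 0 < q) (F : ℝ → ℂ) :
    ∑ b ∈ Finset.range q, F ((b : ℝ) / q) = ∑ d ∈ q.divisors, ∑ a ∈ redRes d, F ((a : ℝ) / d) := by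
  rw [← Nat.sum_div_divisors q (fun d => ∑ a ∈ redRes d, F ((a : ℝ) / d)),
    ← Finset.sum_fiberwise_of_maps_to (s := Finset.range q) (t := q.divisors)
      (g := fun b => q.gcd b) (fun b _ => Nat.mem_divisors.mpr ⟨Nat.gcd_dvd_left _ _, hq.ne'⟩)]
  refine Finset.sum_congr rfl fun d hd => ?_
  obtain ⟨x, rfl⟩ := Nat.dvd_of_mem_divisors hd
  have hd0 : 0 < d := Nat.pos_of_mul_pos_right hq
  rw [Nat.mul_div_cancel_left x hd0]
  symm
  refine Finset.sum_bij (fun k _ => d * k) ?_ ?_ ?_ ?_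
  · intro a ha
    rw [mem_redRes] at ha
    rw [Finset.mem_filter, Finset.mem_range, Nat.gcd_mul_left, ha.2, mul_one]
    exact ⟨by gcongr; exact ha.1, rfl⟩
  · intro a _ b _ h
    exact Nat.eq_of_mul_eq_mul_left hd0 h
  · intro b hb
    rw [Finset.mem_filter, Finset.mem_range] at hb
    obtain ⟨k, rfl⟩ : d ∣ b := by rw [← hb.2]; exact Nat.gcd_dvd_right _ _
    rw [Nat.gcd_mul_left] at hb
    exact ⟨k, mem_redRes.mpr ⟨Nat.lt_of_mul_lt_mul_left hb.1,
      Nat.eq_of_mul_eq_mul_left hd0 (by rw [hb.2, mul_one])⟩, rfl⟩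
  · intro a _
    have : (d : ℝ) ≠ 0 := by exact_mod_cast hd0.ne'
    congr 1
    push_cast
    rw [mul_div_mul_left _ _ this]

/-- The function `d ↦ d` restricted to the divisors of `n`. -/
def divisorIndicator (n : ℕ) : ArithmeticFunction ℝ :=
  ⟨fun d => if d ∣ n then (d : ℝ) else 0, by simp⟩

lemma divisorIndicator_apply (n d : ℕ) :
    divisorIndicator n d = if d ∣ n then (d : ℝ) else 0 := rfl

lemma isMultiplicative_divisorIndicator (n : ℕ) : (divisorIndicator n).IsMultiplicative := by
  refine ⟨by simp [divisorIndicator_apply], fun {a b} hab => ?_⟩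
  simp only [divisorIndicator_apply]
  by_cases ha : a ∣ n
  · by_cases hb : b ∣ n
    · rw [if_pos (hab.mul_dvd_of_dvd_of_dvd ha hb), if_pos ha, if_pos hb]; push_cast; rfl
    · rw [if_neg hb, if_neg fun h => hb ((Dvd.intro_left a rfl).trans h), mul_zero]
  · rw [if_neg ha, if_neg fun h => ha ((Dvd.intro b rfl).trans h), zero_mul]

/-- The Ramanujan sum `c_q(n)` as an arithmetic function of `q`. -/
noncomputable def ramanujanSum (n : ℕ) : ArithmeticFunction ℝ :=
  divisorIndicator n * (μ : ArithmeticFunction ℝ)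

lemma isMultiplicative_ramanujanSum (n : ℕ) : (ramanujanSum n).IsMultiplicative :=
  (isMultiplicative_divisorIndicator n).mul isMultiplicative_moebius.intCast

lemma sum_redRes_expChar (q n : ℕ) :
    ∑ a ∈ redRes q, expChar ((a : ℝ) / q * n) = (ramanujanSum n q : ℂ) := by
  set C : ArithmeticFunction ℂ :=
    ⟨fun q => ∑ a ∈ redRes q, expChar ((a : ℝ) / q * n), by simp [redRes]⟩ with hC
  set G : ArithmeticFunction ℂ := ⟨fun d => if d ∣ n then (d : ℂ) else 0, by simp⟩ with hG
  have h1 : C * (ζ : ArithmeticFunction ℂ) = G := by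
    ext k
    rw [coe_mul_zeta_apply]
    rcases Nat.eq_zero_or_pos k with rfl | hk
    · simp
    · have := sum_range_eq_sum_divisors_redRes hk (fun x => expChar (x * n))
      rw [sum_range_expChar hk] at this
      exact this.symm
  have h2 : C = G * (μ : ArithmeticFunction ℂ) := by
    rw [← h1, mul_assoc, coe_zeta_mul_coe_moebius, mul_one]
  change C q = _
  rw [h2, ramanujanSum, ArithmeticFunction.mul_apply, ArithmeticFunction.mul_apply]
  push_cast
  refine Finset.sum_congr rfl fun x _ => ?_
  rw [divisorIndicator_apply, intCoe_apply, intCoe_apply]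
  change (if x.1 ∣ n then (x.1 : ℂ) else 0) * _ = _
  split_ifs <;> simp

lemma abs_ramanujanSum_le (n q : ℕ) : |ramanujanSum n q| ≤ q.totient := by
  rw [← Real.norm_eq_abs, ← Complex.norm_real, ← sum_redRes_expChar]
  refine (norm_sum_le _ _).trans ?_
  simp [card_redRes]

lemma ramanujanSum_of_coprime {q a : ℕ} (h : q.Coprime a) (hq : 0 < q) :
    ramanujanSum a q = μ q := by
  rw [ramanujanSum, ArithmeticFunction.mul_apply, Finset.sum_eq_single (1, q)]
  · simp [divisorIndicator_apply, intCoe_apply]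
  · intro x hx hne
    rw [Nat.mem_divisorsAntidiagonal] at hx
    rw [divisorIndicator_apply, if_neg, zero_mul]
    intro hd
    have h1 : x.1 = 1 := Nat.eq_one_of_dvd_coprimes h (Dvd.intro _ hx.1) hd
    exact hne (Prod.ext h1 (by rw [h1, one_mul] at hx; exact hx.1))
  · intro h'
    exact absurd (Nat.mem_divisorsAntidiagonal.mpr ⟨one_mul q, hq.ne'⟩) h'

lemma ramanujanSum_prime (n : ℕ) {p : ℕ} (hp : p.Prime) :
    ramanujanSum n p = (if p ∣ n then (p : ℝ) else 0) - 1 := by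
  rw [ramanujanSum, ArithmeticFunction.mul_apply,
    Nat.sum_divisorsAntidiagonal' (f := fun x y => divisorIndicator n x * ((μ :
      ArithmeticFunction ℝ) y)), hp.divisors, Finset.sum_pair hp.one_lt.ne]
  simp [divisorIndicator_apply, intCoe_apply, moebius_apply_prime hp, hp.pos]
  ring

end RamanujanSums

section TwistedPrimes

open ArithmeticFunction hiding log
open ArithmeticFunction.Moebius

lemma div_log_pow_le (A : ℕ) {x n : ℕ} (hx : 3 ≤ x) (hn : x ≤ n) :
    (x : ℝ) / Real.log x ^ A ≤ 3 * A.factorial * (n / Real.log n ^ A) := by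
  have h1 := one_le_log_natCast hx
  have h2 := one_le_log_natCast (hx.trans hn)
  have hx0 : (0 : ℝ) < x := by positivity
  have hn0 : (0 : ℝ) < n := by exact_mod_cast (by omega : 0 < n)
  have hr : (1 : ℝ) ≤ n / x := by rw [one_le_div hx0]; exact_mod_cast hn
  have h3 : Real.log n ≤ Real.log x * Real.log (Real.exp 1 * (n / x)) := by
    rw [Real.log_mul (Real.exp_ne_zero 1) (by positivity), Real.log_exp,
      Real.log_div hn0.ne' hx0.ne']
    have : 0 ≤ Real.log n - Real.log x := by
      have := Real.log_le_log hx0 (by exact_mod_cast hn : (x : ℝ) ≤ n); linarith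
    nlinarith
  have h4 := log_pow_le_factorial_mul (x := Real.exp 1 * (n / x))
    (by nlinarith [Real.add_one_le_exp (1 : ℝ)]) A
  have h5 : Real.exp 1 ≤ 3 := by have := Real.exp_one_lt_d9; linarith
  rw [← mul_div_assoc, div_le_div_iff₀ (by positivity) (by positivity)]
  calc (x : ℝ) * Real.log n ^ A
      ≤ x * (Real.log x * Real.log (Real.exp 1 * (n / x))) ^ A := by gcongr
    _ = x * (Real.log x ^ A * Real.log (Real.exp 1 * (n / x)) ^ A) := by rw [mul_pow]
    _ ≤ x * (Real.log x ^ A * (A.factorial * (Real.exp 1 * (n / x)))) := by gcongr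
    _ ≤ x * (Real.log x ^ A * (A.factorial * (3 * (n / x)))) := by gcongr
    _ = _ := by field_simp

lemma log_pow_le_mul_div_log_pow (A k : ℕ) {n : ℕ} (hn : 3 ≤ n) :
    Real.log n ^ k ≤ (A + k).factorial * (n / Real.log n ^ A) := by
  have h2 := one_le_log_natCast hn
  have h3 := log_pow_le_factorial_mul (x := (n : ℝ)) (by exact_mod_cast (by omega)) (A + k)
  rw [← mul_div_assoc, le_div_iff₀ (by positivity), ← pow_add, add_comm k A]
  exact h3

lemma abs_moebius_div_totient_le (q : ℕ) : |(μ q : ℝ) / q.totient| ≤ 1 := by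
  rw [abs_div, Nat.abs_cast]
  rcases Nat.eq_zero_or_pos q with rfl | hq
  · simp
  · have h1 : |(μ q : ℝ)| ≤ 1 := by exact_mod_cast abs_moebius_le_one
    have h2 : (1 : ℝ) ≤ q.totient := by exact_mod_cast Nat.totient_pos.mpr hq
    rw [div_le_one (by linarith)]
    linarith

lemma sum_coprime_vonMangoldt_expChar (x q a : ℕ) (hq : 0 < q) :
    ∑ m ∈ Finset.Icc 1 x with m.Coprime q, (Λ m : ℂ) * expChar ((a : ℝ) / q * m) =
      ∑ b ∈ redRes q, expChar ((b : ℝ) / q * a) *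
        ((∑ m ∈ Finset.Icc 1 x with ((m : ℕ) : ZMod q) = (b : ZMod q), Λ m : ℝ) : ℂ) := by
  rw [← Finset.sum_fiberwise_of_maps_to (t := redRes q) (g := fun m => m % q)
    (fun m hm => by
      rw [Finset.mem_filter] at hm
      rw [mem_redRes]
      refine ⟨Nat.mod_lt _ hq, ?_⟩
      rw [Nat.Coprime, ← Nat.gcd_comm, ← Nat.gcd_rec, Nat.gcd_comm]
      exact hm.2)]
  refine Finset.sum_congr rfl fun b hb => ?_
  rw [mem_redRes] at hb
  rw [Complex.ofReal_sum, Finset.mul_sum]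
  have hmod : ∀ m : ℕ, (m : ZMod q) = (b : ZMod q) ↔ m % q = b := fun m => by
    rw [ZMod.natCast_eq_natCast_iff', Nat.mod_eq_of_lt hb.1]
  refine Finset.sum_congr ?_ fun m hm => ?_
  · ext m
    simp only [Finset.mem_filter, hmod]
    refine ⟨fun h => ⟨h.1.1, h.2⟩, fun h => ⟨⟨h.1, ?_⟩, h.2⟩⟩
    have := hb.2
    rw [← h.2, Nat.Coprime, ← Nat.gcd_comm, ← Nat.gcd_rec, Nat.gcd_comm] at this
    exact this
  · rw [Finset.mem_filter, hmod] at hm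
    have h1 : m = b + q * (m / q) := by rw [← hm.2, Nat.mod_add_div]
    have hqR : (q : ℝ) ≠ 0 := by exact_mod_cast hq.ne'
    have h2 : (a : ℝ) / q * m = (b : ℝ) / q * a + ((a * (m / q) : ℕ) : ℝ) := by
      conv_lhs => rw [h1]
      push_cast
      field_simp
    rw [h2, expChar_add, expChar_natCast]
    ring

theorem exists_sum_vonMangoldt_rational (A : ℕ) : ∃ C : ℝ, 0 < C ∧ ∀ n q a x : ℕ, 3 ≤ n → 0 < q →
    q.Coprime a → x ≤ n →
    ‖∑ m ∈ Finset.Icc 1 x, (Λ m : ℂ) * expChar ((a : ℝ) / q * m) -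
      ((μ q : ℝ) / q.totient : ℝ) * x‖ ≤ C * q ^ 2 * (n / Real.log n ^ A) := by
  obtain ⟨C, hC, hSW⟩ := exists_siegelWalfisz A
  refine ⟨3 * A.factorial * C + (A + 1).factorial + 3 * A.factorial, by positivity,
    fun n q a x hn hq hqa hx => ?_⟩
  have hL := one_le_log_natCast hn
  have hq1 : (1 : ℝ) ≤ q := by exact_mod_cast hq
  have hq2 : (q : ℝ) ≤ q ^ 2 := le_self_pow₀ hq1 two_ne_zero
  set X := (n : ℝ) / Real.log n ^ A with hX
  have hX0 : 0 ≤ X := by positivity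
  have hone : 1 ≤ A.factorial * X := by simpa using log_pow_le_mul_div_log_pow A 0 hn
  have hμ := abs_moebius_div_totient_le q
  rcases lt_or_ge x 3 with hx3 | hx3
  · have h1 : ‖∑ m ∈ Finset.Icc 1 x, (Λ m : ℂ) * expChar ((a : ℝ) / q * m)‖ ≤ 1 := by
      calc _ ≤ ∑ m ∈ Finset.Icc 1 x, Λ m := by
            refine (norm_sum_le _ _).trans (Finset.sum_le_sum fun m _ => ?_)
            rw [norm_mul, norm_expChar, mul_one, Complex.norm_real,
              Real.norm_of_nonneg vonMangoldt_nonneg]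
        _ ≤ ∑ m ∈ Finset.Icc 1 2, Λ m := Finset.sum_le_sum_of_subset_of_nonneg
            (Finset.Icc_subset_Icc_right (by omega)) fun _ _ _ => vonMangoldt_nonneg
        _ = Real.log 2 := by
            rw [show Finset.Icc 1 2 = {1, 2} from rfl, Finset.sum_pair (by norm_num),
              vonMangoldt_apply_one, vonMangoldt_apply_prime Nat.prime_two]
            simp
        _ ≤ 1 := by have := Real.log_two_lt_d9; linarith
    have h2 : ‖(((μ q : ℝ) / q.totient : ℝ) : ℂ) * x‖ ≤ 2 := by
      rw [norm_mul, Complex.norm_real, Real.norm_eq_abs, Complex.norm_natCast]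
      have : (x : ℝ) ≤ 2 := by exact_mod_cast (by omega : x ≤ 2)
      calc _ ≤ 1 * (2 : ℝ) := by gcongr
        _ = 2 := one_mul _
    calc _ ≤ (3 : ℝ) := (norm_sub_le _ _).trans (by linarith)
      _ ≤ 3 * (A.factorial * X) := by linarith
      _ ≤ 3 * (A.factorial * X) * q ^ 2 := le_mul_of_one_le_right (by positivity) (by linarith)
      _ ≤ _ := by
        have : 0 ≤ (3 * A.factorial * C + (A + 1).factorial) * q ^ 2 * X := by positivity
        linarith
  · have : NeZero q := ⟨hq.ne'⟩
    have hsplit := Finset.sum_filter_add_sum_filter_not (Finset.Icc 1 x) (fun m => m.Coprime q)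
      (fun m => (Λ m : ℂ) * expChar ((a : ℝ) / q * m))
    have hnc : ‖∑ m ∈ Finset.Icc 1 x with ¬ m.Coprime q,
        (Λ m : ℂ) * expChar ((a : ℝ) / q * m)‖ ≤ q * Real.log n := by
      calc _ ≤ ∑ m ∈ Finset.Icc 1 x with ¬ m.Coprime q, Λ m := by
            refine (norm_sum_le _ _).trans (Finset.sum_le_sum fun m _ => ?_)
            rw [norm_mul, norm_expChar, mul_one, Complex.norm_real,
              Real.norm_of_nonneg vonMangoldt_nonneg]
        _ ≤ q * Real.log x := sum_vonMangoldt_not_coprime_le q x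
        _ ≤ _ := by gcongr
    have hμsum : (((μ q : ℝ) / q.totient : ℝ) : ℂ) * x =
        ∑ b ∈ redRes q, expChar ((b : ℝ) / q * a) * ((x / q.totient : ℝ) : ℂ) := by
      rw [← Finset.sum_mul, sum_redRes_expChar, ramanujanSum_of_coprime hqa hq]
      push_cast; ring
    have hco : ‖∑ m ∈ Finset.Icc 1 x with m.Coprime q, (Λ m : ℂ) * expChar ((a : ℝ) / q * m) -
        (((μ q : ℝ) / q.totient : ℝ) : ℂ) * x‖ ≤ q * (C * q * (3 * A.factorial * X)) := by
      rw [sum_coprime_vonMangoldt_expChar x q a hq, hμsum, ← Finset.sum_sub_distrib]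
      calc _ ≤ ∑ b ∈ redRes q, C * q * (3 * A.factorial * X) := by
            refine (norm_sum_le _ _).trans (Finset.sum_le_sum fun b hb => ?_)
            rw [← mul_sub, norm_mul, norm_expChar, one_mul, ← Complex.ofReal_sub,
              Complex.norm_real, Real.norm_eq_abs]
            refine (hSW q b ?_ x hx3).trans ?_
            · rw [ZMod.isUnit_iff_coprime]; exact (mem_redRes.mp hb).2.symm
            · gcongr
              exact div_log_pow_le A hx3 hx
        _ = q.totient * (C * q * (3 * A.factorial * X)) := by
            rw [Finset.sum_const, card_redRes, nsmul_eq_mul]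
        _ ≤ _ := by
            gcongr
            exact_mod_cast Nat.totient_le q
    have hlog : Real.log n ≤ (A + 1).factorial * X := by
      simpa using log_pow_le_mul_div_log_pow A 1 hn
    rw [← hsplit, add_sub_right_comm]
    calc _ ≤ q * (C * q * (3 * A.factorial * X)) + q * Real.log n :=
          (norm_add_le _ _).trans (add_le_add hco hnc)
      _ ≤ q * (C * q * (3 * A.factorial * X)) + q ^ 2 * ((A + 1).factorial * X) := by gcongr
      _ ≤ _ := by
        have : 0 ≤ (3 * A.factorial) * q ^ 2 * X := by positivity
        linarith

/-- The density weight `1 / log m`. -/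
noncomputable def invLog (m : ℕ) : ℝ := (Real.log m)⁻¹

lemma invLog_zero : invLog 0 = 0 := by simp [invLog]

lemma invLog_one : invLog 1 = 0 := by simp [invLog]

lemma invLog_nonneg (m : ℕ) : 0 ≤ invLog m := inv_nonneg.mpr (Real.log_natCast_nonneg m)

lemma invLog_anti {m k : ℕ} (hm : 2 ≤ m) (hk : m ≤ k) : invLog k ≤ invLog m := by
  have h : (1 : ℝ) < m := by exact_mod_cast hm
  exact inv_anti₀ (Real.log_pos h)
    (Real.log_le_log (by linarith) (by exact_mod_cast hk))

lemma invLog_le_two (m : ℕ) : invLog m ≤ 2 := by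
  rcases lt_or_ge m 2 with h | h
  · interval_cases m
    · rw [invLog_zero]; norm_num
    · rw [invLog_one]; norm_num
  · refine (invLog_anti le_rfl h).trans ?_
    have := Real.log_two_gt_d9
    rw [invLog, inv_le_comm₀ (by push_cast; linarith) two_pos]
    push_cast; linarith

/-- The weight `Λ m / log m`, which is `1 / k` at the prime powers `p ^ k`. -/
noncomputable def primeWeight (m : ℕ) : ℝ := Λ m * invLog m

lemma primeWeight_zero : primeWeight 0 = 0 := by simp [primeWeight]

lemma primeWeight_one : primeWeight 1 = 0 := by simp [primeWeight, invLog_one]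

lemma primeWeight_nonneg (m : ℕ) : 0 ≤ primeWeight m :=
  mul_nonneg vonMangoldt_nonneg (invLog_nonneg m)

lemma primeWeight_le_one (m : ℕ) : primeWeight m ≤ 1 := by
  rw [primeWeight, invLog, ← div_eq_mul_inv]
  exact div_le_one_of_le₀ vonMangoldt_le_log (Real.log_natCast_nonneg m)

lemma sum_range_eq_sum_Ico_two {F : ℕ → ℂ} (h0 : F 0 = 0) (h1 : F 1 = 0) {t : ℕ} (ht : 2 ≤ t) :
    ∑ m ∈ Finset.range t, F m = ∑ m ∈ Finset.Ico 2 t, F m := by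
  rw [← Finset.sum_range_add_sum_Ico F ht]
  simp [Finset.sum_range_succ, h0, h1]

/-- The deviation of the weighted primes from their expected density along `e(a m / q)`. -/
noncomputable def primeDeviation (q a : ℕ) (m : ℕ) : ℂ :=
  primeWeight m * expChar ((a : ℝ) / q * m) - ((μ q : ℝ) / q.totient : ℝ) * invLog m

theorem exists_sum_primeDeviation_le (A : ℕ) : ∃ C : ℝ, 0 < C ∧ ∀ n q a t : ℕ, 3 ≤ n → 0 < q →
    q.Coprime a → t ≤ n + 1 →
    ‖∑ m ∈ Finset.range t, primeDeviation q a m‖ ≤ C * q ^ 2 * (n / Real.log n ^ A) := by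
  obtain ⟨C, hC, h⟩ := exists_sum_vonMangoldt_rational A
  refine ⟨2 * C + 2 * A.factorial, by positivity, fun n q a t hn hq hqa ht => ?_⟩
  have hL := one_le_log_natCast hn
  have hq1 : (1 : ℝ) ≤ q := by exact_mod_cast hq
  have hq2 : (1 : ℝ) ≤ q ^ 2 := one_le_pow₀ hq1
  set X := (n : ℝ) / Real.log n ^ A with hX
  have hX0 : 0 ≤ X := by positivity
  have hone : 1 ≤ A.factorial * X := by simpa using log_pow_le_mul_div_log_pow A 0 hn
  have hμ := abs_moebius_div_totient_le q
  have z0 : primeDeviation q a 0 = 0 := by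
    simp [primeDeviation, primeWeight_zero, invLog_zero]
  have z1 : primeDeviation q a 1 = 0 := by
    simp [primeDeviation, primeWeight_one, invLog_one]
  rcases lt_or_ge t 2 with ht2 | ht2
  · have : ∑ m ∈ Finset.range t, primeDeviation q a m = 0 := by
      interval_cases t
      · simp
      · simp [z0]
    rw [this, norm_zero]
    positivity
  rw [sum_range_eq_sum_Ico_two z0 z1 ht2]
  set κ : ℂ := (((μ q : ℝ) / q.totient : ℝ) : ℂ) with hκ
  have hκ1 : ‖κ‖ ≤ 1 := by rw [hκ, Complex.norm_real]; exact hμ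
  have hfac : ∀ m, primeDeviation q a m =
      ((Λ m : ℂ) * expChar ((a : ℝ) / q * m) - κ) * (invLog m : ℂ) := fun m => by
    simp only [primeDeviation, primeWeight, hκ]; push_cast; ring
  simp_rw [hfac]
  have hpart : ∀ s, 2 ≤ s → s ≤ t →
      ‖∑ m ∈ Finset.Ico 2 s, ((Λ m : ℂ) * expChar ((a : ℝ) / q * m) - κ)‖ ≤
        C * q ^ 2 * X + 1 := by
    intro s hs hst
    have e1 : ∑ m ∈ Finset.Ico 2 s, ((Λ m : ℂ) * expChar ((a : ℝ) / q * m) - κ) =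
        (∑ m ∈ Finset.Icc 1 (s - 1), (Λ m : ℂ) * expChar ((a : ℝ) / q * m) -
          κ * (s - 1 : ℕ)) + κ := by
      have e2 : Finset.Icc 1 (s - 1) = Finset.Ico 1 s := by
        ext m; simp only [Finset.mem_Icc, Finset.mem_Ico]; omega
      rw [e2, Finset.sum_eq_sum_Ico_succ_bot (by omega : 1 < s), vonMangoldt_apply_one,
        Finset.sum_sub_distrib, Finset.sum_const, Nat.card_Ico, nsmul_eq_mul,
        show s - 1 = (s - 2) + 1 by omega]
      push_cast
      ring
    rw [e1]
    exact (norm_add_le _ _).trans (add_le_add (h n q a (s - 1) hn hq hqa (by omega)) hκ1)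
  have hab := norm_sum_mul_le_of_antitone (w := invLog) ht2
    (fun m hm _ => invLog_anti hm (Nat.le_succ m)) (invLog_nonneg t) hpart
  refine hab.trans ?_
  have h3 : (1 : ℝ) ≤ A.factorial * X * q ^ 2 := hone.trans
    (le_mul_of_one_le_right (by positivity) hq2)
  calc _ ≤ (C * q ^ 2 * X + 1) * 2 := by gcongr; exact invLog_le_two 2
    _ ≤ _ := by linarith

lemma norm_expChar_sub_le (x y : ℝ) : ‖expChar x - expChar y‖ ≤ 2 * π * |x - y| := by
  have h : expChar x - expChar y = expChar y * (expChar (x - y) - 1) := by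
    rw [mul_sub, ← expChar_add, add_sub_cancel, mul_one]
  rw [h, norm_mul, norm_expChar, one_mul, expChar]
  refine (Real.norm_exp_I_mul_ofReal_sub_one_le).trans (le_of_eq ?_)
  rw [norm_mul, Real.norm_of_nonneg (by positivity), Real.norm_eq_abs]

theorem exists_sum_primeDeviation_mul_expChar_le (A : ℕ) : ∃ C : ℝ, 0 < C ∧
    ∀ n q a : ℕ, ∀ β : ℝ, 3 ≤ n → 0 < q → q.Coprime a →
    ‖∑ m ∈ Finset.range (n + 1), primeDeviation q a m * expChar (β * m)‖ ≤
      C * q ^ 2 * (n / Real.log n ^ A) * (1 + |β| * n) := by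
  obtain ⟨C, hC, h⟩ := exists_sum_primeDeviation_le A
  refine ⟨C * 14, by positivity, fun n q a β hn hq hqa => ?_⟩
  have hL := one_le_log_natCast hn
  have hn1 : (1 : ℝ) ≤ n := by exact_mod_cast (by omega)
  have hab := norm_sum_mul_le (f := primeDeviation q a) (w := fun m => expChar (β * m))
    (Nat.zero_le (n + 1)) (fun m _ hm => by
      rw [← Finset.range_eq_Ico]
      exact h n q a m hn hq hqa hm)
  rw [← Finset.range_eq_Ico] at hab
  refine hab.trans ?_
  have hvar : ∑ m ∈ Finset.range (n + 1), ‖expChar (β * m) - expChar (β * (m + 1 : ℕ))‖ ≤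
      (n + 1) * (2 * π * |β|) := by
    calc _ ≤ ∑ m ∈ Finset.range (n + 1), 2 * π * |β| := by
          refine Finset.sum_le_sum fun m _ => (norm_expChar_sub_le _ _).trans (le_of_eq ?_)
          rw [← mul_sub, abs_mul]
          push_cast
          rw [sub_add_cancel_left, abs_neg, abs_one, mul_one]
      _ = _ := by rw [Finset.sum_const, Finset.card_range, nsmul_eq_mul]; push_cast; ring
  rw [norm_expChar, show C * 14 * q ^ 2 * (n / Real.log n ^ A) * (1 + |β| * n) =
    C * q ^ 2 * (n / Real.log n ^ A) * (14 * (1 + |β| * n)) by ring]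
  gcongr
  have hπ : π ≤ 3.15 := Real.pi_lt_d2.le
  have hb := abs_nonneg β
  calc _ ≤ 1 + ((n : ℝ) + 1) * (2 * π * |β|) := by gcongr
    _ ≤ 1 + ((n : ℝ) + n) * (2 * 3.15 * |β|) := by gcongr
    _ ≤ _ := by nlinarith [mul_nonneg hb (by linarith : (0 : ℝ) ≤ n)]

end TwistedPrimes

section Model

open ArithmeticFunction hiding log
open ArithmeticFunction.Moebius

lemma norm_sum_primeWeight_expChar_le {α : ℝ} {a : ℤ} {q n K : ℕ} (hα : IsDirichletApprox α a q)
    (hn : 3 ≤ n) (hK : 0 < K) (hKq : K ^ 2 ≤ q) (hqn : q * K ^ 2 ≤ n) (hKn : K ^ 6 ≤ n) :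
    ‖∑ m ∈ Finset.range (n + 1), (primeWeight m : ℂ) * expChar (α * m)‖ ≤
      30000 * Real.log n ^ 3 * (n / K) := by
  have hL := one_le_log_natCast hn
  set L := Real.log n with hLd
  have hKR : (1 : ℝ) ≤ K := by exact_mod_cast hK
  have hK0 : (0 : ℝ) < K := by linarith
  have hqR : (K : ℝ) ^ 2 ≤ q := by exact_mod_cast hKq
  have hqnR : (q : ℝ) * K ^ 2 ≤ n := by exact_mod_cast hqn
  have hKnR : (K : ℝ) ^ 6 ≤ n := by exact_mod_cast hKn
  have hn0 : (0 : ℝ) ≤ n := Nat.cast_nonneg n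
  have hlog : ∀ x : ℕ, x ≤ n → Real.log x ≤ L := fun x hx => by
    rcases Nat.eq_zero_or_pos x with rfl | h
    · simp; positivity
    · exact Real.log_le_log (by exact_mod_cast h) (by exact_mod_cast hx)
  have hL3 : L ≤ L ^ 3 := le_self_pow₀ hL (by norm_num)
  have hpart : ∀ x ≤ n, ‖∑ m ∈ Finset.Icc 1 x, (Λ m : ℂ) * expChar (α * m)‖ ≤
      15000 * L ^ 3 * (n / K) := by
    intro x hx
    by_cases hxs : x * K ^ 2 < n
    · have hxR : (x : ℝ) * K ^ 2 ≤ n := by exact_mod_cast hxs.le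
      have hx1 : (x : ℝ) ≤ n / K := by
        rw [le_div_iff₀ hK0]
        refine le_trans ?_ hxR
        gcongr
        exact le_self_pow₀ hKR two_ne_zero
      calc _ ≤ ∑ m ∈ Finset.Icc 1 x, L := by
            refine (norm_sum_le _ _).trans (Finset.sum_le_sum fun m hm => ?_)
            rw [norm_mul, norm_expChar, mul_one, Complex.norm_real,
              Real.norm_of_nonneg vonMangoldt_nonneg]
            exact vonMangoldt_le_log.trans (hlog m ((Finset.mem_Icc.mp hm).2.trans hx))
        _ = x * L := by rw [Finset.sum_const, Nat.card_Icc, nsmul_eq_mul]; simp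
        _ ≤ n / K * L ^ 3 := by gcongr
        _ ≤ _ := by
          have : 0 ≤ (n : ℝ) / K * L ^ 3 := by positivity
          linarith
    · have hxs := not_lt.mp hxs
      have hK2 : 0 < K ^ 2 := by positivity
      have hqx : q ≤ x := Nat.le_of_mul_le_mul_right (hqn.trans hxs) hK2
      have hKx : (K ^ 2) ^ 2 ≤ x :=
        Nat.le_of_mul_le_mul_right (by rw [← pow_mul, ← pow_add]; exact hKn.trans hxs) hK2
      have hxR : (x : ℝ) ≤ n := by exact_mod_cast hx
      by_cases hx3 : 3 ≤ x
      · refine (norm_sum_vonMangoldt_expChar_le hα hx3 hqx hK2 hKx).trans ?_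
        have h1 : √((x : ℝ) * (x / q + x / (K ^ 2 : ℕ) + q)) ≤ 2 * ((n : ℝ) / K) := by
          rw [Real.sqrt_le_left (by positivity)]
          push_cast
          calc (x : ℝ) * (x / q + x / K ^ 2 + q) ≤
                (n : ℝ) * ((n : ℝ) / K ^ 2 + (n : ℝ) / K ^ 2 + (n : ℝ) / K ^ 2) := by
                gcongr
                rw [le_div_iff₀ (by positivity)]; exact hqnR
            _ = 3 * ((n : ℝ) / K) ^ 2 := by ring
            _ ≤ (2 * ((n : ℝ) / K)) ^ 2 := by
              rw [mul_pow]
              have : 0 ≤ ((n : ℝ) / K) ^ 2 := by positivity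
              linarith
        have h2 : (((K ^ 2 : ℕ) : ℝ)) ^ 2 ≤ (n : ℝ) / K := by
          rw [le_div_iff₀ hK0]
          push_cast
          calc ((K : ℝ) ^ 2) ^ 2 * K = (K : ℝ) ^ 5 := by ring
            _ ≤ (K : ℝ) ^ 6 := pow_le_pow_right₀ hKR (by norm_num)
            _ ≤ n := hKnR
        have h3 := hlog x hx
        have h4 : 0 ≤ Real.log x := Real.log_natCast_nonneg x
        calc _ ≤ 4400 * L ^ 3 * (2 * ((n : ℝ) / K) + (n : ℝ) / K) := by gcongr
          _ ≤ _ := by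
            have : 0 ≤ (n : ℝ) / K * L ^ 3 := by positivity
            linarith
      · have h1 : K ^ 2 ≤ 2 := hKq.trans (hqx.trans (by omega))
        have hK1 : K = 1 := by
          by_contra h
          have : 2 ≤ K := by omega
          nlinarith
        subst hK1
        omega
  have z0 : (primeWeight 0 : ℂ) * expChar (α * (0 : ℕ)) = 0 := by simp [primeWeight_zero]
  have z1 : (primeWeight 1 : ℂ) * expChar (α * (1 : ℕ)) = 0 := by simp [primeWeight_one]
  rw [sum_range_eq_sum_Ico_two z0 z1 (by omega)]
  have hab := norm_sum_mul_le_of_antitone (f := fun m => (Λ m : ℂ) * expChar (α * m))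
    (w := invLog) (by omega : 2 ≤ n + 1) (fun m hm _ => invLog_anti hm (Nat.le_succ m))
    (invLog_nonneg _) (M := 15000 * L ^ 3 * (n / K)) (fun s hs hst => by
      have e2 : Finset.Icc 1 (s - 1) = Finset.Ico 1 s := by
        ext m; simp only [Finset.mem_Icc, Finset.mem_Ico]; omega
      have e3 := hpart (s - 1) (by omega)
      rw [e2, Finset.sum_eq_sum_Ico_succ_bot (by omega : 1 < s), vonMangoldt_apply_one] at e3
      simpa using e3)
  calc _ = ‖∑ m ∈ Finset.Ico 2 (n + 1), (Λ m : ℂ) * expChar (α * m) * (invLog m : ℂ)‖ := by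
        congr 1
        refine Finset.sum_congr rfl fun m _ => ?_
        rw [primeWeight]; push_cast; ring
    _ ≤ _ := hab
    _ ≤ 15000 * L ^ 3 * (n / K) * 2 := by gcongr; exact invLog_le_two 2
    _ = _ := by ring

/-- The exponential sum of the density `1 / log m`. -/
noncomputable def densitySum (n : ℕ) (γ : ℝ) : ℂ :=
  ∑ m ∈ Finset.range (n + 1), (invLog m : ℂ) * expChar (γ * m)

lemma norm_densitySum_mul_distInt_le {n : ℕ} (hn : 1 ≤ n) (γ : ℝ) :
    ‖densitySum n γ‖ * distInt γ ≤ 1 := by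
  rw [densitySum, sum_range_eq_sum_Ico_two (by simp [invLog_zero]) (by simp [invLog_one])
    (by omega)]
  rcases (distInt_nonneg γ).eq_or_lt with h0 | h0
  · rw [← h0, mul_zero]; exact zero_le_one
  have hab := norm_sum_mul_le_of_antitone (f := fun m => expChar (γ * m))
    (w := invLog) (by omega : 2 ≤ n + 1) (fun m hm _ => invLog_anti hm (Nat.le_succ m))
    (invLog_nonneg _) (M := 1 / 2 / distInt γ) (fun s hs hst => by
      rw [le_div_iff₀ h0]; exact norm_sum_expChar_mul_distInt_le _ _ _)
  simp_rw [mul_comm (expChar _)] at hab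
  calc _ ≤ 1 / 2 / distInt γ * invLog 2 * distInt γ := by gcongr
    _ ≤ 1 / 2 / distInt γ * 2 * distInt γ := by gcongr; exact invLog_le_two 2
    _ = 1 := by field_simp

lemma inv_le_distInt_sub {α : ℝ} {a b q r : ℕ} (hq : 0 < q) (hr : 0 < r)
    (h : |α - a / q| ≤ 1 / (2 * q * r)) (hne : ∀ z : ℤ, (a : ℝ) / q - b / r ≠ z) :
    1 / (2 * (q : ℝ) * r) ≤ distInt (α - b / r) := by
  have hqR : (0 : ℝ) < q := by exact_mod_cast hq
  have hrR : (0 : ℝ) < r := by exact_mod_cast hr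
  set z := round (α - (b : ℝ) / r) with hz
  have h1 : 1 / ((q : ℝ) * r) ≤ |(a : ℝ) / q - b / r - z| := by
    have e1 : (a : ℝ) / q - b / r - z = ((a * r - b * q - z * (q * r) : ℤ) : ℝ) / (q * r) := by
      push_cast; field_simp
    have hi : (a * r - b * q - z * (q * r) : ℤ) ≠ 0 := by
      intro h0
      rw [h0, Int.cast_zero, zero_div, sub_eq_zero] at e1
      exact hne z e1
    rw [e1, abs_div, abs_of_pos (by positivity : (0 : ℝ) < q * r)]
    gcongr
    exact_mod_cast Int.one_le_abs hi
  have h2 : |(a : ℝ) / q - b / r - z| ≤ |α - a / q| + |α - b / r - z| := by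
    rw [abs_sub_comm α]
    refine le_trans (le_of_eq ?_) (abs_add_le _ _)
    congr 1; ring
  rw [distInt]
  have h3 : 1 / ((q : ℝ) * r) = 1 / (2 * q * r) + 1 / (2 * q * r) := by field_simp; ring
  linarith

lemma eq_of_div_sub_div_eq_int {a b q r : ℕ} (ha : a ∈ redRes q) (hb : b ∈ redRes r)
    (hq : 0 < q) (hr : 0 < r) {z : ℤ} (h : (a : ℝ) / q - b / r = z) : q = r ∧ a = b := by
  have hqR : (0 : ℝ) < q := by exact_mod_cast hq
  have hrR : (0 : ℝ) < r := by exact_mod_cast hr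
  rw [mem_redRes] at ha hb
  have ha1 : (a : ℝ) / q < 1 := by rw [div_lt_one hqR]; exact_mod_cast ha.1
  have hb1 : (b : ℝ) / r < 1 := by rw [div_lt_one hrR]; exact_mod_cast hb.1
  have ha0 : 0 ≤ (a : ℝ) / q := by positivity
  have hb0 : 0 ≤ (b : ℝ) / r := by positivity
  have hz : z = 0 := by
    have h1 : (z : ℝ) < 1 := by linarith
    have h2 : (-1 : ℝ) < z := by linarith
    have h1' : z < 1 := by exact_mod_cast h1
    have h2' : -1 < z := by exact_mod_cast h2
    omega
  rw [hz, Int.cast_zero, sub_eq_zero, div_eq_div_iff hqR.ne' hrR.ne'] at h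
  have h' : a * r = b * q := by exact_mod_cast h
  have h1 : q ∣ r := ha.2.dvd_of_dvd_mul_left (h' ▸ Dvd.intro_left b rfl)
  have h2 : r ∣ q := hb.2.dvd_of_dvd_mul_left (h' ▸ Dvd.intro_left a rfl)
  have h3 := Nat.dvd_antisymm h1 h2
  subst h3
  exact ⟨rfl, Nat.eq_of_mul_eq_mul_right hq h'⟩

/-- The truncated Ramanujan expansion modelling the weighted primes. -/
noncomputable def modelWeight (Q m : ℕ) : ℂ :=
  ∑ q ∈ Finset.Icc 1 Q, ∑ b ∈ redRes q,
    ((μ q : ℝ) / q.totient : ℝ) * ((invLog m : ℂ) * expChar (-((b : ℝ) / q) * m))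

lemma sum_modelWeight_expChar (Q n : ℕ) (α : ℝ) :
    ∑ m ∈ Finset.range (n + 1), modelWeight Q m * expChar (α * m) =
      ∑ q ∈ Finset.Icc 1 Q, ∑ b ∈ redRes q,
        (((μ q : ℝ) / q.totient : ℝ) : ℂ) * densitySum n (α - b / q) := by
  simp only [modelWeight, Finset.sum_mul]
  rw [Finset.sum_comm]
  refine Finset.sum_congr rfl fun q _ => ?_
  rw [Finset.sum_comm]
  refine Finset.sum_congr rfl fun b _ => ?_
  rw [densitySum, Finset.mul_sum]
  refine Finset.sum_congr rfl fun m _ => ?_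
  rw [show (α - (b : ℝ) / q) * m = -((b : ℝ) / q) * m + α * m by ring, expChar_add]
  ring

lemma norm_sum_modelWeight_sub_le {Q n a q : ℕ} {α : ℝ} (hn : 1 ≤ n) (hq : 0 < q)
    (ha : a ∈ redRes q) (h : |α - a / q| ≤ 1 / (2 * q * Q)) :
    ‖∑ m ∈ Finset.range (n + 1), modelWeight Q m * expChar (α * m) -
      if q ≤ Q then (((μ q : ℝ) / q.totient : ℝ) : ℂ) * densitySum n (α - a / q) else 0‖ ≤
      2 * q * Q ^ 2 := by
  have hqR : (0 : ℝ) < q := by exact_mod_cast hq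
  set D : ℕ → ℕ → ℂ := fun r b => (((μ r : ℝ) / r.totient : ℝ) : ℂ) * densitySum n (α - b / r)
    with hD
  have hdiag : (if q ≤ Q then (((μ q : ℝ) / q.totient : ℝ) : ℂ) * densitySum n (α - a / q)
      else 0) = ∑ r ∈ Finset.Icc 1 Q, ∑ b ∈ redRes r, if r = q ∧ b = a then D r b else 0 := by
    have e1 : ∀ r ∈ Finset.Icc 1 Q, (∑ b ∈ redRes r, if r = q ∧ b = a then D r b else 0) =
        if r = q then D q a else 0 := by
      intro r _
      split_ifs with hr
      · subst hr
        simp [ha]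
      · simp [hr]
    rw [Finset.sum_congr rfl e1, Finset.sum_ite_eq']
    simp only [Finset.mem_Icc, hD]
    congr 1
    simp only [eq_iff_iff]
    exact ⟨fun h => ⟨hq, h⟩, fun h => h.2⟩
  rw [sum_modelWeight_expChar, hdiag, ← Finset.sum_sub_distrib]
  have hterm : ∀ r ∈ Finset.Icc 1 Q, ‖(∑ b ∈ redRes r,
      (((μ r : ℝ) / r.totient : ℝ) : ℂ) * densitySum n (α - b / r)) -
      ∑ b ∈ redRes r, (if r = q ∧ b = a then D r b else 0)‖ ≤ 2 * q * Q := by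
    intro r hr
    rw [Finset.mem_Icc] at hr
    have hr0 : 0 < r := hr.1
    have hrR : (0 : ℝ) < r := by exact_mod_cast hr0
    have hrQ : (r : ℝ) ≤ Q := by exact_mod_cast hr.2
    have hφ : (0 : ℝ) < r.totient := by exact_mod_cast Nat.totient_pos.mpr hr0
    rw [← Finset.sum_sub_distrib]
    calc _ ≤ ∑ b ∈ redRes r, 1 / (r.totient : ℝ) * (2 * q * Q) := by
          refine (norm_sum_le _ _).trans (Finset.sum_le_sum fun b hb => ?_)
          split_ifs with hc
          · rw [sub_self, norm_zero]; positivity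
          · rw [sub_zero, norm_mul, Complex.norm_real, Real.norm_eq_abs, abs_div, Nat.abs_cast]
            have hμ : |(μ r : ℝ)| ≤ 1 := by exact_mod_cast abs_moebius_le_one
            have hd : 1 / (2 * (q : ℝ) * r) ≤ distInt (α - b / r) := by
              refine inv_le_distInt_sub hq hr0 (h.trans (by gcongr)) fun z hz => hc ?_
              have := eq_of_div_sub_div_eq_int ha hb hq hr0 hz
              exact ⟨this.1.symm, this.2.symm⟩
            have hs := norm_densitySum_mul_distInt_le hn (α - b / r)
            have hs2 : ‖densitySum n (α - b / r)‖ ≤ 2 * q * r := by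
              have := (mul_le_mul_of_nonneg_left hd (norm_nonneg _)).trans hs
              rwa [mul_one_div, div_le_one (by positivity)] at this
            gcongr
            exact hs2.trans (by gcongr)
      _ = _ := by
          rw [Finset.sum_const, card_redRes, nsmul_eq_mul]
          field_simp
  refine (norm_sum_le _ _).trans ((Finset.sum_le_sum hterm).trans (le_of_eq ?_))
  rw [Finset.sum_const, Nat.card_Icc, nsmul_eq_mul]
  simp only [Nat.add_sub_cancel]
  ring

end Model

section ModelApproximation

open ArithmeticFunction hiding log
open ArithmeticFunction.Moebius

lemma exists_redRes_abs_sub_le (α : ℝ) {n P : ℕ} (hP : 0 < P) (hPn : P ≤ n) :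
    ∃ (z : ℤ) (q a : ℕ), 0 < q ∧ q * P ≤ n ∧ a ∈ redRes q ∧
      |α - z - a / q| ≤ P / (n * q) := by
  have hB : 0 < n / P := Nat.div_pos hPn hP
  obtain ⟨r, hr, hden⟩ := Real.exists_rat_abs_sub_le_and_den_le α hB
  have hq : 0 < r.den := r.den_pos
  have hqR : (0 : ℝ) < r.den := by exact_mod_cast hq
  have hn : (0 : ℝ) < n := by exact_mod_cast hP.trans_le hPn
  have hPR : (0 : ℝ) < P := by exact_mod_cast hP
  set a : ℕ := (r.num % r.den).toNat with ha
  have hqz : (r.den : ℤ) ≠ 0 := by exact_mod_cast hq.ne'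
  have haz : (a : ℤ) = r.num % r.den := Int.toNat_of_nonneg (Int.emod_nonneg _ hqz)
  have hra : (a : ℤ) + r.den * (r.num / r.den) = r.num := by
    rw [haz]; exact Int.emod_add_mul_ediv _ _
  refine ⟨r.num / r.den, r.den, a, hq, ?_, ?_, ?_⟩
  · exact (Nat.mul_le_mul_right P hden).trans (Nat.div_mul_le_self n P)
  · rw [mem_redRes]
    constructor
    · have := Int.emod_lt_of_pos r.num (by exact_mod_cast hq : (0 : ℤ) < r.den)
      omega
    · have h1 : IsCoprime r.num (r.den : ℤ) := by
        rw [Int.isCoprime_iff_gcd_eq_one]; exact r.reduced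
      rw [← hra] at h1
      have h2 := (IsCoprime.add_mul_left_left_iff.mp h1).symm
      exact Nat.isCoprime_iff_coprime.mp h2
  · have hr1 : (r : ℝ) = ((r.num / r.den : ℤ) : ℝ) + (a : ℝ) / r.den := by
      have h1 : (r : ℝ) = (r.num : ℝ) / r.den := by exact_mod_cast (Rat.num_div_den r).symm
      rw [h1, ← hra]
      rw [show (a : ℤ) + r.den * (r.num / r.den) = r.num from hra]
      have h2 : (r.num : ℝ) = a + r.den * ((r.num / r.den : ℤ) : ℝ) := by exact_mod_cast hra.symm
      rw [h2]
      field_simp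
      ring
    rw [sub_sub, ← hr1]
    refine hr.trans ?_
    have h3 : (n : ℝ) / P ≤ ((n / P : ℕ) : ℝ) + 1 := (Nat.lt_floor_add_one ((n : ℝ) / P)).le.trans
      (by rw [Nat.floor_div_eq_div])
    rw [div_le_div_iff₀ (by positivity) (by positivity)]
    have h4 : (n : ℝ) ≤ P * (((n / P : ℕ) : ℝ) + 1) := by
      rw [div_le_iff₀ hPR] at h3; linarith
    nlinarith

/-- Truncation level of the Ramanujan expansion. -/
noncomputable def modelLevel (n : ℕ) : ℕ := ⌊Real.log n⌋₊ ^ 14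

theorem exists_sup_primeWeight_sub_modelWeight_le : ∃ C : ℝ, 0 < C ∧ ∀ n : ℕ, 3 ≤ n →
    2 * Real.log n ^ 56 ≤ n → ∀ α : ℝ,
    ‖∑ m ∈ Finset.range (n + 1), ((primeWeight m : ℂ) - modelWeight (modelLevel n) m) *
      expChar (α * m)‖ ≤ C * (n / Real.log n ^ 4) := by
  obtain ⟨C, hC, hdev⟩ := exists_sum_primeDeviation_mul_expChar_le 74
  refine ⟨2 ^ 22 + 2 * C, by positivity, fun n hn hbig α => ?_⟩
  have hL := one_le_log_natCast hn
  set L := Real.log n with hLd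
  set l : ℕ := ⌊L⌋₊ with hl
  have hl1 : 1 ≤ l := Nat.le_floor (by exact_mod_cast hL)
  have hlR : (1 : ℝ) ≤ l := by exact_mod_cast hl1
  have hlL : (l : ℝ) ≤ L := Nat.floor_le (by linarith)
  have hLl : L ≤ 2 * l := by
    have := (Nat.lt_floor_add_one L).le
    linarith
  have hL0 : 0 < L := by linarith
  have hn0 : (0 : ℝ) < n := by exact_mod_cast (by omega : 0 < n)
  have hbl : 2 * l ^ 56 ≤ n := by
    have : 2 * (l : ℝ) ^ 56 ≤ n := le_trans (by gcongr) hbig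
    exact_mod_cast this
  have hpow : ∀ i j : ℕ, i ≤ j → l ^ i ≤ l ^ j := fun i j h => Nat.pow_le_pow_right hl1 h
  have h42 : l ^ 42 ≤ n := (hpow 42 56 (by norm_num)).trans (by omega)
  obtain ⟨z, q, a, hq, hqP, ha, hβ⟩ := exists_redRes_abs_sub_le α (P := l ^ 42) (by positivity) h42
  have hqR : (0 : ℝ) < q := by exact_mod_cast hq
  have hshift : ∀ m : ℕ, expChar (α * m) = expChar ((α - z) * m) := fun m => by
    rw [show α * m = (α - z) * m + ((z * m : ℤ) : ℝ) by push_cast; ring, expChar_add_intCast]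
  simp only [hshift]
  generalize α - z = γ at hβ ⊢
  have hQ : modelLevel n = l ^ 14 := rfl
  rw [hQ]
  have hqPR : (q : ℝ) * l ^ 42 ≤ n := by exact_mod_cast hqP
  have hblR : 2 * (l : ℝ) ^ 56 ≤ n := by exact_mod_cast hbl
  have hβ' : |γ - a / q| ≤ l ^ 42 / (n * q) := by exact_mod_cast hβ
  have hoff := norm_sum_modelWeight_sub_le (Q := l ^ 14) (n := n) (α := γ) (by omega) hq ha
    (hβ'.trans (by
      rw [div_le_div_iff₀ (by positivity) (by positivity)]
      push_cast
      calc (l : ℝ) ^ 42 * (2 * q * l ^ 14) = 2 * (l : ℝ) ^ 56 * q := by ring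
        _ ≤ (n : ℝ) * q := by gcongr
        _ = _ := by ring))
  have hLpow : ∀ k : ℕ, L ^ k ≤ 2 ^ k * (l : ℝ) ^ k := fun k => by
    rw [← mul_pow]; exact pow_le_pow_left₀ hL0.le hLl k
  have hoff2 : 2 * (q : ℝ) * ((l ^ 14 : ℕ) : ℝ) ^ 2 ≤ 2 ^ 15 * (n / L ^ 4) := by
    rw [mul_div_assoc', le_div_iff₀ (by positivity)]
    push_cast
    calc 2 * (q : ℝ) * ((l : ℝ) ^ 14) ^ 2 * L ^ 4 ≤ 2 * (q : ℝ) * ((l : ℝ) ^ 14) ^ 2 * L ^ 14 := by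
          gcongr 2 * (q : ℝ) * ((l : ℝ) ^ 14) ^ 2 * ?_
          exact pow_le_pow_right₀ hL (by norm_num)
      _ ≤ 2 * (q : ℝ) * ((l : ℝ) ^ 14) ^ 2 * (2 ^ 14 * (l : ℝ) ^ 14) := by gcongr; exact hLpow 14
      _ = 2 ^ 15 * (q * (l : ℝ) ^ 42) := by ring
      _ ≤ _ := by gcongr
  set S := ∑ m ∈ Finset.range (n + 1), modelWeight (l ^ 14) m * expChar (γ * m) with hS
  have hsplit : ∑ m ∈ Finset.range (n + 1), ((primeWeight m : ℂ) - modelWeight (l ^ 14) m) *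
      expChar (γ * m) = ∑ m ∈ Finset.range (n + 1), (primeWeight m : ℂ) * expChar (γ * m) - S := by
    rw [hS, ← Finset.sum_sub_distrib]
    exact Finset.sum_congr rfl fun m _ => by ring
  rw [hsplit]
  have hpos : 0 ≤ (n : ℝ) / L ^ 4 := by positivity
  by_cases hqQ : q ≤ l ^ 14
  · rw [if_pos hqQ] at hoff
    have hmaj : ∑ m ∈ Finset.range (n + 1), (primeWeight m : ℂ) * expChar (γ * m) -
        (((μ q : ℝ) / q.totient : ℝ) : ℂ) * densitySum n (γ - a / q) =
        ∑ m ∈ Finset.range (n + 1), primeDeviation q a m * expChar ((γ - a / q) * m) := by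
      rw [densitySum, Finset.mul_sum, ← Finset.sum_sub_distrib]
      refine Finset.sum_congr rfl fun m _ => ?_
      rw [primeDeviation, show γ * m = (a : ℝ) / q * m + (γ - a / q) * m by ring, expChar_add]
      ring
    have h1 := hdev n q a (γ - a / q) hn hq (mem_redRes.mp ha).2
    rw [← hmaj] at h1
    have h2 : C * (q : ℝ) ^ 2 * (n / L ^ 74) * (1 + |γ - a / q| * n) ≤ 2 * C * (n / L ^ 4) := by
      have e1 : |γ - a / q| * n ≤ l ^ 42 := by
        have : |γ - a / q| * n ≤ (l : ℝ) ^ 42 / (n * q) * n := by gcongr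
        refine this.trans ?_
        rw [div_mul_eq_mul_div, div_le_iff₀ (by positivity)]
        have hq1 : (1 : ℝ) ≤ q := by exact_mod_cast hq
        gcongr
        exact le_mul_of_one_le_right hn0.le hq1
      have e2 : (1 : ℝ) ≤ (l : ℝ) ^ 42 := one_le_pow₀ hlR
      have e3 : (q : ℝ) ≤ L ^ 14 := by
        refine le_trans (by exact_mod_cast hqQ : (q : ℝ) ≤ (l : ℝ) ^ 14) (by gcongr)
      have e4 : (l : ℝ) ^ 42 ≤ L ^ 42 := by gcongr
      calc _ ≤ C * (L ^ 14) ^ 2 * (n / L ^ 74) * (2 * L ^ 42) := by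
            gcongr; linarith
        _ = _ := by field_simp
    calc _ = ‖(∑ m ∈ Finset.range (n + 1), (primeWeight m : ℂ) * expChar (γ * m) -
          (((μ q : ℝ) / q.totient : ℝ) : ℂ) * densitySum n (γ - a / q)) -
          (S - (((μ q : ℝ) / q.totient : ℝ) : ℂ) * densitySum n (γ - a / q))‖ := by
          congr 1; ring
      _ ≤ 2 * C * (n / L ^ 4) + 2 ^ 15 * (n / L ^ 4) :=
          (norm_sub_le _ _).trans (add_le_add (h1.trans h2) (hoff.trans hoff2))
      _ ≤ _ := by nlinarith
  · rw [if_neg hqQ, sub_zero] at hoff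
    have hα : IsDirichletApprox γ a q := by
      refine ⟨hq, ?_, hβ'.trans ?_⟩
      · exact Nat.isCoprime_iff_coprime.mpr (mem_redRes.mp ha).2.symm
      · rw [div_le_div_iff₀ (by positivity) (by positivity)]
        calc (l : ℝ) ^ 42 * q ^ 2 = (q * (l : ℝ) ^ 42) * q := by ring
          _ ≤ (n : ℝ) * q := by gcongr
          _ = _ := by ring
    have hmin := norm_sum_primeWeight_expChar_le (K := l ^ 7) hα hn (by positivity)
      (by rw [← pow_mul]; exact (not_le.mp hqQ).le)
      (by rw [← pow_mul]; exact (Nat.mul_le_mul_left q (hpow _ 42 (by norm_num))).trans hqP)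
      (by rw [← pow_mul]; exact h42)
    have h2 : 30000 * L ^ 3 * (n / ((l ^ 7 : ℕ) : ℝ)) ≤ 30000 * 2 ^ 7 * (n / L ^ 4) := by
      push_cast
      rw [mul_div_assoc', mul_div_assoc', div_le_div_iff₀ (by positivity) (by positivity)]
      calc 30000 * L ^ 3 * n * L ^ 4 = 30000 * n * L ^ 7 := by ring
        _ ≤ 30000 * n * (2 ^ 7 * (l : ℝ) ^ 7) := by gcongr; exact hLpow 7
        _ = _ := by ring
    calc _ ≤ 30000 * 2 ^ 7 * (n / L ^ 4) + 2 ^ 15 * (n / L ^ 4) :=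
          (norm_sub_le _ _).trans (add_le_add (hmin.trans h2) (hoff.trans hoff2))
      _ ≤ _ := by nlinarith

end ModelApproximation

section TernaryConvolution

lemma sum_range_expChar_int {M : ℕ} (hM : 0 < M) (j : ℤ) :
    ∑ k ∈ Finset.range M, expChar ((k : ℝ) / M * j) = if (M : ℤ) ∣ j then (M : ℂ) else 0 := by
  have hMR : (M : ℝ) ≠ 0 := by exact_mod_cast hM.ne'
  have hz : (M : ℤ) ≠ 0 := by exact_mod_cast hM.ne'
  set r : ℕ := (j % M).toNat with hr
  have hrz : (r : ℤ) = j % M := Int.toNat_of_nonneg (Int.emod_nonneg _ hz)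
  have hj : (j : ℝ) = r + M * ((j / M : ℤ) : ℝ) := by
    have h : j = r + M * (j / M) := by rw [hrz]; exact (Int.emod_add_mul_ediv _ _).symm
    exact_mod_cast h
  have h1 : ∀ k ∈ Finset.range M, expChar ((k : ℝ) / M * j) = expChar ((k : ℝ) / M * r) := by
    intro k _
    rw [← expChar_add_intCast ((k : ℝ) / M * r) (k * (j / M))]
    congr 1
    rw [hj]
    push_cast
    field_simp
  rw [Finset.sum_congr rfl h1, sum_range_expChar hM]
  congr 1
  rw [eq_iff_iff, ← Int.natCast_dvd_natCast, hrz, Int.dvd_iff_emod_eq_zero,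
    Int.dvd_iff_emod_eq_zero, Int.emod_emod]

/-- The `n`-th coefficient of the triple additive convolution. -/
def tri (n : ℕ) (x y z : ℕ → ℂ) : ℂ :=
  ∑ a ∈ Finset.range (n + 1), ∑ b ∈ Finset.range (n + 1), ∑ c ∈ Finset.range (n + 1),
    if a + b + c = n then x a * y b * z c else 0

/-- Exponential sum attached to the weight `x` on `[0, n]`. -/
noncomputable def expSum (n : ℕ) (x : ℕ → ℂ) (θ : ℝ) : ℂ :=
  ∑ m ∈ Finset.range (n + 1), x m * expChar (θ * m)

lemma sum_expSum_mul_expChar (n : ℕ) (x y z : ℕ → ℂ) :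
    ∑ k ∈ Finset.range (2 * n + 1), expSum n x ((k : ℝ) / (2 * n + 1 : ℕ)) *
      expSum n y ((k : ℝ) / (2 * n + 1 : ℕ)) * expSum n z ((k : ℝ) / (2 * n + 1 : ℕ)) *
      expChar ((k : ℝ) / (2 * n + 1 : ℕ) * (-(n : ℤ) : ℤ)) = (2 * n + 1 : ℕ) * tri n x y z := by
  have h1 : ∀ k ∈ Finset.range (2 * n + 1), expSum n x ((k : ℝ) / (2 * n + 1 : ℕ)) *
      expSum n y ((k : ℝ) / (2 * n + 1 : ℕ)) * expSum n z ((k : ℝ) / (2 * n + 1 : ℕ)) *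
      expChar ((k : ℝ) / (2 * n + 1 : ℕ) * (-(n : ℤ) : ℤ)) =
      ∑ a ∈ Finset.range (n + 1), ∑ b ∈ Finset.range (n + 1), ∑ c ∈ Finset.range (n + 1),
        x a * y b * z c * expChar ((k : ℝ) / (2 * n + 1 : ℕ) * ((a + b + c - n : ℤ) : ℝ)) := by
    intro k _
    rw [expSum, expSum, expSum, Finset.sum_mul_sum, Finset.sum_mul, Finset.sum_mul]
    refine Finset.sum_congr rfl fun a _ => ?_
    rw [Finset.sum_mul_sum, Finset.sum_mul]
    refine Finset.sum_congr rfl fun b _ => ?_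
    rw [Finset.sum_mul]
    refine Finset.sum_congr rfl fun c _ => ?_
    generalize (k : ℝ) / (2 * n + 1 : ℕ) = θ
    rw [show θ * ((a + b + c - n : ℤ) : ℝ) = θ * a + θ * b + θ * c + θ * (-(n : ℤ) : ℤ) by
      push_cast; ring, expChar_add, expChar_add, expChar_add]
    ring
  rw [Finset.sum_congr rfl h1, Finset.sum_comm, tri, Finset.mul_sum]
  refine Finset.sum_congr rfl fun a ha => ?_
  rw [Finset.sum_comm, Finset.mul_sum]
  refine Finset.sum_congr rfl fun b hb => ?_
  rw [Finset.sum_comm, Finset.mul_sum]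
  refine Finset.sum_congr rfl fun c hc => ?_
  rw [Finset.mem_range] at ha hb hc
  rw [← Finset.mul_sum, sum_range_expChar_int (by omega)]
  have : ((2 * n + 1 : ℕ) : ℤ) ∣ (a + b + c - n : ℤ) ↔ a + b + c = n := by
    constructor
    · rintro ⟨t, ht⟩
      have h2 : t = 0 := by
        push_cast at ht
        by_contra h0
        rcases lt_or_gt_of_ne h0 with h | h
        · nlinarith
        · nlinarith
      rw [h2] at ht
      omega
    · intro h
      rw [show (a + b + c - n : ℤ) = 0 by omega]
      exact dvd_zero _
  simp only [this]
  split_ifs <;> ring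

lemma sum_norm_expSum_sq (n : ℕ) (x : ℕ → ℂ) :
    ∑ k ∈ Finset.range (2 * n + 1), ‖expSum n x ((k : ℝ) / (2 * n + 1 : ℕ))‖ ^ 2 =
      (2 * n + 1 : ℕ) * ∑ m ∈ Finset.range (n + 1), ‖x m‖ ^ 2 := by
  have h1 : ∀ k ∈ Finset.range (2 * n + 1),
      ((‖expSum n x ((k : ℝ) / (2 * n + 1 : ℕ))‖ ^ 2 : ℝ) : ℂ) =
      ∑ a ∈ Finset.range (n + 1), ∑ b ∈ Finset.range (n + 1),
        x a * (starRingEnd ℂ) (x b) *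
          expChar ((k : ℝ) / (2 * n + 1 : ℕ) * ((a - b : ℤ) : ℝ)) := by
    intro k _
    push_cast
    rw [← Complex.mul_conj', expSum, map_sum, Finset.sum_mul_sum]
    refine Finset.sum_congr rfl fun a _ => Finset.sum_congr rfl fun b _ => ?_
    rw [map_mul, conj_expChar]
    rw [mul_sub, sub_eq_add_neg, expChar_add]
    ring
  have h2 : ((∑ k ∈ Finset.range (2 * n + 1),
      ‖expSum n x ((k : ℝ) / (2 * n + 1 : ℕ))‖ ^ 2 : ℝ) : ℂ) =
      (((2 * n + 1 : ℕ) * ∑ m ∈ Finset.range (n + 1), ‖x m‖ ^ 2 : ℝ) : ℂ) := by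
    rw [Complex.ofReal_sum, Finset.sum_congr rfl h1, Finset.sum_comm, Complex.ofReal_mul,
      Complex.ofReal_sum, Finset.mul_sum]
    refine Finset.sum_congr rfl fun a ha => ?_
    rw [Finset.sum_comm]
    have h3 : ∀ b ∈ Finset.range (n + 1), ∑ k ∈ Finset.range (2 * n + 1),
        x a * (starRingEnd ℂ) (x b) *
          expChar ((k : ℝ) / (2 * n + 1 : ℕ) * ((a - b : ℤ) : ℝ)) =
        if a = b then (2 * n + 1 : ℕ) * (x a * (starRingEnd ℂ) (x b)) else 0 := by
      intro b hb
      rw [Finset.mem_range] at ha hb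
      rw [← Finset.mul_sum, sum_range_expChar_int (by omega)]
      have : ((2 * n + 1 : ℕ) : ℤ) ∣ (a - b : ℤ) ↔ a = b := by
        constructor
        · rintro ⟨t, ht⟩
          have h2 : t = 0 := by
            push_cast at ht
            by_contra h0
            rcases lt_or_gt_of_ne h0 with h | h
            · nlinarith
            · nlinarith
          rw [h2] at ht
          omega
        · rintro rfl
          simp
      simp only [this]
      split_ifs <;> ring
    rw [Finset.sum_congr rfl h3, Finset.sum_ite_eq, if_pos ha, Complex.mul_conj']
    push_cast
    ring
  exact_mod_cast h2

lemma norm_tri_le_of_expSum {n : ℕ} {h f : ℕ → ℂ} {B : ℝ} (hB : ∀ θ, ‖expSum n h θ‖ ≤ B) :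
    ‖tri n h f f‖ ≤ B * ∑ m ∈ Finset.range (n + 1), ‖f m‖ ^ 2 := by
  have hM : (0 : ℝ) < (2 * n + 1 : ℕ) := by positivity
  refine le_of_mul_le_mul_left ?_ hM
  calc ((2 * n + 1 : ℕ) : ℝ) * ‖tri n h f f‖ = ‖((2 * n + 1 : ℕ) : ℂ) * tri n h f f‖ := by
        rw [norm_mul, Complex.norm_natCast]
    _ ≤ ∑ k ∈ Finset.range (2 * n + 1), B * ‖expSum n f ((k : ℝ) / (2 * n + 1 : ℕ))‖ ^ 2 := by
        rw [← sum_expSum_mul_expChar]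
        refine (norm_sum_le _ _).trans (Finset.sum_le_sum fun k _ => ?_)
        rw [norm_mul, norm_expChar, mul_one, norm_mul, norm_mul, mul_assoc, ← sq]
        gcongr
        exact hB _
    _ = _ := by
        rw [← Finset.mul_sum, sum_norm_expSum_sq]; ring

lemma tri_eq (n : ℕ) (x y z : ℕ → ℂ) : tri n x y z =
    ∑ c ∈ Finset.range (n + 1), z c * ∑ a ∈ Finset.range (n - c + 1), x a * y (n - c - a) := by
  rw [tri]
  have h1 : ∀ a ∈ Finset.range (n + 1), ∑ b ∈ Finset.range (n + 1), ∑ c ∈ Finset.range (n + 1),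
      (if a + b + c = n then x a * y b * z c else 0) = ∑ c ∈ Finset.range (n + 1),
      if a + c ≤ n then z c * (x a * y (n - c - a)) else 0 := by
    intro a _
    rw [Finset.sum_comm]
    refine Finset.sum_congr rfl fun c _ => ?_
    split_ifs with h
    · have h2 : ∀ b ∈ Finset.range (n + 1), (if a + b + c = n then x a * y b * z c else 0) =
          if b = n - c - a then z c * (x a * y b) else 0 := by
        intro b _
        refine if_congr (by omega) (by ring) rfl
      rw [Finset.sum_congr rfl h2, Finset.sum_ite_eq', if_pos (Finset.mem_range.mpr (by omega))]
    · exact Finset.sum_eq_zero fun b _ => if_neg (by omega)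
  rw [Finset.sum_congr rfl h1, Finset.sum_comm]
  refine Finset.sum_congr rfl fun c hc => ?_
  rw [Finset.mem_range] at hc
  rw [← Finset.sum_filter, Finset.mul_sum]
  refine Finset.sum_congr ?_ fun _ _ => rfl
  ext a
  simp only [Finset.mem_filter, Finset.mem_range]
  omega

lemma tri_swap_left (n : ℕ) (x y z : ℕ → ℂ) : tri n x y z = tri n y x z := by
  rw [tri, Finset.sum_comm, tri]
  refine Finset.sum_congr rfl fun a _ => Finset.sum_congr rfl fun b _ =>
    Finset.sum_congr rfl fun c _ => if_congr (by omega) (by ring) rfl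

lemma tri_swap_right (n : ℕ) (x y z : ℕ → ℂ) : tri n x y z = tri n x z y := by
  rw [tri, tri]
  refine Finset.sum_congr rfl fun a _ => ?_
  rw [Finset.sum_comm]
  refine Finset.sum_congr rfl fun b _ =>
    Finset.sum_congr rfl fun c _ => if_congr (by omega) (by ring) rfl

lemma tri_add_left (n : ℕ) (x x' y z : ℕ → ℂ) :
    tri n (fun m => x m + x' m) y z = tri n x y z + tri n x' y z := by
  simp only [tri, ← Finset.sum_add_distrib]
  refine Finset.sum_congr rfl fun a _ => Finset.sum_congr rfl fun b _ =>
    Finset.sum_congr rfl fun c _ => ?_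
  split_ifs <;> ring

lemma tri_sub_left (n : ℕ) (x x' y z : ℕ → ℂ) :
    tri n (fun m => x m - x' m) y z = tri n x y z - tri n x' y z := by
  simp only [tri, ← Finset.sum_sub_distrib]
  refine Finset.sum_congr rfl fun a _ => Finset.sum_congr rfl fun b _ =>
    Finset.sum_congr rfl fun c _ => ?_
  split_ifs <;> ring

lemma tri_const_mul_left (n : ℕ) (k : ℂ) (x y z : ℕ → ℂ) :
    tri n (fun m => k * x m) y z = k * tri n x y z := by
  simp only [tri, Finset.mul_sum]
  refine Finset.sum_congr rfl fun a _ => Finset.sum_congr rfl fun b _ =>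
    Finset.sum_congr rfl fun c _ => ?_
  split_ifs <;> ring

lemma tri_sum_left {ι : Type*} (n : ℕ) (s : Finset ι) (x : ι → ℕ → ℂ) (y z : ℕ → ℂ) :
    tri n (fun m => ∑ i ∈ s, x i m) y z = ∑ i ∈ s, tri n (x i) y z := by
  induction s using Finset.cons_induction with
  | empty => simp [tri]
  | cons i s hi ih => simp only [Finset.sum_cons, tri_add_left, ih]

lemma norm_tri_le {n : ℕ} {x y z : ℕ → ℂ} {Z : ℝ} (hZ : ∀ m, ‖z m‖ ≤ Z) :
    ‖tri n x y z‖ ≤ Z * ((∑ a ∈ Finset.range (n + 1), ‖x a‖) *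
      ∑ b ∈ Finset.range (n + 1), ‖y b‖) := by
  have hZ0 : 0 ≤ Z := (norm_nonneg _).trans (hZ 0)
  rw [tri, Finset.sum_mul_sum, Finset.mul_sum]
  refine (norm_sum_le _ _).trans (Finset.sum_le_sum fun a _ => ?_)
  rw [Finset.mul_sum]
  refine (norm_sum_le _ _).trans (Finset.sum_le_sum fun b _ => ?_)
  have h1 : ∀ c ∈ Finset.range (n + 1), (if a + b + c = n then x a * y b * z c else 0) =
      if c = n - a - b then (if a + b ≤ n then x a * y b * z c else 0) else 0 := by
    intro c _
    split_ifs <;> first | rfl | omega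
  rw [Finset.sum_congr rfl h1, Finset.sum_ite_eq', if_pos (Finset.mem_range.mpr (by omega))]
  split_ifs
  · rw [norm_mul, norm_mul, mul_comm]
    gcongr
    exact hZ _
  · rw [norm_zero]; positivity

/-- A factor with small partial sums makes the convolution with `1 / log` small. -/
lemma norm_tri_invLog_le {n : ℕ} {D z : ℕ → ℂ} {E : ℝ}
    (hE : ∀ t ≤ n + 1, ‖∑ m ∈ Finset.range t, D m‖ ≤ E) :
    ‖tri n (fun m => (invLog m : ℂ)) D z‖ ≤
      4 * E * ∑ c ∈ Finset.range (n + 1), ‖z c‖ := by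
  have hE0 : 0 ≤ E := (norm_nonneg _).trans (hE 0 (by omega))
  rw [tri_eq, Finset.mul_sum]
  refine (norm_sum_le _ _).trans (Finset.sum_le_sum fun c hc => ?_)
  rw [Finset.mem_range] at hc
  rw [norm_mul, mul_comm]
  gcongr
  set N := n - c with hN
  rcases lt_or_ge N 1 with h | h
  · rw [show N = 0 by omega]
    simp [invLog_zero, hE0]
  rw [sum_range_eq_sum_Ico_two (by simp [invLog_zero]) (by simp [invLog_one]) (by omega)]
  have hab := norm_sum_mul_le_of_antitone (f := fun m => D (N - m)) (w := invLog)
    (by omega : 2 ≤ N + 1) (fun m hm _ => invLog_anti hm (Nat.le_succ m))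
    (invLog_nonneg _) (M := 2 * E) (fun s hs hst => by
      rw [Finset.sum_Ico_reflect D 2 (by omega),
        Finset.sum_Ico_eq_sub _ (by omega)]
      refine (norm_sub_le _ _).trans ?_
      have := hE (N + 1 - 2) (by omega)
      have := hE (N + 1 - s) (by omega)
      linarith)
  calc _ = ‖∑ m ∈ Finset.Ico 2 (N + 1), D (N - m) * (invLog m : ℂ)‖ := by
        simp only [mul_comm]
    _ ≤ 2 * E * invLog 2 := hab
    _ ≤ 2 * E * 2 := by gcongr; exact invLog_le_two 2
    _ = 4 * E := by ring

end TernaryConvolution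

section MainTerm

open ArithmeticFunction hiding log
open ArithmeticFunction.Moebius

lemma tri_twist (n : ℕ) (θ : ℝ) (x y z : ℕ → ℂ) :
    tri n (fun m => x m * expChar (-θ * m)) y z = expChar (-(θ * n)) *
      tri n x (fun m => y m * expChar (θ * m)) (fun m => z m * expChar (θ * m)) := by
  simp only [tri, Finset.mul_sum]
  refine Finset.sum_congr rfl fun a _ => Finset.sum_congr rfl fun b _ =>
    Finset.sum_congr rfl fun c _ => ?_
  split_ifs with h
  · have hn : (n : ℝ) = a + b + c := by exact_mod_cast h.symm
    rw [show -θ * (a : ℝ) = -(θ * n) + θ * b + θ * c by rw [hn]; ring, expChar_add, expChar_add]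
    ring
  · rw [mul_zero]

/-- The `q`-th term of the singular series. -/
noncomputable def singularTerm (n q : ℕ) : ℝ := ((μ q : ℝ) / q.totient) ^ 3 * ramanujanSum n q

lemma norm_sum_range_norm_le {n : ℕ} {x : ℕ → ℂ} {B : ℝ} (hx : ∀ m, ‖x m‖ ≤ B) (hn : 1 ≤ n) :
    ∑ m ∈ Finset.range (n + 1), ‖x m‖ ≤ 2 * B * n := by
  have hB : 0 ≤ B := (norm_nonneg _).trans (hx 0)
  have hn' : (1 : ℝ) ≤ n := by exact_mod_cast hn
  refine (Finset.sum_le_sum fun m _ => hx m).trans ?_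
  rw [Finset.sum_const, Finset.card_range, nsmul_eq_mul]
  push_cast
  nlinarith

lemma norm_tri_primeWeight_twist_sub_le {n q b : ℕ} {E : ℝ} (hn : 1 ≤ n)
    (hE : ∀ t ≤ n + 1, ‖∑ m ∈ Finset.range t, primeDeviation q b m‖ ≤ E) :
    ‖tri n (fun m => (invLog m : ℂ)) (fun m => (primeWeight m : ℂ) * expChar ((b : ℝ) / q * m))
      (fun m => (primeWeight m : ℂ) * expChar ((b : ℝ) / q * m)) -
      ((((μ q : ℝ) / q.totient : ℝ)) : ℂ) ^ 2 * tri n (fun m => (invLog m : ℂ))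
        (fun m => (invLog m : ℂ)) (fun m => (invLog m : ℂ))‖ ≤ 24 * E * n := by
  set w : ℕ → ℂ := fun m => (invLog m : ℂ) with hw
  set F : ℕ → ℂ := fun m => (primeWeight m : ℂ) * expChar ((b : ℝ) / q * m) with hF
  set κ : ℂ := ((((μ q : ℝ) / q.totient : ℝ)) : ℂ) with hκ
  set D : ℕ → ℂ := primeDeviation q b with hD
  have hE0 : 0 ≤ E := (norm_nonneg _).trans (hE 0 (by omega))
  have hFD : F = fun m => D m + κ * w m := by
    funext m
    simp only [hF, hD, hκ, hw, primeDeviation]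
    ring
  have hκ1 : ‖κ‖ ≤ 1 := by
    rw [hκ, Complex.norm_real]; exact abs_moebius_div_totient_le q
  have hF1 : ∀ m, ‖F m‖ ≤ 1 := fun m => by
    simp only [hF]
    rw [norm_mul, norm_expChar, mul_one, Complex.norm_real,
      Real.norm_of_nonneg (primeWeight_nonneg m)]
    exact primeWeight_le_one m
  have hG1 : ∀ m, ‖κ * w m‖ ≤ 2 := fun m => by
    have h1 : ‖w m‖ ≤ 2 := by
      simp only [hw]
      rw [Complex.norm_real, Real.norm_of_nonneg (invLog_nonneg m)]
      exact invLog_le_two m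
    rw [norm_mul]
    nlinarith [norm_nonneg κ, norm_nonneg (w m)]
  have e1 : tri n w F F = tri n w D F + tri n w D (fun m => κ * w m) +
      κ ^ 2 * tri n w w w := by
    have h1 : tri n w F F = tri n w D F + tri n w (fun m => κ * w m) F := by
      rw [tri_swap_left, hFD, tri_add_left, ← hFD, tri_swap_left, tri_swap_left n (fun m => κ * w m)]
    have h2 : tri n w (fun m => κ * w m) F =
        tri n w D (fun m => κ * w m) + κ ^ 2 * tri n w w w := by
      rw [tri_swap_right, tri_swap_left, hFD, tri_add_left, tri_swap_left, tri_const_mul_left,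
        tri_swap_right n w w, tri_swap_left n w (fun m => κ * w m), tri_const_mul_left]
      ring
    rw [h1, h2]; ring
  have hb1 := norm_tri_invLog_le (z := F) hE
  have hb2 := norm_tri_invLog_le (z := fun m => κ * w m) hE
  have hs1 := norm_sum_range_norm_le hF1 hn
  have hs2 := norm_sum_range_norm_le hG1 hn
  rw [e1, add_sub_cancel_right]
  refine (norm_add_le _ _).trans ((add_le_add hb1 hb2).trans ?_)
  have h4 : (0 : ℝ) ≤ 4 * E := by positivity
  have := mul_le_mul_of_nonneg_left hs1 h4
  have := mul_le_mul_of_nonneg_left hs2 h4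
  linarith

lemma sum_redRes_expChar_neg (q n : ℕ) :
    ∑ b ∈ redRes q, expChar (-((b : ℝ) / q * n)) = (ramanujanSum n q : ℂ) := by
  have h := congrArg (starRingEnd ℂ) (sum_redRes_expChar q n)
  rw [map_sum, Complex.conj_ofReal] at h
  simpa only [conj_expChar] using h

theorem exists_tri_modelWeight_sub_le : ∃ C : ℝ, 0 < C ∧ ∀ n : ℕ, 3 ≤ n →
    ‖tri n (modelWeight (modelLevel n)) (fun m => (primeWeight m : ℂ))
      (fun m => (primeWeight m : ℂ)) -
      (∑ q ∈ Finset.Icc 1 (modelLevel n), singularTerm n q : ℝ) * tri n (fun m => (invLog m : ℂ))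
        (fun m => (invLog m : ℂ)) (fun m => (invLog m : ℂ))‖ ≤ C * (n ^ 2 / Real.log n ^ 4) := by
  obtain ⟨C, hC, hdev⟩ := exists_sum_primeDeviation_le 46
  refine ⟨24 * C, by positivity, fun n hn => ?_⟩
  have hL := one_le_log_natCast hn
  set L := Real.log n with hLd
  have hn0 : (0 : ℝ) < n := by exact_mod_cast (by omega : 0 < n)
  set Q := modelLevel n with hQd
  have hQ : (Q : ℝ) ≤ L ^ 14 := by
    rw [hQd, modelLevel]
    push_cast
    gcongr
    exact Nat.floor_le (by linarith)
  set w : ℕ → ℂ := fun m => (invLog m : ℂ) with hw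
  set f : ℕ → ℂ := fun m => (primeWeight m : ℂ) with hf
  have e1 : tri n (modelWeight Q) f f = ∑ q ∈ Finset.Icc 1 Q, ∑ b ∈ redRes q,
      (((μ q : ℝ) / q.totient : ℝ) : ℂ) * (expChar (-((b : ℝ) / q * n)) *
        tri n w (fun m => f m * expChar ((b : ℝ) / q * m))
          (fun m => f m * expChar ((b : ℝ) / q * m))) := by
    have h0 : modelWeight Q = fun m => ∑ q ∈ Finset.Icc 1 Q, ∑ b ∈ redRes q,
        (((μ q : ℝ) / q.totient : ℝ) : ℂ) * (w m * expChar (-((b : ℝ) / q) * m)) := rfl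
    rw [h0, tri_sum_left]
    refine Finset.sum_congr rfl fun q _ => ?_
    rw [tri_sum_left]
    refine Finset.sum_congr rfl fun b _ => ?_
    rw [tri_const_mul_left, tri_twist]
  have e2 : ((∑ q ∈ Finset.Icc 1 Q, singularTerm n q : ℝ) : ℂ) * tri n w w w =
      ∑ q ∈ Finset.Icc 1 Q, ∑ b ∈ redRes q,
      (((μ q : ℝ) / q.totient : ℝ) : ℂ) * (expChar (-((b : ℝ) / q * n)) *
        ((((μ q : ℝ) / q.totient : ℝ) : ℂ) ^ 2 * tri n w w w)) := by
    rw [Complex.ofReal_sum, Finset.sum_mul]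
    refine Finset.sum_congr rfl fun q _ => ?_
    rw [← Finset.mul_sum, ← Finset.sum_mul, sum_redRes_expChar_neg, singularTerm]
    push_cast
    ring
  rw [e1, e2, ← Finset.sum_sub_distrib]
  have hterm : ∀ q ∈ Finset.Icc 1 Q, ‖∑ b ∈ redRes q,
      (((μ q : ℝ) / q.totient : ℝ) : ℂ) * (expChar (-((b : ℝ) / q * n)) *
        tri n w (fun m => f m * expChar ((b : ℝ) / q * m))
          (fun m => f m * expChar ((b : ℝ) / q * m))) - ∑ b ∈ redRes q,
      (((μ q : ℝ) / q.totient : ℝ) : ℂ) * (expChar (-((b : ℝ) / q * n)) *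
        ((((μ q : ℝ) / q.totient : ℝ) : ℂ) ^ 2 * tri n w w w))‖ ≤
      24 * (C * (L ^ 14) ^ 2 * (n / L ^ 46)) * n := by
    intro q hq
    rw [Finset.mem_Icc] at hq
    have hq0 : 0 < q := hq.1
    have hqQ : (q : ℝ) ≤ L ^ 14 := le_trans (by exact_mod_cast hq.2) hQ
    have hφ : (0 : ℝ) < q.totient := by exact_mod_cast Nat.totient_pos.mpr hq0
    rw [← Finset.sum_sub_distrib]
    calc _ ≤ ∑ b ∈ redRes q, 1 / (q.totient : ℝ) *
          (24 * (C * (L ^ 14) ^ 2 * (n / L ^ 46)) * n) := by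
          refine (norm_sum_le _ _).trans (Finset.sum_le_sum fun b hb => ?_)
          have hμ : |(μ q : ℝ)| ≤ 1 := by exact_mod_cast abs_moebius_le_one
          have ht := norm_tri_primeWeight_twist_sub_le (n := n) (q := q) (b := b)
            (E := C * (L ^ 14) ^ 2 * (n / L ^ 46)) (by omega) (fun t ht =>
              (hdev n q b t hn hq0 (mem_redRes.mp hb).2 ht).trans (by gcongr))
          rw [← mul_sub, ← mul_sub, norm_mul, norm_mul, norm_expChar, one_mul, Complex.norm_real,
            Real.norm_eq_abs, abs_div, Nat.abs_cast]
          gcongr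
      _ = _ := by
          rw [Finset.sum_const, card_redRes, nsmul_eq_mul]
          field_simp
  refine (norm_sum_le _ _).trans ((Finset.sum_le_sum hterm).trans ?_)
  rw [Finset.sum_const, Nat.card_Icc, nsmul_eq_mul, Nat.add_sub_cancel]
  calc _ ≤ L ^ 14 * (24 * (C * (L ^ 14) ^ 2 * (n / L ^ 46)) * n) := by gcongr
    _ = _ := by field_simp

theorem exists_tri_primeWeight_sub_le : ∃ C : ℝ, 0 < C ∧ ∀ n : ℕ, 3 ≤ n →
    2 * Real.log n ^ 56 ≤ n →
    ‖tri n (fun m => (primeWeight m : ℂ)) (fun m => (primeWeight m : ℂ))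
      (fun m => (primeWeight m : ℂ)) -
      (∑ q ∈ Finset.Icc 1 (modelLevel n), singularTerm n q : ℝ) * tri n (fun m => (invLog m : ℂ))
        (fun m => (invLog m : ℂ)) (fun m => (invLog m : ℂ))‖ ≤ C * (n ^ 2 / Real.log n ^ 4) := by
  obtain ⟨C₁, hC₁, h₁⟩ := exists_sup_primeWeight_sub_modelWeight_le
  obtain ⟨C₂, hC₂, h₂⟩ := exists_tri_modelWeight_sub_le
  refine ⟨2 * C₁ + C₂, by positivity, fun n hn hbig => ?_⟩
  have hL := one_le_log_natCast hn
  have hn1 : (1 : ℝ) ≤ n := by exact_mod_cast (by omega : 1 ≤ n)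
  have h3 := norm_tri_le_of_expSum (n := n) (f := fun m => (primeWeight m : ℂ))
    (h₁ n hn hbig)
  rw [tri_sub_left] at h3
  have h4 : ∑ m ∈ Finset.range (n + 1), ‖(primeWeight m : ℂ)‖ ^ 2 ≤ 2 * n := by
    calc _ ≤ ∑ m ∈ Finset.range (n + 1), (1 : ℝ) := by
          refine Finset.sum_le_sum fun m _ => ?_
          rw [Complex.norm_real, Real.norm_of_nonneg (primeWeight_nonneg m)]
          exact pow_le_one₀ (primeWeight_nonneg m) (primeWeight_le_one m)
      _ ≤ _ := by
          rw [Finset.sum_const, Finset.card_range, nsmul_eq_mul]; push_cast; linarith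
  have h5 : C₁ * (n / Real.log n ^ 4) * ∑ m ∈ Finset.range (n + 1), ‖(primeWeight m : ℂ)‖ ^ 2 ≤
      2 * C₁ * (n ^ 2 / Real.log n ^ 4) := by
    calc _ ≤ C₁ * (n / Real.log n ^ 4) * (2 * n) := by gcongr
      _ = _ := by ring
  rw [add_mul]
  refine le_trans ?_ (add_le_add (h3.trans h5) (h₂ n hn))
  exact norm_sub_le_norm_sub_add_norm_sub _ _ _

end MainTerm

section DensityConvolution

lemma sum_log_div_le (n : ℕ) (hn : 0 < n) :
    ∑ m ∈ Finset.Icc 1 n, Real.log ((n : ℝ) / m) ≤ n := by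
  have hn0 : (0 : ℝ) < n := by exact_mod_cast hn
  have h1 : ∑ m ∈ Finset.Icc 1 n, Real.log ((n : ℝ) / m) =
      Real.log ((n : ℝ) ^ n / n.factorial) := by
    rw [← Real.log_prod (fun m hm => by
      have : 0 < m := (Finset.mem_Icc.mp hm).1
      positivity)]
    congr 1
    rw [Finset.prod_div_distrib, Finset.prod_const, Nat.card_Icc, Nat.add_sub_cancel,
      ← Finset.prod_range_add_one_eq_factorial, ← Finset.Ico_add_one_right_eq_Icc,
      Finset.prod_Ico_eq_prod_range]
    push_cast
    simp [add_comm]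
  rw [h1, Real.log_le_iff_le_exp (by positivity)]
  exact Real.pow_div_factorial_le_exp _ hn0.le _

lemma abs_invLog_sub_le {m n : ℕ} (hn : 3 ≤ n) (hm : 1 ≤ m) (hmn : m ≤ n) :
    |invLog m - (Real.log n)⁻¹| ≤ 2 * Real.log ((n : ℝ) / m) / Real.log n ^ 2 +
      if m ^ 2 ≤ n then 2 else 0 := by
  have hL := one_le_log_natCast hn
  set L := Real.log n with hLd
  have hn0 : (0 : ℝ) < n := by exact_mod_cast (by omega : 0 < n)
  have hm0 : (0 : ℝ) < m := by exact_mod_cast hm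
  have hmnR : (m : ℝ) ≤ n := by exact_mod_cast hmn
  have hlog : 0 ≤ Real.log ((n : ℝ) / m) := Real.log_nonneg (by rwa [one_le_div hm0])
  have hnn : 0 ≤ 2 * Real.log ((n : ℝ) / m) / L ^ 2 := by positivity
  have hLi : L⁻¹ ≤ 1 := inv_le_one_of_one_le₀ hL
  have hLi0 : 0 ≤ L⁻¹ := by positivity
  split_ifs with h
  · have h1 := invLog_le_two m
    have h2 := invLog_nonneg m
    have : |invLog m - L⁻¹| ≤ 2 := abs_le.mpr ⟨by linarith, by linarith⟩
    linarith
  · have hhalf : L / 2 ≤ Real.log m := by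
      have h1 : (n : ℝ) ≤ (m : ℝ) ^ 2 := by exact_mod_cast (not_le.mp h).le
      have h2 := Real.log_le_log hn0 h1
      rw [Real.log_pow] at h2
      push_cast at h2
      linarith
    have hpos : 0 < Real.log m := by linarith
    have h3 : invLog m - L⁻¹ = Real.log ((n : ℝ) / m) / (L * Real.log m) := by
      rw [invLog, Real.log_div hn0.ne' hm0.ne', ← hLd]
      field_simp
    rw [h3, abs_of_nonneg (by positivity), add_zero, div_le_div_iff₀ (by positivity) (by positivity)]
    nlinarith [mul_le_mul_of_nonneg_left hhalf (by positivity : 0 ≤ Real.log ((n : ℝ) / m) * L)]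

lemma sum_abs_invLog_sub_le {n : ℕ} (hn : 3 ≤ n) :
    ∑ m ∈ Finset.range (n + 1), |invLog m - (Real.log n)⁻¹| ≤ 100 * (n / Real.log n ^ 2) := by
  have hL := one_le_log_natCast hn
  set L := Real.log n with hLd
  have hn0 : (0 : ℝ) < n := by exact_mod_cast (by omega : 0 < n)
  have hs0 : 0 < √(n : ℝ) := Real.sqrt_pos.mpr hn0
  have hss : √(n : ℝ) * √(n : ℝ) = n := Real.mul_self_sqrt hn0.le
  have hLi : L⁻¹ ≤ 1 := inv_le_one_of_one_le₀ hL
  have hLi0 : 0 ≤ L⁻¹ := by positivity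
  have hlogs : L ^ 2 ≤ 8 * √(n : ℝ) := by
    have h1 : (1 : ℝ) ≤ √(n : ℝ) := by
      rw [Real.one_le_sqrt]; exact_mod_cast (by omega : 1 ≤ n)
    have h2 := log_pow_le_factorial_mul h1 2
    rw [Real.log_sqrt hn0.le, ← hLd] at h2
    norm_num [Nat.factorial] at h2
    nlinarith
  have hcount : (∑ m ∈ Finset.Icc 1 n, if m ^ 2 ≤ n then (2 : ℝ) else 0) ≤ 2 * √(n : ℝ) := by
    rw [← Finset.sum_filter, Finset.sum_const, nsmul_eq_mul]
    have h1 : ({m ∈ Finset.Icc 1 n | m ^ 2 ≤ n} : Finset ℕ) ⊆ Finset.Icc 1 (Nat.sqrt n) := by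
      intro m hm
      rw [Finset.mem_filter, Finset.mem_Icc] at hm
      rw [Finset.mem_Icc, Nat.le_sqrt']
      exact ⟨hm.1.1, hm.2⟩
    have h2 := Finset.card_le_card h1
    rw [Nat.card_Icc, Nat.add_sub_cancel] at h2
    have h3 : (({m ∈ Finset.Icc 1 n | m ^ 2 ≤ n} : Finset ℕ).card : ℝ) ≤ √(n : ℝ) :=
      le_trans (by exact_mod_cast h2) Real.nat_sqrt_le_real_sqrt
    linarith
  have hIcc : Finset.range (n + 1) = insert 0 (Finset.Icc 1 n) := by
    ext m; simp only [Finset.mem_range, Finset.mem_insert, Finset.mem_Icc]; omega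
  rw [hIcc, Finset.sum_insert (by simp), invLog_zero, zero_sub, abs_neg, abs_of_nonneg hLi0]
  have hsum := Finset.sum_le_sum (fun m (hm : m ∈ Finset.Icc 1 n) =>
    abs_invLog_sub_le hn (Finset.mem_Icc.mp hm).1 (Finset.mem_Icc.mp hm).2)
  rw [Finset.sum_add_distrib, ← Finset.sum_div, ← Finset.mul_sum] at hsum
  have hlogsum := sum_log_div_le n (by omega)
  have h1 : 2 * (∑ m ∈ Finset.Icc 1 n, Real.log ((n : ℝ) / m)) / L ^ 2 ≤ 2 * (n / L ^ 2) := by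
    rw [mul_div_assoc]; gcongr
  have h2 : √(n : ℝ) ≤ 8 * (n / L ^ 2) := by
    rw [mul_div_assoc', le_div_iff₀ (by positivity)]
    nlinarith
  have h3 : (1 : ℝ) ≤ √(n : ℝ) := by
    rw [Real.one_le_sqrt]; exact_mod_cast (by omega : 1 ≤ n)
  linarith

lemma tri_one (n : ℕ) : tri n (fun _ => 1) (fun _ => 1) (fun _ => 1) =
    ((n : ℂ) + 1) * (n + 2) / 2 := by
  rw [tri_eq]
  simp only [mul_one, one_mul, Finset.sum_const, Finset.card_range, nsmul_eq_mul]
  have h1 : ∑ c ∈ Finset.range (n + 1), ((n - c + 1 : ℕ) : ℂ) =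
      ∑ c ∈ Finset.range (n + 1), ((c + 1 : ℕ) : ℂ) := by
    rw [← Finset.sum_range_reflect]
    refine Finset.sum_congr rfl fun c hc => ?_
    rw [Finset.mem_range] at hc
    congr 1
    omega
  rw [h1]
  clear h1
  induction n with
  | zero => simp
  | succ n ih => rw [Finset.sum_range_succ, ih]; push_cast; ring

lemma tri_add_cube (n : ℕ) (k v : ℕ → ℂ) :
    tri n (fun m => k m + v m) (fun m => k m + v m) (fun m => k m + v m) =
      tri n k k k + 3 * tri n v k k + 3 * tri n v v k + tri n v v v := by
  have h1 : tri n (fun m => k m + v m) (fun m => k m + v m) (fun m => k m + v m) =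
      tri n k k k + (tri n v k k + tri n k v k + tri n k k v) +
      (tri n v v k + tri n v k v + tri n k v v) + tri n v v v := by
    simp only [tri, ← Finset.sum_add_distrib]
    refine Finset.sum_congr rfl fun a _ => Finset.sum_congr rfl fun b _ =>
      Finset.sum_congr rfl fun c _ => ?_
    split_ifs <;> ring
  rw [h1, tri_swap_left n k v k, tri_swap_right n k k v, tri_swap_left n k v k,
    tri_swap_right n v k v, tri_swap_left n k v v, tri_swap_right n v k v]
  ring

theorem norm_tri_invLog_sub_le {n : ℕ} (hn : 3 ≤ n) :
    ‖tri n (fun m => (invLog m : ℂ)) (fun m => (invLog m : ℂ)) (fun m => (invLog m : ℂ)) -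
      ((n ^ 2 / (2 * Real.log n ^ 3) : ℝ) : ℂ)‖ ≤ 10 ^ 5 * (n ^ 2 / Real.log n ^ 4) := by
  have hL := one_le_log_natCast hn
  have hV := sum_abs_invLog_sub_le hn
  have hlogn : Real.log n ≤ n := (Real.log_le_self (Nat.cast_nonneg n))
  set L := Real.log n with hLd
  have hn0 : (0 : ℝ) < n := by exact_mod_cast (by omega : 0 < n)
  have hn3 : (3 : ℝ) ≤ n := by exact_mod_cast hn
  have hL0 : 0 < L := by linarith
  have hLi : L⁻¹ ≤ 1 := inv_le_one_of_one_le₀ hL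
  have hLi0 : 0 ≤ L⁻¹ := by positivity
  set k : ℕ → ℂ := fun _ => ((L⁻¹ : ℝ) : ℂ) with hk
  set v : ℕ → ℂ := fun m => ((invLog m - L⁻¹ : ℝ) : ℂ) with hv
  have hw : (fun m => (invLog m : ℂ)) = fun m => k m + v m := by
    funext m; simp only [hk, hv]; push_cast; ring
  have hnv : ∀ m, ‖v m‖ = |invLog m - L⁻¹| := fun m => by
    simp only [hv]; rw [Complex.norm_real, Real.norm_eq_abs]
  have hv2 : ∀ m, ‖v m‖ ≤ 2 := fun m => by
    rw [hnv]
    have h1 := invLog_le_two m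
    have h2 := invLog_nonneg m
    exact abs_le.mpr ⟨by linarith, by linarith⟩
  have hk1 : ∀ m, ‖k m‖ ≤ L⁻¹ := fun m => by
    simp only [hk]; rw [Complex.norm_real, Real.norm_of_nonneg hLi0]
  have hsk : ∑ m ∈ Finset.range (n + 1), ‖k m‖ ≤ 2 * L⁻¹ * n := norm_sum_range_norm_le hk1 (by omega)
  have hsv : ∑ m ∈ Finset.range (n + 1), ‖v m‖ ≤ 100 * (n / L ^ 2) := by
    simpa only [hnv] using hV
  have hsk0 : 0 ≤ ∑ m ∈ Finset.range (n + 1), ‖k m‖ := Finset.sum_nonneg fun _ _ => norm_nonneg _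
  have hsv0 : 0 ≤ ∑ m ∈ Finset.range (n + 1), ‖v m‖ := Finset.sum_nonneg fun _ _ => norm_nonneg _
  have b1 : ‖tri n v k k‖ ≤ 200 * (n ^ 2 / L ^ 4) := by
    calc _ ≤ L⁻¹ * ((100 * (n / L ^ 2)) * (2 * L⁻¹ * n)) :=
          (norm_tri_le hk1).trans (by gcongr)
      _ = _ := by field_simp; norm_num
  have b2 : ‖tri n v v k‖ ≤ 10000 * (n ^ 2 / L ^ 4) := by
    calc _ ≤ L⁻¹ * ((100 * (n / L ^ 2)) * (100 * (n / L ^ 2))) :=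
          (norm_tri_le hk1).trans (by gcongr)
      _ = L⁻¹ * (10000 * (n ^ 2 / L ^ 4)) := by ring
      _ ≤ 1 * (10000 * (n ^ 2 / L ^ 4)) := by gcongr
      _ = _ := one_mul _
  have b3 : ‖tri n v v v‖ ≤ 20000 * (n ^ 2 / L ^ 4) := by
    calc _ ≤ 2 * ((100 * (n / L ^ 2)) * (100 * (n / L ^ 2))) :=
          (norm_tri_le hv2).trans (by gcongr)
      _ = _ := by ring
  have e1 : tri n k k k = ((L⁻¹ ^ 3 * ((n + 1) * (n + 2) / 2) : ℝ) : ℂ) := by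
    have hk' : k = fun _ => ((L⁻¹ : ℝ) : ℂ) * (1 : ℂ) := by funext m; simp [hk]
    rw [hk', tri_const_mul_left, tri_swap_left, tri_const_mul_left, tri_swap_right, tri_swap_left,
      tri_const_mul_left, tri_one]
    push_cast
    ring
  have b0 : ‖tri n k k k - ((n ^ 2 / (2 * L ^ 3) : ℝ) : ℂ)‖ ≤ 2 * (n ^ 2 / L ^ 4) := by
    rw [e1, ← Complex.ofReal_sub, Complex.norm_real]
    have : L⁻¹ ^ 3 * (((n : ℝ) + 1) * (n + 2) / 2) - n ^ 2 / (2 * L ^ 3) =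
        (3 * n + 2) / (2 * L ^ 3) := by
      field_simp; ring
    rw [this, Real.norm_of_nonneg (by positivity), mul_div_assoc',
      div_le_div_iff₀ (by positivity) (by positivity)]
    have h5 : (3 * (n : ℝ) + 2) * L ≤ 4 * n ^ 2 := by nlinarith
    calc (3 * (n : ℝ) + 2) * L ^ 4 = (3 * (n : ℝ) + 2) * L * L ^ 3 := by ring
      _ ≤ 4 * n ^ 2 * L ^ 3 := by gcongr
      _ = _ := by ring
  have hpos : 0 ≤ (n : ℝ) ^ 2 / L ^ 4 := by positivity
  rw [hw, tri_add_cube]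
  calc _ = ‖(tri n k k k - ((n ^ 2 / (2 * L ^ 3) : ℝ) : ℂ)) + 3 * tri n v k k +
        3 * tri n v v k + tri n v v v‖ := by congr 1; ring
    _ ≤ ‖tri n k k k - ((n ^ 2 / (2 * L ^ 3) : ℝ) : ℂ)‖ + ‖3 * tri n v k k‖ +
        ‖3 * tri n v v k‖ + ‖tri n v v v‖ := norm_add₄_le
    _ ≤ _ := by
      rw [norm_mul, norm_mul, Complex.norm_ofNat]
      linarith

end DensityConvolution

section SingularSeries

open ArithmeticFunction hiding log
open ArithmeticFunction.Moebius

lemma Squarefree.pow_three_le_totient {q : ℕ} (hq : Squarefree q) :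
    q ^ 3 ≤ 16 * q.totient ^ 4 := by
  have hq0 : q ≠ 0 := hq.ne_zero
  have h1 : q = ∏ p ∈ q.primeFactors, p := (Nat.prod_primeFactors_of_squarefree hq).symm
  have h2 : q.totient = ∏ p ∈ q.primeFactors, (p - 1) := by
    have h3 := Nat.totient_mul_prod_primeFactors q
    rw [← h1, mul_comm] at h3
    exact Nat.eq_of_mul_eq_mul_left (Nat.pos_of_ne_zero hq0) h3
  have h3 : ∏ p ∈ q.primeFactors, ((if p = 2 then 8 else 1) * (if p = 3 then 2 else 1)) ≤ 16 := by
    rw [Finset.prod_mul_distrib, Finset.prod_ite_eq', Finset.prod_ite_eq']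
    split_ifs <;> norm_num
  have h4 : ∏ p ∈ q.primeFactors, p ^ 3 ≤ ∏ p ∈ q.primeFactors,
      ((if p = 2 then 8 else 1) * (if p = 3 then 2 else 1)) * (p - 1) ^ 4 := by
    refine Finset.prod_le_prod' fun p hp => ?_
    have hp' := Nat.prime_of_mem_primeFactors hp
    rcases lt_or_ge p 5 with h | h
    · have := hp'.two_le
      interval_cases p
      · norm_num
      · norm_num
      · exact absurd hp' (by norm_num)
    · rw [if_neg (by omega), if_neg (by omega), one_mul, one_mul]
      obtain ⟨k, rfl⟩ := Nat.exists_eq_add_of_le h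
      rw [show 5 + k - 1 = k + 4 by omega]
      nlinarith [sq_nonneg k, Nat.zero_le (k ^ 3), Nat.zero_le (k ^ 4)]
  calc q ^ 3 = ∏ p ∈ q.primeFactors, p ^ 3 := by rw [Finset.prod_pow, ← h1]
    _ ≤ _ := h4
    _ = (∏ p ∈ q.primeFactors, ((if p = 2 then 8 else 1) * (if p = 3 then 2 else 1))) *
        q.totient ^ 4 := by rw [Finset.prod_mul_distrib, Finset.prod_pow, ← h2]
    _ ≤ _ := by gcongr

lemma abs_singularTerm_le (n q : ℕ) : |singularTerm n q| ≤ 4 / (q : ℝ) ^ (3 / 2 : ℝ) := by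
  by_cases hq : Squarefree q
  · have hq0 : 0 < q := Nat.pos_of_ne_zero hq.ne_zero
    have hqR : (0 : ℝ) < q := by exact_mod_cast hq0
    have hφ : (0 : ℝ) < q.totient := by exact_mod_cast Nat.totient_pos.mpr hq0
    have hμ : |(μ q : ℝ)| ≤ 1 := by exact_mod_cast abs_moebius_le_one
    have h1 : |singularTerm n q| ≤ 1 / (q.totient : ℝ) ^ 2 := by
      rw [singularTerm, abs_mul, abs_pow, abs_div, Nat.abs_cast]
      calc _ ≤ (1 / (q.totient : ℝ)) ^ 3 * q.totient := by
            gcongr; exact abs_ramanujanSum_le n q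
        _ = _ := by field_simp
    have h2 : ((q : ℝ) ^ (3 / 2 : ℝ)) ^ 2 ≤ (4 * (q.totient : ℝ) ^ 2) ^ 2 := by
      rw [← Real.rpow_natCast, ← Real.rpow_mul hqR.le]
      norm_num
      have : (q : ℝ) ^ 3 ≤ 16 * (q.totient : ℝ) ^ 4 := by exact_mod_cast hq.pow_three_le_totient
      calc (q : ℝ) ^ 3 ≤ _ := this
        _ = _ := by ring
    have h3 := le_of_sq_le_sq h2 (by positivity)
    refine h1.trans ?_
    rw [div_le_div_iff₀ (by positivity) (by positivity), one_mul]
    exact h3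
  · rw [singularTerm, moebius_eq_zero_of_not_squarefree hq]
    simp
    positivity

lemma singularTerm_zero (n : ℕ) : singularTerm n 0 = 0 := by simp [singularTerm]

lemma singularTerm_one (n : ℕ) : singularTerm n 1 = 1 := by
  simp [singularTerm, (isMultiplicative_ramanujanSum n).map_one]

lemma singularTerm_mul (n : ℕ) {a b : ℕ} (h : a.Coprime b) :
    singularTerm n (a * b) = singularTerm n a * singularTerm n b := by
  rw [singularTerm, singularTerm, singularTerm, (isMultiplicative_ramanujanSum n).map_mul_of_coprime h,
    isMultiplicative_moebius.map_mul_of_coprime h, Nat.totient_mul h]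
  push_cast
  rw [mul_div_mul_comm]
  ring

lemma singularTerm_prime (n : ℕ) {p : ℕ} (hp : p.Prime) : 1 + singularTerm n p =
    if p ∣ n then 1 - 1 / ((p : ℝ) - 1) ^ 2 else 1 + 1 / ((p : ℝ) - 1) ^ 3 := by
  have h1 : (0 : ℝ) < (p : ℝ) - 1 := by
    have : (1 : ℝ) < p := by exact_mod_cast hp.one_lt
    linarith
  rw [singularTerm, moebius_apply_prime hp, Nat.totient_prime hp, ramanujanSum_prime n hp,
    Nat.cast_sub hp.one_le]
  push_cast
  split_ifs
  · field_simp; ring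
  · field_simp; ring

lemma summable_norm_singularTerm (n : ℕ) : Summable fun q => ‖singularTerm n q‖ := by
  refine Summable.of_nonneg_of_le (fun q => norm_nonneg _) (fun q => abs_singularTerm_le n q) ?_
  have h := (Real.summable_one_div_nat_rpow.mpr (by norm_num : (1 : ℝ) < 3 / 2)).mul_left 4
  simpa only [mul_one_div] using h

lemma hasProd_ternarySingularSeries (n : ℕ) : HasProd (fun p : Nat.Primes =>
    if (p : ℕ) ∣ n then 1 - 1 / ((p : ℝ) - 1) ^ 2 else 1 + 1 / ((p : ℝ) - 1) ^ 3)
    (∑' q, singularTerm n q) := by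
  have h := EulerProduct.eulerProduct_hasProd (singularTerm_one n)
    (fun h => singularTerm_mul n h) (summable_norm_singularTerm n) (singularTerm_zero n)
  suffices hf : (fun p : Nat.Primes => ∑' e, singularTerm n ((p : ℕ) ^ e)) = fun p : Nat.Primes =>
      if (p : ℕ) ∣ n then 1 - 1 / ((p : ℝ) - 1) ^ 2 else 1 + 1 / ((p : ℝ) - 1) ^ 3 by
    rw [← hf]; exact h
  funext p
  rw [tsum_eq_sum (s := Finset.range 2)]
  · rw [Finset.sum_range_succ, Finset.sum_range_one, pow_zero, pow_one, singularTerm_one,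
      singularTerm_prime n p.2]
  · intro e he
    rw [Finset.mem_range, not_lt] at he
    have : ¬ Squarefree ((p : ℕ) ^ e) := fun hs => by
      have := (Nat.squarefree_pow_iff p.2.one_lt.ne' (by omega)).mp hs
      omega
    rw [singularTerm, moebius_eq_zero_of_not_squarefree this]
    simp

lemma ternarySingularSeries_eq (n : ℕ) : ternarySingularSeries n = ∑' q, singularTerm n q :=
  (hasProd_ternarySingularSeries n).tprod_eq

lemma exists_ternarySingularSeries_sub_le : ∃ C : ℝ, 0 < C ∧ ∀ n Q : ℕ, 0 < Q →
    |ternarySingularSeries n - ∑ q ∈ Finset.Icc 1 Q, singularTerm n q| ≤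
      C / (Q : ℝ) ^ (1 / 4 : ℝ) := by
  have hs : Summable fun q : ℕ => 1 / (q : ℝ) ^ (5 / 4 : ℝ) :=
    Real.summable_one_div_nat_rpow.mpr (by norm_num)
  have hnn : ∀ q : ℕ, 0 ≤ 1 / (q : ℝ) ^ (5 / 4 : ℝ) := fun q => by positivity
  refine ⟨4 * ∑' q : ℕ, 1 / (q : ℝ) ^ (5 / 4 : ℝ), ?_, fun n Q hQ => ?_⟩
  · have := hs.tsum_pos hnn 1 (by norm_num)
    linarith
  rw [ternarySingularSeries_eq]
  have hQR : (0 : ℝ) < Q := by exact_mod_cast hQ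
  have h1 : HasSum (fun q => if q ∈ Finset.Icc 1 Q then singularTerm n q else 0)
      (∑ q ∈ Finset.Icc 1 Q, singularTerm n q) := by
    have h0 := hasSum_sum_of_ne_finset_zero (L := .unconditional ℕ) (s := Finset.Icc 1 Q)
      (f := fun q => if q ∈ Finset.Icc 1 Q then singularTerm n q else 0) (fun b hb => if_neg hb)
    rwa [Finset.sum_congr rfl fun q hq => if_pos hq] at h0
  have h0 : HasSum (singularTerm n) (∑' q, singularTerm n q) :=
    (summable_norm_singularTerm n).of_norm.hasSum
  have h2 := h0.sub h1
  rw [← h2.tsum_eq, ← Real.norm_eq_abs]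
  have h3 := (hs.hasSum.mul_left (4 / (Q : ℝ) ^ (1 / 4 : ℝ)))
  refine (tsum_of_norm_bounded h3 fun q => ?_).trans (le_of_eq (by ring))
  split_ifs with hq
  · rw [sub_self, norm_zero]; positivity
  · rw [sub_zero]
    rcases Nat.eq_zero_or_pos q with rfl | hq0
    · rw [singularTerm_zero, norm_zero]; positivity
    · have hqQ : (Q : ℝ) ≤ q := by
        rw [Finset.mem_Icc] at hq
        exact_mod_cast (by omega : Q ≤ q)
      have hqR : (0 : ℝ) < q := by exact_mod_cast hq0
      refine (abs_singularTerm_le n q).trans ?_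
      rw [show (3 / 2 : ℝ) = 1 / 4 + 5 / 4 by norm_num, Real.rpow_add hqR, div_mul_div_comm,
        mul_one]
      gcongr

lemma exists_abs_ternarySingularSeries_le : ∃ C : ℝ, 0 < C ∧ ∀ n : ℕ,
    |ternarySingularSeries n| ≤ C := by
  obtain ⟨C, hC, h⟩ := exists_ternarySingularSeries_sub_le
  refine ⟨C + 1, by positivity, fun n => ?_⟩
  have h1 := h n 1 one_pos
  simp only [Finset.Icc_self, Finset.sum_singleton, singularTerm_one, Nat.cast_one, Real.one_rpow,
    div_one] at h1
  rw [abs_le] at h1 ⊢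
  constructor <;> linarith

lemma half_le_prod_one_sub_sq (T : Finset ℕ) (hT : ∀ k ∈ T, 2 ≤ k) :
    1 / 2 ≤ ∏ k ∈ T, (1 - 1 / (k : ℝ) ^ 2) := by
  have h0 : ∀ k : ℕ, 2 ≤ k → 0 ≤ 1 - 1 / (k : ℝ) ^ 2 := fun k hk => by
    have : (2 : ℝ) ≤ k := by exact_mod_cast hk
    rw [sub_nonneg, div_le_one (by positivity)]
    nlinarith
  have h1 : ∀ k : ℕ, 1 - 1 / (k : ℝ) ^ 2 ≤ 1 := fun k => by
    have : 0 ≤ 1 / (k : ℝ) ^ 2 := by positivity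
    linarith
  set N := T.sup id with hN
  have hsub : T ⊆ Finset.Ico 2 (N + 2) := fun k hk => by
    have : k ≤ N := Finset.le_sup (f := id) hk
    rw [Finset.mem_Ico]
    exact ⟨hT k hk, by omega⟩
  have h2 : ∀ m : ℕ, ∏ k ∈ Finset.Ico 2 (m + 2), (1 - 1 / (k : ℝ) ^ 2) =
      ((m : ℝ) + 2) / (2 * (m + 1)) := by
    intro m
    induction m with
    | zero => simp
    | succ m ih =>
      rw [show m + 1 + 2 = (m + 2) + 1 by ring, Finset.prod_Ico_succ_top (by omega), ih]
      push_cast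
      field_simp
      ring
  calc (1 : ℝ) / 2 ≤ (N + 2) / (2 * (N + 1)) := by
        rw [div_le_div_iff₀ (by norm_num) (by positivity)]
        linarith
    _ = (∏ k ∈ Finset.Ico 2 (N + 2) \ T, (1 - 1 / (k : ℝ) ^ 2)) *
        ∏ k ∈ T, (1 - 1 / (k : ℝ) ^ 2) := by rw [Finset.prod_sdiff hsub, h2]
    _ ≤ 1 * ∏ k ∈ T, (1 - 1 / (k : ℝ) ^ 2) := by
        gcongr
        · exact Finset.prod_nonneg fun k hk => h0 k (hT k hk)
        · refine Finset.prod_le_one (fun k hk => h0 k ?_) fun k _ => h1 k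
          exact (Finset.mem_Ico.mp (Finset.mem_sdiff.mp hk).1).1
    _ = _ := one_mul _

lemma one_le_ternarySingularSeries {n : ℕ} (hn : Odd n) : 1 ≤ ternarySingularSeries n := by
  rw [ternarySingularSeries_eq]
  refine ge_of_tendsto (hasProd_ternarySingularSeries n) ?_
  filter_upwards [Filter.eventually_ge_atTop ({⟨2, Nat.prime_two⟩} : Finset Nat.Primes)] with s hs
  have h2 : (⟨2, Nat.prime_two⟩ : Nat.Primes) ∈ s := hs (Finset.mem_singleton_self _)
  rw [← Finset.mul_prod_erase s _ h2]
  have hn2 : ¬ 2 ∣ n := hn.not_two_dvd_nat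
  rw [if_neg hn2]
  set T := s.erase ⟨2, Nat.prime_two⟩ with hT
  have hT3 : ∀ p ∈ T, 3 ≤ (p : ℕ) := fun p hp => by
    have h3 := p.2.two_le
    have h4 : (p : ℕ) ≠ 2 := fun h => (Finset.mem_erase.mp hp).1 (Subtype.ext h)
    omega
  have h3 : 1 / 2 ≤ ∏ p ∈ T, (1 - 1 / ((p : ℝ) - 1) ^ 2) := by
    have h4 := half_le_prod_one_sub_sq (T.image fun p : Nat.Primes => (p : ℕ) - 1) (fun k hk => by
      obtain ⟨p, hp, rfl⟩ := Finset.mem_image.mp hk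
      have := hT3 p hp
      omega)
    rw [Finset.prod_image (fun p hp p' hp' h => by
      have h5 := hT3 p hp
      have h6 := hT3 p' hp'
      change (p : ℕ) - 1 = (p' : ℕ) - 1 at h
      exact Subtype.ext (by omega))] at h4
    refine h4.trans (le_of_eq (Finset.prod_congr rfl fun p hp => ?_))
    have := hT3 p hp
    rw [Nat.cast_sub (by omega), Nat.cast_one]
  have h4 : ∏ p ∈ T, (1 - 1 / ((p : ℝ) - 1) ^ 2) ≤ ∏ p ∈ T,
      if (p : ℕ) ∣ n then 1 - 1 / ((p : ℝ) - 1) ^ 2 else 1 + 1 / ((p : ℝ) - 1) ^ 3 := by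
    refine Finset.prod_le_prod (fun p hp => ?_) fun p hp => ?_
    · have : (3 : ℝ) ≤ p := by exact_mod_cast hT3 p hp
      rw [sub_nonneg, div_le_one (by nlinarith)]
      nlinarith
    · have : (3 : ℝ) ≤ p := by exact_mod_cast hT3 p hp
      split_ifs
      · exact le_rfl
      · have h5 : 0 ≤ 1 / ((p : ℝ) - 1) ^ 2 := by positivity
        have h6 : 0 ≤ 1 / ((p : ℝ) - 1) ^ 3 := by
          have : 0 ≤ (p : ℝ) - 1 := by linarith
          positivity
        linarith
  have h5 : (1 : ℝ) + 1 / ((((⟨2, Nat.prime_two⟩ : Nat.Primes) : ℕ) : ℝ) - 1) ^ 3 = 2 := by norm_num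
  rw [h5]
  linarith

end SingularSeries

section ThreePrimes

open ArithmeticFunction hiding log

lemma ternaryGoldbachReps_eq_tri (n : ℕ) :
    (ternaryGoldbachReps n : ℂ) = tri n (fun m => if m.Prime then 1 else 0)
      (fun m => if m.Prime then 1 else 0) (fun m => if m.Prime then 1 else 0) := by
  have hset : {t : ℕ × ℕ × ℕ | t.1.Prime ∧ t.2.1.Prime ∧ t.2.2.Prime ∧ t.1 + t.2.1 + t.2.2 = n} =
      ((Finset.range (n + 1) ×ˢ (Finset.range (n + 1) ×ˢ Finset.range (n + 1))).filter
        fun t : ℕ × ℕ × ℕ => t.1.Prime ∧ t.2.1.Prime ∧ t.2.2.Prime ∧ t.1 + t.2.1 + t.2.2 = n :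
        Finset (ℕ × ℕ × ℕ)) := by
    ext ⟨a, b, c⟩
    simp only [Set.mem_ofPred_eq, Finset.coe_filter, Finset.mem_product, Finset.mem_range]
    refine ⟨fun h => ⟨by omega, h⟩, fun h => h.2⟩
  rw [ternaryGoldbachReps, hset, Set.ncard_coe_finset, Finset.card_filter, Finset.sum_product, tri]
  push_cast
  refine Finset.sum_congr rfl fun a _ => ?_
  rw [Finset.sum_product]
  refine Finset.sum_congr rfl fun b _ => Finset.sum_congr rfl fun c _ => ?_
  by_cases ha : a.Prime <;> by_cases hb : b.Prime <;> by_cases hc : c.Prime <;> simp [ha, hb, hc]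

lemma primeWeight_of_prime {p : ℕ} (hp : p.Prime) : primeWeight p = 1 := by
  rw [primeWeight, vonMangoldt_apply_prime hp, invLog,
    mul_inv_cancel₀ (Real.log_pos (by exact_mod_cast hp.one_lt)).ne']

lemma sum_primeWeight_not_prime_le {n : ℕ} (hn : 1 ≤ n) :
    ∑ m ∈ Finset.range (n + 1), (if m.Prime then 0 else primeWeight m) ≤
      4 * √n * Real.log n := by
  have h := Chebyshev.psi_sub_theta_le (x := (n : ℝ)) (by exact_mod_cast hn)
  rw [Chebyshev.psi_sub_theta_eq_sum_not_prime, Nat.floor_natCast, Finset.sum_filter] at h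
  rw [Finset.range_eq_Ico, Finset.sum_eq_sum_Ico_succ_bot (by omega)]
  have hI : Finset.Ico (0 + 1) (n + 1) = Finset.Ioc 0 n := by ext; simp; omega
  rw [hI]
  calc _ ≤ 2 * ∑ m ∈ Finset.Ioc 0 n, (if ¬ m.Prime then Λ m else 0) := by
        rw [primeWeight_zero, ite_self, zero_add, Finset.mul_sum]
        refine Finset.sum_le_sum fun m _ => ?_
        by_cases hm : m.Prime
        · simp [hm]
        · simp only [hm, not_false_eq_true, if_true, if_false]
          rw [primeWeight, mul_comm]
          exact mul_le_mul_of_nonneg_right (invLog_le_two m) vonMangoldt_nonneg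
    _ ≤ _ := by linarith

lemma norm_tri_primeWeight_sub_ternaryGoldbachReps_le {n : ℕ} (hn : 3 ≤ n) :
    ‖tri n (fun m => (primeWeight m : ℂ)) (fun m => (primeWeight m : ℂ))
      (fun m => (primeWeight m : ℂ)) - ternaryGoldbachReps n‖ ≤
      215040 * ((n : ℝ) ^ 2 / Real.log n ^ 4) := by
  have hL := one_le_log_natCast hn
  have hn1 : (1 : ℝ) ≤ n := by exact_mod_cast (by omega : 1 ≤ n)
  set k : ℕ → ℂ := fun m => if m.Prime then 1 else 0 with hk
  set v : ℕ → ℂ := fun m => ((if m.Prime then 0 else primeWeight m : ℝ) : ℂ) with hv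
  have hkv : (fun m => (primeWeight m : ℂ)) = fun m => k m + v m := by
    funext m
    by_cases hm : m.Prime
    · simp [hk, hv, hm, primeWeight_of_prime hm]
    · simp [hk, hv, hm]
  have hk1 : ∀ m, ‖k m‖ ≤ 1 := fun m => by
    by_cases hm : m.Prime <;> simp [hk, hm]
  have hvn : ∀ m, ‖v m‖ = if m.Prime then 0 else primeWeight m := fun m => by
    rw [hv, Complex.norm_real, Real.norm_of_nonneg]
    split_ifs
    exacts [le_rfl, primeWeight_nonneg m]
  have hv1 : ∀ m, ‖v m‖ ≤ 1 := fun m => by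
    rw [hvn]
    split_ifs
    exacts [zero_le_one, primeWeight_le_one m]
  have hks := norm_sum_range_norm_le hk1 (by omega : 1 ≤ n)
  have hvs := norm_sum_range_norm_le hv1 (by omega : 1 ≤ n)
  have hV := sum_primeWeight_not_prime_le (by omega : 1 ≤ n)
  rw [← Finset.sum_congr rfl fun m _ => hvn m] at hV
  rw [hkv, tri_add_cube, ternaryGoldbachReps_eq_tri, ← hk]
  set V := ∑ m ∈ Finset.range (n + 1), ‖v m‖ with hVd
  have hV0 : 0 ≤ V := Finset.sum_nonneg fun _ _ => norm_nonneg _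
  have h1 : ‖tri n v k k‖ ≤ V * (2 * n) :=
    (norm_tri_le hk1).trans (by rw [one_mul]; gcongr; linarith)
  have h2 : ‖tri n v v k‖ ≤ V * (2 * n) :=
    (norm_tri_le hk1).trans (by rw [one_mul]; gcongr; linarith)
  have h3 : ‖tri n v v v‖ ≤ V * (2 * n) :=
    (norm_tri_le hv1).trans (by rw [one_mul]; gcongr; linarith)
  have hs1 : (1 : ℝ) ≤ √n := Real.one_le_sqrt.mpr hn1
  have h5 := log_pow_le_factorial_mul hs1 5
  rw [Real.log_sqrt (by positivity), div_pow, show (Nat.factorial 5 : ℝ) = 120 by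
    norm_num [Nat.factorial]] at h5
  have hss : √(n : ℝ) * √n = n := Real.mul_self_sqrt (by positivity)
  set L := Real.log n with hLd
  have hfin : V * (2 * n) * 7 ≤ 215040 * ((n : ℝ) ^ 2 / L ^ 4) := by
    rw [← mul_div_assoc, le_div_iff₀ (by positivity)]
    calc V * (2 * n) * 7 * L ^ 4 ≤ 4 * √n * L * (2 * n) * 7 * L ^ 4 := by gcongr
      _ = 56 * (n * √n) * L ^ 5 := by ring
      _ ≤ 56 * (n * √n) * (3840 * √n) := by gcongr; linarith
      _ = 215040 * (n * (√n * √n)) := by ring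
      _ = _ := by rw [hss]; ring
  refine le_trans ?_ hfin
  calc _ = ‖3 * tri n v k k + 3 * tri n v v k + tri n v v v‖ := by congr 1; ring
    _ ≤ ‖3 * tri n v k k‖ + ‖3 * tri n v v k‖ + ‖tri n v v v‖ := norm_add₃_le
    _ ≤ _ := by
      rw [norm_mul, norm_mul, Complex.norm_ofNat]
      linarith

lemma exists_abs_ternaryGoldbachReps_sub_le : ∃ C : ℝ, 0 < C ∧ ∀ n : ℕ, 3 ≤ n →
    2 * Real.log n ^ 56 ≤ n →
    |(ternaryGoldbachReps n : ℝ) -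
      ternarySingularSeries n * (n : ℝ) ^ 2 / (2 * Real.log n ^ 3)| ≤
      C * ((n : ℝ) ^ 2 / Real.log n ^ 4) := by
  obtain ⟨C₁, hC₁, h₁⟩ := exists_tri_primeWeight_sub_le
  obtain ⟨C₂, hC₂, h₂⟩ := exists_ternarySingularSeries_sub_le
  obtain ⟨C₃, hC₃, h₃⟩ := exists_abs_ternarySingularSeries_le
  refine ⟨215040 + C₁ + 2 * C₂ * (1 + 10 ^ 5) + C₃ * 10 ^ 5, by positivity, fun n hn hbig => ?_⟩
  have hL := one_le_log_natCast hn
  have hn1 : (1 : ℝ) ≤ n := by exact_mod_cast (by omega : 1 ≤ n)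
  have a0 := norm_tri_primeWeight_sub_ternaryGoldbachReps_le hn
  have a1 := h₁ n hn hbig
  have a3 := norm_tri_invLog_sub_le hn
  have hQ0 : 0 < ⌊Real.log n⌋₊ := Nat.floor_pos.mpr hL
  have a2 := h₂ n (modelLevel n) (by rw [modelLevel]; positivity)
  have a4 := h₃ n
  set L := Real.log n with hLd
  set W := tri n (fun m => (invLog m : ℂ)) (fun m => (invLog m : ℂ)) (fun m => (invLog m : ℂ))
  set T := tri n (fun m => (primeWeight m : ℂ)) (fun m => (primeWeight m : ℂ))
    (fun m => (primeWeight m : ℂ))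
  set S := ∑ q ∈ Finset.Icc 1 (modelLevel n), singularTerm n q
  set G := ternarySingularSeries n
  set X := (n : ℝ) ^ 2 / L ^ 4 with hX
  have hX0 : 0 ≤ X := by positivity
  have hXL : (n : ℝ) ^ 2 / L ^ 3 = X * L := by rw [hX]; field_simp
  have hfl : L / 2 ≤ (⌊L⌋₊ : ℝ) := by
    have := Nat.lt_floor_add_one L
    have : (1 : ℝ) ≤ (⌊L⌋₊ : ℝ) := by exact_mod_cast hQ0
    linarith
  have hQL : L / 2 ≤ ((modelLevel n : ℕ) : ℝ) ^ (1 / 4 : ℝ) := by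
    have h1 : (1 : ℝ) ≤ (⌊L⌋₊ : ℝ) := by exact_mod_cast hQ0
    refine hfl.trans ?_
    rw [modelLevel, Nat.cast_pow, ← hLd, ← Real.rpow_natCast, ← Real.rpow_mul (by positivity)]
    exact Real.self_le_rpow_of_one_le h1 (by norm_num)
  have a2' : |G - S| ≤ 2 * C₂ / L := by
    refine a2.trans ?_
    rw [show 2 * C₂ / L = C₂ / (L / 2) by field_simp]
    exact div_le_div_of_nonneg_left hC₂.le (by positivity) hQL
  have hM : ‖(((n : ℝ) ^ 2 / (2 * L ^ 3) : ℝ) : ℂ)‖ = X * L / 2 := by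
    rw [Complex.norm_real, Real.norm_of_nonneg (by positivity), ← hXL]
    field_simp
  have hW : ‖W‖ ≤ (1 + 10 ^ 5) * (X * L) := by
    have h := norm_add_le (W - (((n : ℝ) ^ 2 / (2 * L ^ 3) : ℝ) : ℂ))
      (((n : ℝ) ^ 2 / (2 * L ^ 3) : ℝ) : ℂ)
    rw [sub_add_cancel, hM] at h
    have : X ≤ X * L := le_mul_of_one_le_right hX0 hL
    linarith
  have b2 : ‖((G - S : ℝ) : ℂ) * W‖ ≤ 2 * C₂ * (1 + 10 ^ 5) * X := by
    rw [norm_mul, Complex.norm_real, Real.norm_eq_abs]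
    calc |G - S| * ‖W‖ ≤ 2 * C₂ / L * ((1 + 10 ^ 5) * (X * L)) := by gcongr
      _ = _ := by field_simp
  have b3 : ‖(G : ℂ) * (W - (((n : ℝ) ^ 2 / (2 * L ^ 3) : ℝ) : ℂ))‖ ≤ C₃ * (10 ^ 5 * X) := by
    rw [norm_mul, Complex.norm_real, Real.norm_eq_abs]
    gcongr
  rw [← Real.norm_eq_abs, ← Complex.norm_real]
  calc _ = ‖-(T - ternaryGoldbachReps n) + (T - (S : ℂ) * W) - ((G - S : ℝ) : ℂ) * W +
        (G : ℂ) * (W - (((n : ℝ) ^ 2 / (2 * L ^ 3) : ℝ) : ℂ))‖ := by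
        congr 1; push_cast; ring
    _ ≤ ‖T - ternaryGoldbachReps n‖ + ‖T - (S : ℂ) * W‖ + ‖((G - S : ℝ) : ℂ) * W‖ +
        ‖(G : ℂ) * (W - (((n : ℝ) ^ 2 / (2 * L ^ 3) : ℝ) : ℂ))‖ := by
        refine (norm_add_le _ _).trans (add_le_add_left ?_ _)
        refine (norm_sub_le _ _).trans (add_le_add_left ?_ _)
        refine (norm_add_le _ _).trans (add_le_add_left ?_ _)
        rw [norm_neg]
    _ ≤ _ := by linarith

lemma eventually_two_mul_log_pow_le (k : ℕ) :
    ∀ᶠ n : ℕ in Filter.atTop, 2 * Real.log n ^ k ≤ n := by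
  have h := (Real.isLittleO_pow_log_id_atTop (n := k)).comp_tendsto
    (tendsto_natCast_atTop_atTop (R := ℝ))
  filter_upwards [h.bound (show (0 : ℝ) < 1 / 2 by norm_num)] with n hn
  simp only [Function.comp_apply, id_eq, Real.norm_eq_abs, Nat.abs_cast] at hn
  have := le_abs_self (Real.log n ^ k)
  linarith

theorem exists_abs_ternaryGoldbachReps_sub_main_le : ∃ C : ℝ, 0 < C ∧ ∀ n : ℕ, 3 ≤ n →
    |(ternaryGoldbachReps n : ℝ) -
        ternarySingularSeries n * (n : ℝ) ^ 2 / (2 * (Real.log n) ^ 3)| ≤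
      C * (n : ℝ) ^ 2 / (Real.log n) ^ 4 := by
  obtain ⟨C, hC, h⟩ := exists_abs_ternaryGoldbachReps_sub_le
  obtain ⟨N, hN⟩ := Filter.eventually_atTop.mp (eventually_two_mul_log_pow_le 56)
  set D : ℕ → ℝ := fun n => |(ternaryGoldbachReps n : ℝ) -
    ternarySingularSeries n * (n : ℝ) ^ 2 / (2 * (Real.log n) ^ 3)| with hD
  set E : ℕ → ℝ := fun n => D n / ((n : ℝ) ^ 2 / Real.log n ^ 4) with hE
  have hE0 : ∀ n, 0 ≤ E n := fun n => by simp only [hE, hD]; positivity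
  have hs : 0 ≤ ∑ n ∈ Finset.range N, E n := Finset.sum_nonneg fun n _ => hE0 n
  refine ⟨C + ∑ n ∈ Finset.range N, E n, by positivity, fun n hn => ?_⟩
  have hL := one_le_log_natCast hn
  have hn1 : (1 : ℝ) ≤ n := by exact_mod_cast (by omega : 1 ≤ n)
  have hX : 0 < (n : ℝ) ^ 2 / Real.log n ^ 4 := by positivity
  rw [mul_div_assoc (C + _)]
  rcases lt_or_ge n N with hlt | hge
  · have h1 : E n ≤ ∑ n ∈ Finset.range N, E n :=
      Finset.single_le_sum (fun n _ => hE0 n) (Finset.mem_range.mpr hlt)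
    calc D n = E n * ((n : ℝ) ^ 2 / Real.log n ^ 4) := by
          simp only [hE]; rw [div_mul_cancel₀ _ hX.ne']
      _ ≤ _ := by gcongr; exact h1.trans (le_add_of_nonneg_left hC.le)
  · refine (h n hn (hN n hge)).trans ?_
    gcongr
    linarith

theorem exists_forall_odd_eq_sum_three_primes : ∃ n₀ : ℕ, ∀ n : ℕ, n₀ ≤ n → Odd n →
    ∃ p₁ p₂ p₃ : ℕ, p₁.Prime ∧ p₂.Prime ∧ p₃.Prime ∧ p₁ + p₂ + p₃ = n := by
  obtain ⟨C, hC, h⟩ := exists_abs_ternaryGoldbachReps_sub_main_le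
  refine ⟨max 3 (⌈Real.exp (2 * C)⌉₊ + 1), fun n hn hodd => ?_⟩
  have hn3 : 3 ≤ n := (le_max_left _ _).trans hn
  have hL := one_le_log_natCast hn3
  have hn1 : (1 : ℝ) ≤ n := by exact_mod_cast (by omega : 1 ≤ n)
  have hlog : 2 * C < Real.log n := by
    rw [Real.lt_log_iff_exp_lt (by linarith)]
    exact Nat.lt_of_ceil_lt (Nat.succ_le_iff.mp ((le_max_right _ _).trans hn))
  have hR : ternaryGoldbachReps n ≠ 0 := by
    intro h0
    have h1 := h n hn3
    rw [h0, Nat.cast_zero, zero_sub, abs_neg] at h1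
    have h2 := (le_abs_self _).trans h1
    have h3 := one_le_ternarySingularSeries hodd
    have h4 : (n : ℝ) ^ 2 / (2 * Real.log n ^ 3) ≤ C * (n : ℝ) ^ 2 / Real.log n ^ 4 := by
      refine le_trans ?_ h2
      gcongr
      exact le_mul_of_one_le_left (by positivity) h3
    rw [div_le_div_iff₀ (by positivity) (by positivity)] at h4
    have h5 : (n : ℝ) ^ 2 * Real.log n ^ 3 * Real.log n ≤
        (n : ℝ) ^ 2 * Real.log n ^ 3 * (2 * C) := by linarith
    exact absurd (le_of_mul_le_mul_left h5 (by positivity)) (not_le.mpr hlog)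
  obtain ⟨⟨a, b, c⟩, h1, h2, h3, h4⟩ := Set.nonempty_of_ncard_ne_zero hR
  exact ⟨a, b, c, h1, h2, h3, h4⟩

end ThreePrimes

theorem vinogradov_three_primes :
    (∃ C : ℝ, 0 < C ∧ ∀ n : ℕ, 3 ≤ n →
      |(ternaryGoldbachReps n : ℝ) -
          ternarySingularSeries n * (n : ℝ) ^ 2 / (2 * (Real.log n) ^ 3)| ≤
        C * (n : ℝ) ^ 2 / (Real.log n) ^ 4) ∧
    (∃ n₀ : ℕ, ∀ n : ℕ, n₀ ≤ n → Odd n →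
      ∃ p₁ p₂ p₃ : ℕ, p₁.Prime ∧ p₂.Prime ∧ p₃.Prime ∧ p₁ + p₂ + p₃ = n) :=
  ⟨exists_abs_ternaryGoldbachReps_sub_main_le, exists_forall_odd_eq_sum_three_primes⟩
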